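/- (Proposition 6) Let P′ and X′ be self-adjoint operators and U′ a unitary operator on a Hilbert space H̃, let E(·) be the spectral measure of P′, and suppose there is a linear subspace D₁ ⊆ D(P′X′) ∩ D(X′P′) such that: (i) E([q,1))H̃ ⊆ D₁ and E((−1,−q])H̃ ⊆ D₁; (ii) for all f ∈ D₁: U′P′f = qP′U′f, U′X′f = q⁻¹X′U′f, P′X′f − qX′P′f = i(q^{3/2} − q^{−1/2})U′f and X′P′f − qP′X′f = −i(q^{3/2} − q^{−1/2})U′*f; (iii) the restrictions P′↾D₁ and X′↾D₁ are essentially self-adjoint. Then there exist families {μ₁^{j,+} : j ∈ I₊}, {μ₁^{j,−} : j ∈ I₋} of finite positive Borel measures on [q,1), unitary operators V, W : 𝕳₋ → 𝕳₊, and a unitary operator Θ : H̃ → H such that ΘP′Θ* = P, ΘX′Θ* = X_{V,W} and ΘU′Θ* = U. -/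

import Mathlib

open MeasureTheory

noncomputable section

/-- The Hilbert sum `⊕_j L²(ν j)` of `L²`-spaces, as an `l²`-direct sum. -/
abbrev HS {I : Type*} (ν : I → Measure ℝ) : Type _ := lp (fun j => Lp ℂ 2 (ν j)) 2

/-- The measure `t⁻¹ dμ₁` on `[q,1)`. -/
def wd (μ1 : Measure ℝ) : Measure ℝ := μ1.withDensity fun t => ENNReal.ofReal t⁻¹

/-- `μ` is the measure on `ℝ₊ = (0,∞)` induced by `μ₁` via `μ(qⁿM) = qⁿμ₁(M)`. -/
def IsInducedPlus (q : ℝ) (μ1 μ : Measure ℝ) : Prop :=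
  μ (Set.Ioi (0 : ℝ))ᶜ = 0 ∧
  ∀ M : Set ℝ, MeasurableSet M → M ⊆ Set.Ico q 1 → ∀ n : ℤ,
    μ ((fun t => q ^ n * t) '' M) = ENNReal.ofReal (q ^ n) * μ1 M

/-- `μ` is the measure on `ℝ₋ = (−∞,0)` induced by `μ₁` via `μ(−qⁿM) = qⁿμ₁(M)`. -/
def IsInducedMinus (q : ℝ) (μ1 μ : Measure ℝ) : Prop :=
  μ (Set.Iio (0 : ℝ))ᶜ = 0 ∧
  ∀ M : Set ℝ, MeasurableSet M → M ⊆ Set.Ico q 1 → ∀ n : ℤ,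
    μ ((fun t => -(q ^ n * t)) '' M) = ENNReal.ofReal (q ^ n) * μ1 M

/-- `U` acts componentwise by `(Uf)(t) = q^{1/2} f(qt)`. -/
def IsUop (q : ℝ) {I : Type*} (ν : I → Measure ℝ) (U : HS ν ≃ₗᵢ[ℂ] HS ν) : Prop :=
  ∀ f : HS ν, ∀ j : I, ∀ᵐ t ∂(ν j),
    ((U f : HS ν) j) t = ((q ^ ((1 : ℝ)/2) : ℝ) : ℂ) * ((f : HS ν) j) (q * t)

/-- `P` is the (maximal) multiplication operator `(Pf)(t) = t f(t)`, componentwise. -/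
def IsPop {I : Type*} (ν : I → Measure ℝ) (P : HS ν →ₗ.[ℂ] HS ν) : Prop :=
  (∀ f : HS ν, f ∈ P.domain ↔
    ∃ g : HS ν, ∀ j : I, ∀ᵐ t ∂(ν j), (g j) t = (t : ℂ) * (f j) t) ∧
  (∀ f : P.domain, ∀ j : I, ∀ᵐ t ∂(ν j),
    ((P f) j) t = (t : ℂ) * ((f : HS ν) j) t)

/-- `X` is the symmetric operator `(Xf)(t) = i t⁻¹(f(q⁻¹t) − f(qt))` on
`D(X) = {f : t⁻¹f ∈ H}`, componentwise. -/
def IsXop (q : ℝ) {I : Type*} (ν : I → Measure ℝ) (X : HS ν →ₗ.[ℂ] HS ν) : Prop :=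
  (∀ f : HS ν, f ∈ X.domain ↔
    ∃ g : HS ν, ∀ j : I, ∀ᵐ t ∂(ν j), (g j) t = (t : ℂ)⁻¹ * (f j) t) ∧
  (∀ f : X.domain, ∀ j : I, ∀ᵐ t ∂(ν j),
    ((X f) j) t = Complex.I * (t : ℂ)⁻¹ *
      (((f : HS ν) j) (q⁻¹ * t) - ((f : HS ν) j) (q * t)))

/-- `he` is the "even extension" `h^e` of `h : [q,1) → ℂ` to `ℝ₊`. -/
def IsEvenExt (q : ℝ) (h he : ℝ → ℂ) : Prop :=
  (∀ n : ℕ, ∀ t ∈ Set.Ico q 1, he (q ^ (2 * n) * t) = h t) ∧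
  (∀ t : ℝ, (¬ ∃ n : ℕ, ∃ s ∈ Set.Ico q 1, t = q ^ (2 * n) * s) → he t = 0)

/-- `ho` is the "odd extension" `h^o` of `h : [q,1) → ℂ` to `ℝ₊`. -/
def IsOddExt (q : ℝ) (h ho : ℝ → ℂ) : Prop :=
  (∀ n : ℕ, ∀ t ∈ Set.Ico q 1, ho (q ^ (2 * n + 1) * t) = h t) ∧
  (∀ t : ℝ, (¬ ∃ n : ℕ, ∃ s ∈ Set.Ico q 1, t = q ^ (2 * n + 1) * s) → ho t = 0)

/-- Even extension to the negative half-axis. -/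
def IsEvenExtNeg (q : ℝ) (h he : ℝ → ℂ) : Prop :=
  (∀ n : ℕ, ∀ t ∈ Set.Ico q 1, he (-(q ^ (2 * n) * t)) = h t) ∧
  (∀ t : ℝ, (¬ ∃ n : ℕ, ∃ s ∈ Set.Ico q 1, t = -(q ^ (2 * n) * s)) → he t = 0)

/-- Odd extension to the negative half-axis. -/
def IsOddExtNeg (q : ℝ) (h ho : ℝ → ℂ) : Prop :=
  (∀ n : ℕ, ∀ t ∈ Set.Ico q 1, ho (-(q ^ (2 * n + 1) * t)) = h t) ∧
  (∀ t : ℝ, (¬ ∃ n : ℕ, ∃ s ∈ Set.Ico q 1, t = -(q ^ (2 * n + 1) * s)) → ho t = 0)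

/-- `(be, bo, ce, co) ∈ 𝕳₊ ⊕ 𝕳₊ ⊕ 𝕳₋ ⊕ 𝕳₋` are the boundary vectors
`(𝔣_e^+, 𝔣_o^+, 𝔣_e^−, 𝔣_o^−)` of `𝔣 ∈ D(X*)` coming from the componentwise
decomposition `𝔣 = 𝔣_X + 𝔣^e + 𝔣^o` of Lemma 1. -/
def IsBdry (q : ℝ) {Ip Im : Type*} (μp : Ip → Measure ℝ) (μm : Im → Measure ℝ)
    (μ1p : Ip → Measure ℝ) (μ1m : Im → Measure ℝ)
    (X : HS (Sum.elim μp μm) →ₗ.[ℂ] HS (Sum.elim μp μm))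
    (f : HS (Sum.elim μp μm))
    (be bo : HS (fun j => wd (μ1p j))) (ce co : HS (fun j => wd (μ1m j))) : Prop :=
  f ∈ X.adjoint.domain ∧
  ∃ fX : HS (Sum.elim μp μm), fX ∈ X.domain ∧
    (∀ j : Ip, ∃ he ho : ℝ → ℂ,
      IsEvenExt q (⇑(be j)) he ∧ IsOddExt q (⇑(bo j)) ho ∧
      ∀ᵐ t ∂(μp j), (f (Sum.inl j)) t = (fX (Sum.inl j)) t + he t + ho t) ∧
    (∀ j : Im, ∃ he ho : ℝ → ℂ,
      IsEvenExtNeg q (⇑(ce j)) he ∧ IsOddExtNeg q (⇑(co j)) ho ∧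
      ∀ᵐ t ∂(μm j), (f (Sum.inr j)) t = (fX (Sum.inr j)) t + he t + ho t)

/-- Membership in the domain of `X_{V,W}`: `𝔣 ∈ D(X*)` whose boundary vectors satisfy
`𝔣_e^+ + 𝔣_o^+ = V(𝔣_e^− + 𝔣_o^−)` and `𝔣_e^+ − 𝔣_o^+ = W(𝔣_e^− − 𝔣_o^−)`. -/
def MemXVW (q : ℝ) {Ip Im : Type*} (μp : Ip → Measure ℝ) (μm : Im → Measure ℝ)
    (μ1p : Ip → Measure ℝ) (μ1m : Im → Measure ℝ)
    (X : HS (Sum.elim μp μm) →ₗ.[ℂ] HS (Sum.elim μp μm))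
    (V W : HS (fun j => wd (μ1m j)) ≃ₗᵢ[ℂ] HS (fun j => wd (μ1p j)))
    (f : HS (Sum.elim μp μm)) : Prop :=
  ∃ (be bo : HS (fun j => wd (μ1p j))) (ce co : HS (fun j => wd (μ1m j))),
    IsBdry q μp μm μ1p μ1m X f be bo ce co ∧
    be + bo = V (ce + co) ∧ be - bo = W (ce - co)

/-- The bounded operator `A` commutes with the (possibly unbounded) operator `T`,
i.e. `T A ⊆ A T`. -/
def CommutesPMap {H : Type*} [NormedAddCommGroup H] [InnerProductSpace ℂ H]
    (A : H →L[ℂ] H) (T : H →ₗ.[ℂ] H) : Prop :=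
  ∀ f : T.domain, ∃ h : A f ∈ T.domain, T ⟨A f, h⟩ = A (T f)

/-- `Θ T Θ* = T'` for a unitary `Θ` and (possibly unbounded) operators `T`, `T'`. -/
def TransportsPMap {H H' : Type*} [NormedAddCommGroup H] [InnerProductSpace ℂ H]
    [NormedAddCommGroup H'] [InnerProductSpace ℂ H']
    (Θ : H ≃ₗᵢ[ℂ] H') (T : H →ₗ.[ℂ] H) (T' : H' →ₗ.[ℂ] H') : Prop :=
  (∀ f : T.domain, ∃ h : Θ f ∈ T'.domain, T' ⟨Θ f, h⟩ = Θ (T f)) ∧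
  (∀ g : T'.domain, Θ.symm g ∈ T.domain)


/-- `E` is the spectral measure of the self-adjoint operator `P`: a projection-valued
Borel measure on `ℝ` (σ-additivity is encoded by requiring `S ↦ ‖E(S)f‖²` to extend to a
Borel measure) whose integral is `P`, characterized via quadratic forms. -/
def IsSpectralMeasure {H : Type*} [NormedAddCommGroup H] [InnerProductSpace ℂ H]
    [CompleteSpace H] (P : H →ₗ.[ℂ] H) (E : Set ℝ → (H →L[ℂ] H)) : Prop :=
  (∀ S : Set ℝ, IsSelfAdjoint (E S)) ∧
  (∀ S T : Set ℝ, (E S).comp (E T) = E (S ∩ T)) ∧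
  E Set.univ = 1 ∧
  ∀ f : H, ∃ ν : Measure ℝ,
    (∀ S : Set ℝ, MeasurableSet S → ν S = ENNReal.ofReal (‖E S f‖ ^ 2)) ∧
    ((f ∈ P.domain) ↔ (∫⁻ t, ENNReal.ofReal (t ^ 2) ∂ν) < ⊤) ∧
    (∀ hf : f ∈ P.domain, (@inner ℂ _ _ f (P ⟨f, hf⟩)).re = ∫ t, t ∂ν)

open scoped InnerProductSpace

section GraphFacts

theorem LinearPMap.graph_unique {H : Type*} [AddCommGroup H] [Module ℂ H] {P : H →ₗ.[ℂ] H}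
    {f g g' : H} (h : (f, g) ∈ P.graph) (h' : (f, g') ∈ P.graph) : g = g' :=
  P.mem_graph_snd_inj h h' rfl

variable {H : Type*} [NormedAddCommGroup H] [InnerProductSpace ℂ H] [CompleteSpace H]

theorem IsSelfAdjoint.inner_graph_comm {P : H →ₗ.[ℂ] H} (hP : IsSelfAdjoint P) {f g x y : H}
    (h : (f, g) ∈ P.graph) (h' : (x, y) ∈ P.graph) : ⟪g, x⟫_ℂ = ⟪f, y⟫_ℂ := by
  obtain ⟨a, rfl, rfl⟩ := (P.mem_graph_iff).1 h
  obtain ⟨b, rfl, rfl⟩ := (P.mem_graph_iff).1 h'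
  have := LinearPMap.adjoint_isFormalAdjoint hP.dense_domain
  rw [LinearPMap.isSelfAdjoint_def.1 hP] at this
  exact this a b

theorem IsSelfAdjoint.mem_graph_of_inner {P : H →ₗ.[ℂ] H} (hP : IsSelfAdjoint P) {f g : H}
    (h : ∀ x y, (x, y) ∈ P.graph → ⟪g, x⟫_ℂ = ⟪f, y⟫_ℂ) : (f, g) ∈ P.graph := by
  have h1 : f ∈ P.adjoint.domain :=
    LinearPMap.mem_adjoint_domain_of_exists f ⟨g, fun x => h _ _ (P.mem_graph x)⟩
  have h2 := LinearPMap.adjoint_apply_eq hP.dense_domain ⟨f, h1⟩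
    (x₀ := g) (fun x => h _ _ (P.mem_graph x))
  rw [← LinearPMap.isSelfAdjoint_def.1 hP, LinearPMap.mem_graph_iff]
  exact ⟨⟨f, h1⟩, rfl, h2⟩

theorem IsSelfAdjoint.eq_zero_of_inner_domain {P : H →ₗ.[ℂ] H} (hP : IsSelfAdjoint P) {g : H}
    (h : ∀ x y, (x, y) ∈ P.graph → ⟪x, g⟫_ℂ = 0) : g = 0 := by
  refine hP.dense_domain.eq_zero_of_inner_right ℂ fun v hv => ?_
  exact h _ _ (P.mem_graph ⟨v, hv⟩)

end GraphFacts

namespace IsSpectralMeasure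

variable {H : Type*} [NormedAddCommGroup H] [InnerProductSpace ℂ H] [CompleteSpace H]
  {P : H →ₗ.[ℂ] H} {E F : Set ℝ → (H →L[ℂ] H)}

theorem comp_apply (hE : IsSpectralMeasure P E) (S T : Set ℝ) (f : H) :
    E S (E T f) = E (S ∩ T) f := by
  rw [← hE.2.1 S T]; rfl

theorem inner_comm (hE : IsSpectralMeasure P E) (S : Set ℝ) (f g : H) :
    ⟪E S f, g⟫_ℂ = ⟪f, E S g⟫_ℂ := by
  have h := hE.1 S
  rw [ContinuousLinearMap.isSelfAdjoint_iff_isSymmetric] at h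
  exact h f g

theorem univ_apply (hE : IsSpectralMeasure P E) (f : H) : E Set.univ f = f := by
  rw [hE.2.2.1]; rfl

/-- The scalar spectral measure `S ↦ ‖E(S)f‖²`. -/
def meas (hE : IsSpectralMeasure P E) (f : H) : Measure ℝ := (hE.2.2.2 f).choose

theorem meas_apply (hE : IsSpectralMeasure P E) (f : H) {S : Set ℝ} (hS : MeasurableSet S) :
    hE.meas f S = ENNReal.ofReal (‖E S f‖ ^ 2) :=
  (hE.2.2.2 f).choose_spec.1 S hS

theorem mem_domain_iff (hE : IsSpectralMeasure P E) (f : H) :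
    (∃ g, (f, g) ∈ P.graph) ↔ (∫⁻ t, ENNReal.ofReal (t ^ 2) ∂(hE.meas f)) < ⊤ := by
  rw [← LinearPMap.mem_domain_iff]
  exact (hE.2.2.2 f).choose_spec.2.1

theorem re_inner (hE : IsSpectralMeasure P E) {f g : H} (h : (f, g) ∈ P.graph) :
    (⟪f, g⟫_ℂ).re = ∫ t, t ∂(hE.meas f) := by
  obtain ⟨a, ha, hb⟩ := (P.mem_graph_iff).1 h
  simp only at ha hb
  subst ha hb
  exact (hE.2.2.2 _).choose_spec.2.2 a.2

instance (hE : IsSpectralMeasure P E) (f : H) : IsFiniteMeasure (hE.meas f) :=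
  ⟨by rw [hE.meas_apply f .univ]; exact ENNReal.ofReal_lt_top⟩

theorem empty_apply (hE : IsSpectralMeasure P E) (f : H) : E ∅ f = 0 := by
  have h := hE.meas_apply f MeasurableSet.empty
  rw [measure_empty] at h
  have := ENNReal.ofReal_eq_zero.1 h.symm
  have h2 : ‖E ∅ f‖ ^ 2 = 0 := le_antisymm this (sq_nonneg _)
  simpa using h2

theorem apply_eq_zero_iff (hE : IsSpectralMeasure P E) (f : H) {S : Set ℝ}
    (hS : MeasurableSet S) : E S f = 0 ↔ hE.meas f S = 0 := by
  rw [hE.meas_apply f hS, ENNReal.ofReal_eq_zero]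
  constructor
  · intro h; simp [h]
  · intro h
    have h2 : ‖E S f‖ ^ 2 = 0 := le_antisymm h (sq_nonneg _)
    simpa using h2

theorem add_compl (hE : IsSpectralMeasure P E) {S : Set ℝ} (hS : MeasurableSet S) (f : H) :
    E S f + E Sᶜ f = f := by
  have h1 : E S (f - (E S f + E Sᶜ f)) = 0 := by
    simp [map_sub, map_add, hE.comp_apply, hE.empty_apply]
  have h2 : E Sᶜ (f - (E S f + E Sᶜ f)) = 0 := by
    simp [map_sub, map_add, hE.comp_apply, hE.empty_apply]
  have h3 := (hE.apply_eq_zero_iff _ hS).1 h1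
  have h4 := (hE.apply_eq_zero_iff _ hS.compl).1 h2
  have h5 : hE.meas (f - (E S f + E Sᶜ f)) Set.univ = 0 := by
    rw [← Set.union_compl_self S]; exact measure_union_null h3 h4
  have h6 := (hE.apply_eq_zero_iff _ MeasurableSet.univ).2 h5
  rw [hE.univ_apply] at h6
  exact (sub_eq_zero.1 h6).symm

theorem inner_of_disjoint (hE : IsSpectralMeasure P E) {S T : Set ℝ} (h : S ∩ T = ∅) (f g : H) :
    ⟪E S f, E T g⟫_ℂ = 0 := by
  rw [hE.inner_comm, hE.comp_apply, h, hE.empty_apply, inner_zero_right]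

theorem inner_self_apply (hE : IsSpectralMeasure P E) (S : Set ℝ) (f : H) :
    ⟪E S f, f⟫_ℂ = ((‖E S f‖ ^ 2 : ℝ) : ℂ) := by
  have : E S f = E S (E S f) := by rw [hE.comp_apply, Set.inter_self]
  rw [this, hE.inner_comm, ← this, inner_self_eq_norm_sq_to_K]; simp

theorem union_apply (hE : IsSpectralMeasure P E) {S T : Set ℝ} (hS : MeasurableSet S)
    (h : S ∩ T = ∅) (f : H) : E (S ∪ T) f = E S f + E T f := by
  have := hE.add_compl hS (E (S ∪ T) f)
  rw [hE.comp_apply, hE.comp_apply] at this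
  rw [← this]
  congr 2
  · congr 1; simp
  · congr 1
    ext t
    have : t ∈ S ∩ T → False := by simp [h]
    simp only [Set.mem_inter_iff, Set.mem_compl_iff, Set.mem_union] at *
    tauto

theorem meas_proj (hE : IsSpectralMeasure P E) {S : Set ℝ} (hS : MeasurableSet S) (f : H) :
    hE.meas (E S f) = (hE.meas f).restrict S := by
  ext T hT
  rw [Measure.restrict_apply hT, hE.meas_apply _ hT, hE.meas_apply _ (hT.inter hS),
    hE.comp_apply]

theorem integrable_id (hE : IsSpectralMeasure P E) {f g : H} (h : (f, g) ∈ P.graph) :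
    Integrable (fun t : ℝ => t) (hE.meas f) := by
  have h1 := (hE.mem_domain_iff f).1 ⟨g, h⟩
  have h2 : Integrable (fun t : ℝ => t ^ 2) (hE.meas f) := by
    refine ⟨by fun_prop, ?_⟩
    rw [hasFiniteIntegral_iff_ofReal (ae_of_all _ fun t => sq_nonneg t)]
    exact h1
  refine Integrable.mono' ((integrable_const (1 : ℝ)).add h2) (by fun_prop)
    (ae_of_all _ fun t => ?_)
  simp only [Real.norm_eq_abs, Pi.add_apply]
  rw [← sq_abs]; nlinarith [sq_nonneg (|t| - 1), abs_nonneg t]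

theorem proj_mem_domain (hE : IsSpectralMeasure P E) {S : Set ℝ} (hS : MeasurableSet S)
    {f g : H} (h : (f, g) ∈ P.graph) : ∃ g', (E S f, g') ∈ P.graph := by
  rw [hE.mem_domain_iff, hE.meas_proj hS]
  exact lt_of_le_of_lt (lintegral_mono' Measure.restrict_le_self le_rfl)
    ((hE.mem_domain_iff f).1 ⟨g, h⟩)

theorem re_inner_cross (hP : IsSelfAdjoint P) (hE : IsSpectralMeasure P E) {S : Set ℝ}
    (hS : MeasurableSet S) {f g g₁ g₂ : H} (h : (f, g) ∈ P.graph)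
    (h1 : (E S f, g₁) ∈ P.graph) (h2 : (E Sᶜ f, g₂) ∈ P.graph) :
    (⟪E S f, g₂⟫_ℂ).re = 0 := by
  have hf := hE.add_compl hS f
  have hg : g₁ + g₂ = g := by
    have := P.graph.add_mem h1 h2
    rw [Prod.mk_add_mk, hf] at this
    exact LinearPMap.graph_unique this h
  have e0 := hE.re_inner h
  have e1 := hE.re_inner h1
  have e2 := hE.re_inner h2
  rw [hE.meas_proj hS] at e1
  rw [hE.meas_proj hS.compl] at e2
  rw [← integral_add_compl hS (hE.integrable_id h), ← e1, ← e2, ← hg] at e0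
  nth_rewrite 1 [← hf] at e0
  rw [inner_add_left, inner_add_right, inner_add_right] at e0
  have e3 : (⟪E Sᶜ f, g₁⟫_ℂ).re = (⟪E S f, g₂⟫_ℂ).re := by
    rw [← hP.inner_graph_comm h2 h1, ← inner_conj_symm, Complex.conj_re]
  simp only [Complex.add_re] at e0
  linarith

theorem proj_graph (hP : IsSelfAdjoint P) (hE : IsSpectralMeasure P E) {S : Set ℝ}
    (hS : MeasurableSet S) {f g : H} (h : (f, g) ∈ P.graph) : (E S f, E S g) ∈ P.graph := by
  have key : ∀ {S : Set ℝ} (_ : MeasurableSet S) {f g f' g' g₂ : H} (_ : (f, g) ∈ P.graph)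
      (_ : (f', g') ∈ P.graph) (_ : (E Sᶜ f', g₂) ∈ P.graph), ⟪E S f, g₂⟫_ℂ = 0 := by
    intro S hS f g f' g' g₂ h h' h2
    obtain ⟨g₁, h1⟩ := hE.proj_mem_domain hS h
    have aux : ∀ c : ℂ, (⟪E S (c • f), g₂⟫_ℂ).re = 0 := by
      intro c
      have h1c : (E S (c • f), c • g₁) ∈ P.graph := by
        simpa using P.graph.smul_mem c h1
      have hx := P.graph.add_mem h1c h2
      have e1 : E S (E S (c • f) + E Sᶜ f') = E S (c • f) := by
        rw [map_add, hE.comp_apply, hE.comp_apply]; simp [hE.empty_apply]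
      have e2 : E Sᶜ (E S (c • f) + E Sᶜ f') = E Sᶜ f' := by
        rw [map_add, hE.comp_apply, hE.comp_apply]; simp [hE.empty_apply]
      have := hE.re_inner_cross hP hS hx (g₁ := c • g₁) (g₂ := g₂) (by rw [e1]; exact h1c)
        (by rw [e2]; exact h2)
      rwa [e1] at this
    apply Complex.ext
    · simpa using aux 1
    · have := aux Complex.I
      rw [map_smul, inner_smul_left] at this
      simpa using this
  obtain ⟨g₁, h1⟩ := hE.proj_mem_domain hS h
  obtain ⟨g₂, h2⟩ := hE.proj_mem_domain hS.compl h
  have hg : g₁ + g₂ = g := by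
    have := P.graph.add_mem h1 h2
    rw [Prod.mk_add_mk, hE.add_compl hS f] at this
    exact LinearPMap.graph_unique this h
  have z1 : E S g₂ = 0 := hP.eq_zero_of_inner_domain fun x y hxy => by
    rw [← hE.inner_comm]; exact key hS hxy h h2
  have z2 : E Sᶜ g₁ = 0 := hP.eq_zero_of_inner_domain fun x y hxy => by
    rw [← hE.inner_comm]
    exact key hS.compl hxy h (by rwa [compl_compl])
  have : E S g = g₁ := by
    rw [← hg, map_add, z1, add_zero]
    have := hE.add_compl hS g₁
    rwa [z2, add_zero] at this
  rwa [this]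

theorem meas_null_of_apply_eq (hE : IsSpectralMeasure P E) {S : Set ℝ} (hS : MeasurableSet S)
    {f : H} (hf : E S f = f) : hE.meas f Sᶜ = 0 := by
  rw [← hf, hE.meas_proj hS, Measure.restrict_apply hS.compl]; simp

theorem apply_eq_of_subset (hE : IsSpectralMeasure P E) {S T : Set ℝ} (h : S ⊆ T) {f : H}
    (hf : E S f = f) : E T f = f := by
  rw [← hf, hE.comp_apply, Set.inter_eq_right.2 h]

theorem mem_domain_of_bounded (hE : IsSpectralMeasure P E) {a b : ℝ} {f : H}
    (hf : E (Set.Icc a b) f = f) : ∃ g, (f, g) ∈ P.graph := by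
  rw [hE.mem_domain_iff, ← hf, hE.meas_proj measurableSet_Icc]
  have : ∫⁻ t in Set.Icc a b, ENNReal.ofReal (t ^ 2) ∂(hE.meas f)
      ≤ ∫⁻ t in Set.Icc a b, ENNReal.ofReal (a ^ 2 + b ^ 2) ∂(hE.meas f) := by
    refine setLIntegral_mono measurable_const fun t ht => ENNReal.ofReal_le_ofReal ?_
    rcases le_total 0 t with h | h
    · nlinarith [ht.1, ht.2, sq_nonneg a]
    · nlinarith [ht.1, ht.2, sq_nonneg b]
  refine this.trans_lt ?_
  rw [setLIntegral_const]
  exact ENNReal.mul_lt_top ENNReal.ofReal_lt_top (measure_lt_top _ _)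

theorem meas_real_univ (hE : IsSpectralMeasure P E) (f : H) :
    (hE.meas f).real Set.univ = ‖f‖ ^ 2 := by
  rw [measureReal_def, hE.meas_apply f .univ, hE.univ_apply, ENNReal.toReal_ofReal (sq_nonneg _)]

theorem le_re_inner (hE : IsSpectralMeasure P E) {a b : ℝ} {f g : H}
    (hf : E (Set.Icc a b) f = f) (h : (f, g) ∈ P.graph) : a * ‖f‖ ^ 2 ≤ (⟪f, g⟫_ℂ).re := by
  rw [hE.re_inner h, ← hE.meas_real_univ f]
  have h1 : ∫ _t : ℝ, a ∂(hE.meas f) = a * (hE.meas f).real Set.univ := by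
    simp [mul_comm]
  rw [← h1]
  refine integral_mono_ae (integrable_const _) (hE.integrable_id h) ?_
  have := hE.meas_null_of_apply_eq measurableSet_Icc hf
  have : ∀ᵐ t ∂(hE.meas f), t ∈ Set.Icc a b := this
  filter_upwards [this] with t ht using ht.1

theorem re_inner_le (hE : IsSpectralMeasure P E) {a b : ℝ} {f g : H}
    (hf : E (Set.Icc a b) f = f) (h : (f, g) ∈ P.graph) : (⟪f, g⟫_ℂ).re ≤ b * ‖f‖ ^ 2 := by
  rw [hE.re_inner h, ← hE.meas_real_univ f]
  have h1 : ∫ _t : ℝ, b ∂(hE.meas f) = b * (hE.meas f).real Set.univ := by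
    simp [mul_comm]
  rw [← h1]
  refine integral_mono_ae (hE.integrable_id h) (integrable_const _) ?_
  have := hE.meas_null_of_apply_eq measurableSet_Icc hf
  have : ∀ᵐ t ∂(hE.meas f), t ∈ Set.Icc a b := this
  filter_upwards [this] with t ht using ht.2

theorem norm_sub_smul_le (hP : IsSelfAdjoint P) (hE : IsSpectralMeasure P E) {a b : ℝ}
    (hab : a ≤ b) {f g : H} (hf : E (Set.Icc a b) f = f) (h : (f, g) ∈ P.graph) :
    ‖g - (a : ℂ) • f‖ ≤ (b - a) * ‖f‖ := by
  set u := g - (a : ℂ) • f with hu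
  have hgE : E (Set.Icc a b) g = g := by
    have := hE.proj_graph hP measurableSet_Icc h (S := Set.Icc a b)
    rw [hf] at this
    exact LinearPMap.graph_unique this h
  have huE : E (Set.Icc a b) u = u := by rw [hu, map_sub, map_smul, hf, hgE]
  obtain ⟨w, hw⟩ := hE.mem_domain_of_bounded huE
  have e1 : (⟪f, g⟫_ℂ).re = a * ‖f‖ ^ 2 + (⟪f, u⟫_ℂ).re := by
    rw [hu, inner_sub_right, inner_smul_right, inner_self_eq_norm_sq_to_K]
    simp [← Complex.ofReal_pow]
  have e2 : (⟪u, g⟫_ℂ).re = a * (⟪f, u⟫_ℂ).re + ‖u‖ ^ 2 := by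
    have : g = u + (a : ℂ) • f := by rw [hu]; abel
    rw [this, inner_add_right, inner_smul_right, inner_self_eq_norm_sq_to_K]
    have : (⟪u, f⟫_ℂ).re = (⟪f, u⟫_ℂ).re := by rw [← inner_conj_symm, Complex.conj_re]
    simp only [Complex.add_re, Complex.re_ofReal_mul, this]
    simp [← Complex.ofReal_pow]; ring
  have e3 : (⟪f, w⟫_ℂ).re = (⟪u, g⟫_ℂ).re := by
    rw [← hP.inner_graph_comm h hw, ← inner_conj_symm, Complex.conj_re]
  have main : ∀ s : ℝ, 0 ≤ (b - a) * ‖f‖ ^ 2 - 2 * s * ‖u‖ ^ 2 + s ^ 2 * ((b - a) * ‖u‖ ^ 2) := by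
    intro s
    have hx : (f - (s : ℂ) • u, g - (s : ℂ) • w) ∈ P.graph :=
      P.graph.sub_mem h (P.graph.smul_mem (s : ℂ) hw)
    have hxE : E (Set.Icc a b) (f - (s : ℂ) • u) = f - (s : ℂ) • u := by
      rw [map_sub, map_smul, hf, huE]
    have l1 := hE.le_re_inner hxE hx
    have l2 := hE.re_inner_le hf h
    have l3 := hE.re_inner_le huE hw
    have n1 : ‖f - (s : ℂ) • u‖ ^ 2 = ‖f‖ ^ 2 - 2 * s * (⟪f, u⟫_ℂ).re + s ^ 2 * ‖u‖ ^ 2 := by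
      rw [@norm_sub_sq ℂ, inner_smul_right, norm_smul, RCLike.re_eq_complex_re,
        Complex.re_ofReal_mul, mul_pow]
      simp; ring
    have n2 : (⟪f - (s : ℂ) • u, g - (s : ℂ) • w⟫_ℂ).re
        = (⟪f, g⟫_ℂ).re - 2 * s * (⟪u, g⟫_ℂ).re + s ^ 2 * (⟪u, w⟫_ℂ).re := by
      rw [inner_sub_left, inner_sub_right, inner_sub_right, inner_smul_left, inner_smul_right,
        inner_smul_left, inner_smul_right, Complex.conj_ofReal]
      simp only [Complex.sub_re, Complex.re_ofReal_mul, e3]; ring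
    rw [n1, n2, e2, e1] at l1
    rw [e1] at l2
    have l3' := mul_le_mul_of_nonneg_left l3 (sq_nonneg s)
    linear_combination l1 + l2 + l3'
  have hr : 0 ≤ b - a := sub_nonneg.2 hab
  rcases hr.eq_or_lt with h0 | h0
  · have := main 1
    rw [← h0] at this ⊢
    have : ‖u‖ ^ 2 = 0 := le_antisymm (by nlinarith) (sq_nonneg _)
    have : ‖u‖ = 0 := by simpa using this
    simp [this]
  · have := main (1 / (b - a))
    have h3 : (b - a) * ‖f‖ ^ 2 - 2 * (1 / (b - a)) * ‖u‖ ^ 2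
        + (1 / (b - a)) ^ 2 * ((b - a) * ‖u‖ ^ 2) = (((b - a) * ‖f‖) ^ 2 - ‖u‖ ^ 2) / (b - a) := by
      field_simp; ring
    rw [h3] at this
    have h4 : 0 ≤ ((b - a) * ‖f‖) ^ 2 - ‖u‖ ^ 2 := by
      by_contra hc
      exact absurd this (not_le.2 (div_neg_of_neg_of_pos (not_le.1 hc) h0))
    exact abs_le_of_sq_le_sq' (by linarith) (by positivity) |>.2

theorem comp_Icc_eq_zero_of_lt (hP : IsSelfAdjoint P) (hE : IsSpectralMeasure P E)
    (hF : IsSpectralMeasure P F) {a b c d : ℝ} (hab : a ≤ b) (hbc : b < c) :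
    (E (Set.Icc c d)).comp (F (Set.Icc a b)) = 0 := by
  set T := (E (Set.Icc c d)).comp (F (Set.Icc a b)) with hT
  have hF1 : ∀ f, ‖F (Set.Icc a b) f‖ ≤ ‖f‖ := by
    intro f
    have h := hF.inner_self_apply (Set.Icc a b) f
    have h2 := norm_inner_le_norm (𝕜 := ℂ) (F (Set.Icc a b) f) f
    rw [h] at h2
    simp only [Complex.ofReal_pow, norm_pow, Complex.norm_real, norm_norm] at h2
    by_contra hc
    push Not at hc
    nlinarith [norm_nonneg f]
  have hb : ∀ f, ‖T f‖ ≤ ((b - a) / (c - a) * ‖T‖) * ‖f‖ := by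
    intro f
    set u := F (Set.Icc a b) f with hu
    have huF : F (Set.Icc a b) u = u := by rw [hu, hF.comp_apply, Set.inter_self]
    obtain ⟨g, hg⟩ := hF.mem_domain_of_bounded huF
    have hEg := hE.proj_graph hP (measurableSet_Icc (a := c) (b := d)) hg
    have hEE : E (Set.Icc c d) (E (Set.Icc c d) u) = E (Set.Icc c d) u := by
      rw [hE.comp_apply, Set.inter_self]
    have hgF : F (Set.Icc a b) g = g := by
      have := hF.proj_graph hP (measurableSet_Icc (a := a) (b := b)) hg
      rw [huF] at this
      exact LinearPMap.graph_unique this hg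
    have hTf : T f = E (Set.Icc c d) u := rfl
    set w := g - (a : ℂ) • u with hw
    have hwT : T w = E (Set.Icc c d) g - (a : ℂ) • E (Set.Icc c d) u := by
      have : F (Set.Icc a b) w = w := by rw [hw, map_sub, map_smul, hgF, huF]
      rw [hT, ContinuousLinearMap.comp_apply, this, hw, map_sub, map_smul]
    have l1 := hE.le_re_inner hEE hEg
    have l2 := hF.norm_sub_smul_le hP hab huF hg
    have l3 : (c - a) * ‖T f‖ ^ 2 ≤ ‖T f‖ * ‖T w‖ := by
      have : (⟪T f, T w⟫_ℂ).re ≤ ‖T f‖ * ‖T w‖ :=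
        (Complex.re_le_norm _).trans (norm_inner_le_norm _ _)
      refine le_trans ?_ this
      rw [hwT, hTf, inner_sub_right, inner_smul_right, inner_self_eq_norm_sq_to_K]
      simp only [Complex.sub_re, Complex.re_ofReal_mul]
      simp only [Complex.coe_algebraMap, ← Complex.ofReal_pow, Complex.ofReal_re]
      linarith
    have hca : 0 < c - a := by linarith
    have l4 : (c - a) * ‖T f‖ ≤ ‖T w‖ := by
      rcases (norm_nonneg (T f)).eq_or_lt with h | h
      · rw [← h]; simp
      · nlinarith
    have l5 : ‖T w‖ ≤ ‖T‖ * ((b - a) * ‖f‖) :=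
      (T.le_opNorm w).trans (mul_le_mul_of_nonneg_left
        (l2.trans (mul_le_mul_of_nonneg_left (hF1 f) (by linarith))) (norm_nonneg _))
    rw [div_mul_eq_mul_div, div_mul_eq_mul_div, le_div_iff₀ hca]
    nlinarith
  have h1 := T.opNorm_le_bound (by
    have := norm_nonneg T
    have : 0 ≤ (b - a) / (c - a) := div_nonneg (by linarith) (by linarith)
    positivity) hb
  have h2 : (b - a) / (c - a) < 1 := by rw [div_lt_one (by linarith)]; linarith
  have h3 : ‖T‖ = 0 := by
    by_contra hc
    have : 0 < ‖T‖ := lt_of_le_of_ne (norm_nonneg _) (Ne.symm hc)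
    nlinarith
  exact norm_eq_zero.1 h3

theorem comp_Icc_apply_eq_zero (hP : IsSelfAdjoint P) (hE : IsSpectralMeasure P E)
    (hF : IsSpectralMeasure P F) {a b c d : ℝ} (hab : a ≤ b) (hcd : c ≤ d)
    (h : b < c ∨ d < a) (f : H) : E (Set.Icc c d) (F (Set.Icc a b) f) = 0 := by
  rcases h with h | h
  · exact congrArg (fun T : H →L[ℂ] H => T f) (hE.comp_Icc_eq_zero_of_lt hP hF hab h (d := d))
  · have h0 := hF.comp_Icc_eq_zero_of_lt hP hE hcd h (d := b)
    refine ext_inner_left ℂ fun v => ?_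
    rw [← hE.inner_comm, ← hF.inner_comm, inner_zero_right]
    have : F (Set.Icc a b) (E (Set.Icc c d) v) = 0 :=
      congrArg (fun T : H →L[ℂ] H => T v) h0
    rw [this, inner_zero_left]

theorem apply_Icc_of_apply_Icc (hP : IsSelfAdjoint P) (hE : IsSpectralMeasure P E)
    (hF : IsSpectralMeasure P F) {a b : ℝ} (hab : a ≤ b) (f : H) :
    E (Set.Icc a b) (F (Set.Icc a b) f) = F (Set.Icc a b) f := by
  set u := F (Set.Icc a b) f with hu
  have hn : hE.meas u (Set.Icc a b)ᶜ = 0 := by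
    have hsub : (Set.Icc a b)ᶜ ⊆ (⋃ n : ℕ, Set.Icc (b + 1 / ((n : ℝ) + 1)) (b + 1 + n)) ∪
        (⋃ n : ℕ, Set.Icc (a - 1 - n) (a - 1 / ((n : ℝ) + 1))) := by
      intro t ht
      rw [Set.mem_compl_iff, Set.mem_Icc, not_and_or, not_le, not_le] at ht
      rcases ht with ht | ht
      · right
        obtain ⟨n, hn⟩ := exists_nat_one_div_lt (sub_pos.2 ht)
        obtain ⟨m, hm⟩ := exists_nat_ge (a - t)
        refine Set.mem_iUnion.2 ⟨max n m, ?_, ?_⟩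
        · have : (m : ℝ) ≤ (max n m : ℕ) := by exact_mod_cast le_max_right _ _
          linarith
        · have : 1 / (((max n m : ℕ) : ℝ) + 1) ≤ 1 / ((n : ℝ) + 1) := by
            apply one_div_le_one_div_of_le (by positivity)
            have : (n : ℝ) ≤ (max n m : ℕ) := by exact_mod_cast le_max_left _ _
            linarith
          linarith
      · left
        obtain ⟨n, hn⟩ := exists_nat_one_div_lt (sub_pos.2 ht)
        obtain ⟨m, hm⟩ := exists_nat_ge (t - b)
        refine Set.mem_iUnion.2 ⟨max n m, ?_, ?_⟩
        · have : 1 / (((max n m : ℕ) : ℝ) + 1) ≤ 1 / ((n : ℝ) + 1) := by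
            apply one_div_le_one_div_of_le (by positivity)
            have : (n : ℝ) ≤ (max n m : ℕ) := by exact_mod_cast le_max_left _ _
            linarith
          linarith
        · have : (m : ℝ) ≤ (max n m : ℕ) := by exact_mod_cast le_max_right _ _
          linarith
    refine measure_mono_null hsub (measure_union_null ?_ ?_)
    · refine measure_iUnion_null fun n => ?_
      rw [← hE.apply_eq_zero_iff u measurableSet_Icc]
      have hp : 0 < 1 / ((n : ℝ) + 1) := by positivity
      have hp' : 1 / ((n : ℝ) + 1) ≤ 1 := by
        rw [div_le_one (by positivity)]; linarith [n.cast_nonneg (α := ℝ)]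
      exact hE.comp_Icc_apply_eq_zero hP hF hab (by linarith [n.cast_nonneg (α := ℝ)])
        (Or.inl (by linarith)) f
    · refine measure_iUnion_null fun n => ?_
      rw [← hE.apply_eq_zero_iff u measurableSet_Icc]
      have hp : 0 < 1 / ((n : ℝ) + 1) := by positivity
      have hp' : 1 / ((n : ℝ) + 1) ≤ 1 := by
        rw [div_le_one (by positivity)]; linarith [n.cast_nonneg (α := ℝ)]
      exact hE.comp_Icc_apply_eq_zero hP hF hab (by linarith [n.cast_nonneg (α := ℝ)])
        (Or.inr (by linarith)) f
  have h1 := (hE.apply_eq_zero_iff u measurableSet_Icc.compl).2 hn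
  have h2 := hE.add_compl (measurableSet_Icc (a := a) (b := b)) u
  rwa [h1, add_zero] at h2

/-- The spectral measure of a self-adjoint operator is unique on Borel sets. -/
theorem unique (hP : IsSelfAdjoint P) (hE : IsSpectralMeasure P E)
    (hF : IsSpectralMeasure P F) {S : Set ℝ} (hS : MeasurableSet S) : E S = F S := by
  have hIcc : ∀ a b : ℝ, a ≤ b → E (Set.Icc a b) = F (Set.Icc a b) := by
    intro a b hab
    ext f
    rw [← hF.apply_Icc_of_apply_Icc hP hE hab f]
    refine ext_inner_left ℂ fun v => ?_
    rw [← hF.inner_comm, ← hE.inner_comm, hE.apply_Icc_of_apply_Icc hP hF hab, hF.inner_comm]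
  have hm : ∀ f, hE.meas f = hF.meas f := by
    intro f
    refine Measure.ext_of_Icc _ _ fun a b hab => ?_
    rw [hE.meas_apply _ measurableSet_Icc, hF.meas_apply _ measurableSet_Icc, hIcc a b hab]
  have h1 : (E S : H →ₗ[ℂ] H) = (F S : H →ₗ[ℂ] H) := by
    rw [← ext_inner_map]
    intro f
    have h2 := hE.meas_apply f hS
    rw [hm f, hF.meas_apply f hS, ENNReal.ofReal_eq_ofReal_iff (sq_nonneg _) (sq_nonneg _)] at h2
    rw [ContinuousLinearMap.coe_coe, ContinuousLinearMap.coe_coe, hE.inner_self_apply,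
      hF.inner_self_apply, h2]
  ext f
  exact congrArg (fun T : H →ₗ[ℂ] H => T f) h1

end IsSpectralMeasure

namespace IsSpectralMeasure

variable {H : Type*} [NormedAddCommGroup H] [InnerProductSpace ℂ H] [CompleteSpace H]
  {P : H →ₗ.[ℂ] H} {E : Set ℝ → (H →L[ℂ] H)} {q : ℝ} {U : H ≃ₗᵢ[ℂ] H}

theorem conj_unitary (hq0 : 0 < q) (hE : IsSpectralMeasure P E)
    (hU : ∀ f g, (f, g) ∈ P.graph → (U f, (q : ℂ)⁻¹ • U g) ∈ P.graph)
    (hU' : ∀ f g, (f, g) ∈ P.graph → (U.symm f, (q : ℂ) • U.symm g) ∈ P.graph) :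
    IsSpectralMeasure P (fun S => (U.symm : H →L[ℂ] H).comp
      ((E ((fun t => q * t) ⁻¹' S)).comp (U : H →L[ℂ] H))) := by
  have hqc : (q : ℂ) ≠ 0 := by exact_mod_cast hq0.ne'
  refine ⟨fun S => ?_, fun S T => ?_, ?_, fun f => ?_⟩
  · rw [ContinuousLinearMap.isSelfAdjoint_iff_isSymmetric]
    intro f g
    change ⟪U.symm (E _ (U f)), g⟫_ℂ = ⟪f, U.symm (E _ (U g))⟫_ℂ
    rw [← U.inner_map_map, ← U.inner_map_map f, U.apply_symm_apply, U.apply_symm_apply,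
      hE.inner_comm]
  · ext f
    change U.symm (E _ (U (U.symm (E _ (U f))))) = U.symm (E _ (U f))
    rw [U.apply_symm_apply, hE.comp_apply]; rfl
  · ext f
    change U.symm (E _ (U f)) = f
    rw [Set.preimage_univ, hE.univ_apply, U.symm_apply_apply]
  · have hm : Measurable fun t : ℝ => q * t := by fun_prop
    refine ⟨(hE.meas (U f)).map (fun t => q * t), fun S hS => ?_, ?_, fun hf => ?_⟩
    · rw [Measure.map_apply hm hS, hE.meas_apply _ (hm hS)]
      congr 2
      exact (U.symm.norm_map _).symm
    · rw [LinearPMap.mem_domain_iff, lintegral_map (by fun_prop) hm]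
      have : ∀ t : ℝ, ENNReal.ofReal ((q * t) ^ 2) =
          ENNReal.ofReal (q ^ 2) * ENNReal.ofReal (t ^ 2) :=
        fun t => by rw [mul_pow, ENNReal.ofReal_mul (sq_nonneg _)]
      simp_rw [this]
      rw [lintegral_const_mul _ (by fun_prop)]
      have h2 : (∃ g, (f, g) ∈ P.graph) ↔ (∃ g, (U f, g) ∈ P.graph) := by
        constructor
        · rintro ⟨g, hg⟩; exact ⟨_, hU _ _ hg⟩
        · rintro ⟨g, hg⟩
          have := hU' _ _ hg
          rw [U.symm_apply_apply] at this
          exact ⟨_, this⟩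
      rw [h2, hE.mem_domain_iff]
      have h0 : ENNReal.ofReal (q ^ 2) ≠ 0 := by
        rw [Ne, ENNReal.ofReal_eq_zero, not_le]; positivity
      constructor
      · intro h; exact ENNReal.mul_lt_top ENNReal.ofReal_lt_top h
      · intro h
        by_contra hc
        rw [not_lt, top_le_iff] at hc
        rw [hc, ENNReal.mul_top h0] at h
        exact lt_irrefl _ h
    · rw [integral_map hm.aemeasurable (by fun_prop), integral_const_mul]
      have hg := hU _ _ (P.mem_graph ⟨f, hf⟩)
      rw [← hE.re_inner hg, inner_smul_right, U.inner_map_map, ← Complex.ofReal_inv,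
        Complex.re_ofReal_mul, mul_inv_cancel_left₀ hq0.ne']

theorem map_unitary (hq0 : 0 < q) (hP : IsSelfAdjoint P) (hE : IsSpectralMeasure P E)
    (hU : ∀ f g, (f, g) ∈ P.graph → (U f, (q : ℂ)⁻¹ • U g) ∈ P.graph)
    (hU' : ∀ f g, (f, g) ∈ P.graph → (U.symm f, (q : ℂ) • U.symm g) ∈ P.graph)
    {S : Set ℝ} (hS : MeasurableSet S) (f : H) :
    U (E S f) = E ((fun t => q * t) ⁻¹' S) (U f) := by
  have h := hE.unique hP (hE.conj_unitary hq0 hU hU') hS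
  have h2 : E S f = U.symm (E ((fun t => q * t) ⁻¹' S) (U f)) :=
    congrArg (fun T : H →L[ℂ] H => T f) h
  rw [h2, U.apply_symm_apply]

theorem map_unitary_symm (hq0 : 0 < q) (hP : IsSelfAdjoint P) (hE : IsSpectralMeasure P E)
    (hU : ∀ f g, (f, g) ∈ P.graph → (U f, (q : ℂ)⁻¹ • U g) ∈ P.graph)
    (hU' : ∀ f g, (f, g) ∈ P.graph → (U.symm f, (q : ℂ) • U.symm g) ∈ P.graph)
    {S : Set ℝ} (hS : MeasurableSet S) (f : H) :
    U.symm (E S f) = E ((fun t => q⁻¹ * t) ⁻¹' S) (U.symm f) := by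
  apply U.injective
  have hm : Measurable fun t : ℝ => q⁻¹ * t := by fun_prop
  rw [hE.map_unitary hq0 hP hU hU' (hm hS), U.apply_symm_apply, U.apply_symm_apply]
  congr 2
  ext t
  simp [inv_mul_cancel_left₀ hq0.ne']

theorem map_unitary_zpow (hq0 : 0 < q) (hP : IsSelfAdjoint P) (hE : IsSpectralMeasure P E)
    (hU : ∀ f g, (f, g) ∈ P.graph → (U f, (q : ℂ)⁻¹ • U g) ∈ P.graph)
    (hU' : ∀ f g, (f, g) ∈ P.graph → (U.symm f, (q : ℂ) • U.symm g) ∈ P.graph)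
    (n : ℤ) {S : Set ℝ} (hS : MeasurableSet S) (f : H) :
    (U ^ n) (E S f) = E ((fun t => q ^ n * t) ⁻¹' S) ((U ^ n) f) := by
  induction n generalizing S f with
  | zero => simp
  | succ n ih =>
    have hm : Measurable fun t : ℝ => q ^ (n : ℤ) * t := by fun_prop
    rw [add_comm, zpow_add, zpow_one, LinearIsometryEquiv.coe_mul, Function.comp_apply,
      Function.comp_apply, ih hS, hE.map_unitary hq0 hP hU hU' (hm hS)]
    congr 2
    ext t
    simp only [Set.mem_preimage]
    rw [zpow_add₀ hq0.ne', zpow_one, ← mul_assoc, mul_comm q]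
  | pred n ih =>
    have hm : Measurable fun t : ℝ => q ^ (-(n : ℤ)) * t := by fun_prop
    rw [sub_eq_add_neg, add_comm, zpow_add, LinearIsometryEquiv.coe_mul, Function.comp_apply,
      Function.comp_apply, ih hS]
    have : U ^ (-1 : ℤ) = U.symm := by simp; rfl
    rw [this, hE.map_unitary_symm hq0 hP hU hU' (hm hS)]
    congr 2
    ext t
    simp only [Set.mem_preimage]
    rw [zpow_add₀ hq0.ne', zpow_neg_one, ← mul_assoc, mul_comm q⁻¹]

theorem apply_singleton_zero (hP : IsSelfAdjoint P) (hE : IsSpectralMeasure P E)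
    (hker : ∀ f, (f, (0 : H)) ∈ P.graph → f = 0) (f : H) : E {0} f = 0 := by
  have h0 : E (Set.Icc 0 0) (E {0} f) = E {0} f := by
    rw [hE.comp_apply]; simp
  obtain ⟨g, hg⟩ := hE.mem_domain_of_bounded h0
  have h1 := hE.norm_sub_smul_le hP le_rfl h0 hg
  have h2 : g = 0 := by simpa using h1
  rw [h2] at hg
  exact hker _ hg

end IsSpectralMeasure

section Core

variable {H : Type*} [NormedAddCommGroup H] [InnerProductSpace ℂ H] [CompleteSpace H]

/-- A closed condition on graph points that holds over a core holds on the whole graph. -/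
theorem IsSelfAdjoint.graph_induction {P : H →ₗ.[ℂ] H} (hP : IsSelfAdjoint P)
    {D : Submodule ℂ H} (hcore : (P.domRestrict D).closure = P) {p : H × H → Prop}
    (hclosed : IsClosed {x | p x})
    (hD : ∀ f g, f ∈ D → (f, g) ∈ P.graph → p (f, g)) {x : H × H} (hx : x ∈ P.graph) : p x := by
  have hle : P.domRestrict D ≤ P := LinearPMap.domRestrict_le
  have hcl : (P.domRestrict D).IsClosable := hP.isClosed.isClosable.leIsClosable hle
  rw [← hcore, ← hcl.graph_closure_eq_closure_graph] at hx
  have hsub : ((P.domRestrict D).graph : Set (H × H)) ⊆ {x | p x} := by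
    rintro ⟨f, g⟩ hfg
    have h1 := LinearPMap.le_graph_of_le hle hfg
    have h2 : f ∈ (P.domRestrict D).domain := LinearPMap.mem_domain_of_mem_graph hfg
    exact hD f g h2.1 h1
  exact closure_minimal hsub hclosed hx

theorem IsSelfAdjoint.isClosed_graph {P : H →ₗ.[ℂ] H} (hP : IsSelfAdjoint P) :
    IsClosed (P.graph : Set (H × H)) := hP.isClosed

theorem IsSelfAdjoint.graph_map_of_core {P : H →ₗ.[ℂ] H} (hP : IsSelfAdjoint P)
    {D : Submodule ℂ H} (hcore : (P.domRestrict D).closure = P) (U : H ≃ₗᵢ[ℂ] H) (c : ℂ)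
    (hD : ∀ f g, f ∈ D → (f, g) ∈ P.graph → (U f, c • U g) ∈ P.graph) {f g : H}
    (h : (f, g) ∈ P.graph) : (U f, c • U g) ∈ P.graph := by
  refine hP.graph_induction hcore (p := fun x => (U x.1, c • U x.2) ∈ P.graph) ?_ hD h
  exact hP.isClosed_graph.preimage (f := fun x : H × H => (U x.1, c • U x.2)) (by fun_prop)

theorem IsSelfAdjoint.graph_map_symm {P : H →ₗ.[ℂ] H} (hP : IsSelfAdjoint P)
    (U : H ≃ₗᵢ[ℂ] H) {c : ℝ} (hc : c ≠ 0)
    (hU : ∀ f g, (f, g) ∈ P.graph → (U f, (c : ℂ)⁻¹ • U g) ∈ P.graph) {f g : H}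
    (h : (f, g) ∈ P.graph) : (U.symm f, (c : ℂ) • U.symm g) ∈ P.graph := by
  refine hP.mem_graph_of_inner fun x y hxy => ?_
  have h1 := hP.inner_graph_comm h (hU _ _ hxy)
  rw [inner_smul_right] at h1
  rw [inner_smul_left, ← U.inner_map_map, U.apply_symm_apply, ← U.inner_map_map (U.symm f),
    U.apply_symm_apply, h1, Complex.conj_ofReal, ← mul_assoc,
    mul_inv_cancel₀ (by exact_mod_cast hc), one_mul]

end Core

/-- The algebraic relations between `P`, `X` and `U`, in graph form, where `r = q^{1/2}`. -/
structure IsQTriple {H : Type*} [NormedAddCommGroup H] [InnerProductSpace ℂ H] [CompleteSpace H]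
    (r : ℝ) (P X : H →ₗ.[ℂ] H) (U : H ≃ₗᵢ[ℂ] H) : Prop where
  pos : 0 < r
  lt_one : r < 1
  selfAdjoint_P : IsSelfAdjoint P
  selfAdjoint_X : IsSelfAdjoint X
  P_U : ∀ f g, (f, g) ∈ P.graph → (U f, ((r ^ 2 : ℝ) : ℂ)⁻¹ • U g) ∈ P.graph
  X_U : ∀ f g, (f, g) ∈ X.graph → (U f, ((r ^ 2 : ℝ) : ℂ) • U g) ∈ X.graph
  X_P : ∀ f g, (f, g) ∈ P.graph →
    (g, Complex.I • ((r : ℂ)⁻¹ • U.symm f - (r : ℂ) • U f)) ∈ X.graph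
  ker_P : ∀ f, (f, (0 : H)) ∈ P.graph → f = 0

namespace IsQTriple

section Core

variable {H : Type*} [NormedAddCommGroup H] [InnerProductSpace ℂ H] [CompleteSpace H]
  {r : ℝ} {P X : H →ₗ.[ℂ] H} {U : H ≃ₗᵢ[ℂ] H}

theorem of_core (hr0 : 0 < r) (hr1 : r < 1) (hP : IsSelfAdjoint P) (hX : IsSelfAdjoint X)
    {D : Submodule ℂ H} (hcP : (P.domRestrict D).closure = P)
    (hcX : (X.domRestrict D).closure = X)
    (hPU : ∀ f g, f ∈ D → (f, g) ∈ P.graph → (U f, ((r ^ 2 : ℝ) : ℂ)⁻¹ • U g) ∈ P.graph)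
    (hXU : ∀ f g, f ∈ D → (f, g) ∈ X.graph → (U f, ((r ^ 2 : ℝ) : ℂ) • U g) ∈ X.graph)
    (hXP : ∀ f g, f ∈ D → (f, g) ∈ P.graph →
      (g, Complex.I • ((r : ℂ)⁻¹ • U.symm f - (r : ℂ) • U f)) ∈ X.graph)
    (hPX : ∀ f, f ∈ D → ∃ g,
      (g, Complex.I • ((r : ℂ) • U.symm f - (r : ℂ)⁻¹ • U f)) ∈ P.graph) :
    IsQTriple r P X U where
  pos := hr0
  lt_one := hr1
  selfAdjoint_P := hP
  selfAdjoint_X := hX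
  P_U _ _ h := hP.graph_map_of_core hcP U _ hPU h
  X_U _ _ h := hX.graph_map_of_core hcX U _ hXU h
  X_P f g h := by
    refine hP.graph_induction hcP (p := fun x => (x.2, Complex.I •
      ((r : ℂ)⁻¹ • U.symm x.1 - (r : ℂ) • U x.1)) ∈ X.graph) ?_ hXP h
    exact hX.isClosed_graph.preimage (f := fun x : H × H => (x.2, Complex.I •
      ((r : ℂ)⁻¹ • U.symm x.1 - (r : ℂ) • U x.1))) (by fun_prop)
  ker_P g hg := by
    have key : (r : ℂ) • U g - (r : ℂ)⁻¹ • U.symm g = 0 := by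
      refine hP.eq_zero_of_inner_domain fun x y hxy => ?_
      refine hP.graph_induction hcP (p := fun x : H × H =>
        ⟪x.1, (r : ℂ) • U g - (r : ℂ)⁻¹ • U.symm g⟫_ℂ = 0) ?_ ?_ hxy
      · exact isClosed_eq (by fun_prop) (by fun_prop)
      · intro f _ hf _
        obtain ⟨h, hh⟩ := hPX f hf
        have := hP.inner_graph_comm hh hg
        rw [inner_zero_right, inner_smul_left, mul_eq_zero] at this
        have := this.resolve_left (by simp)
        rw [inner_sub_left, inner_smul_left, inner_smul_left, ← Complex.ofReal_inv,
          Complex.conj_ofReal, Complex.conj_ofReal, ← U.inner_map_map,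
          ← U.symm.inner_map_map (U f), U.apply_symm_apply, U.symm_apply_apply] at this
        dsimp only
        rw [inner_sub_right, inner_smul_right, inner_smul_right, ← Complex.ofReal_inv]
        exact this
    have hn : r * ‖g‖ = r⁻¹ * ‖g‖ := by
      have := congrArg norm (sub_eq_zero.1 key)
      rwa [norm_smul, norm_smul, U.norm_map, U.symm.norm_map, norm_inv, Complex.norm_real,
        Real.norm_of_nonneg hr0.le] at this
    have h1 : r < r⁻¹ := hr1.trans ((one_lt_inv₀ hr0).2 hr1)
    by_contra h0
    have := mul_right_cancel₀ (norm_ne_zero_iff.2 h0) hn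
    exact h1.ne this

end Core

end IsQTriple

section Lagrangian

variable {A C : Type*} [NormedAddCommGroup A] [InnerProductSpace ℂ A] [CompleteSpace A]
  [NormedAddCommGroup C] [InnerProductSpace ℂ C] [CompleteSpace C]

/-- A subspace that equals its own annihilator for `⟪a, a'⟫_ℂ - ⟪c, c'⟫_ℂ` is the graph of a
unitary. -/
theorem exists_unitary_of_lagrangian (L : Submodule ℂ (A × C))
    (hL : ∀ p, p ∈ L ↔ ∀ p' ∈ L, ⟪p.1, p'.1⟫_ℂ = ⟪p.2, p'.2⟫_ℂ) :
    ∃ V : C ≃ₗᵢ[ℂ] A, ∀ p : A × C, p ∈ L ↔ p.1 = V p.2 := by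
  have hnorm : ∀ p ∈ L, ‖p.1‖ = ‖p.2‖ := fun p hp => by
    have h := (hL p).1 hp p hp
    rw [inner_self_eq_norm_sq_to_K, inner_self_eq_norm_sq_to_K] at h
    have h' : ‖p.1‖ ^ 2 = ‖p.2‖ ^ 2 := by exact_mod_cast h
    exact (sq_eq_sq₀ (norm_nonneg _) (norm_nonneg _)).1 h'
  have hclosed : IsClosed (L : Set (A × C)) := by
    have : (L : Set (A × C)) =
        ⋂ p' : L, {p | ⟪p.1, (p' : A × C).1⟫_ℂ = ⟪p.2, (p' : A × C).2⟫_ℂ} := by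
      ext p
      simp only [SetLike.mem_coe, Set.mem_iInter, Set.mem_ofPred_eq, Subtype.forall]
      exact hL p
    rw [this]
    exact isClosed_iInter fun p' => isClosed_eq (by fun_prop) (by fun_prop)
  have hcomplete : CompleteSpace L := hclosed.completeSpace_coe
  let f₁ : L →ₗᵢ[ℂ] A := ⟨(LinearMap.fst ℂ A C).comp L.subtype, fun p => by
    have := hnorm p p.2
    rw [Submodule.coe_norm, Prod.norm_def, ← this, max_self]; rfl⟩
  let f₂ : L →ₗᵢ[ℂ] C := ⟨(LinearMap.snd ℂ A C).comp L.subtype, fun p => by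
    have := hnorm p p.2
    rw [Submodule.coe_norm, Prod.norm_def, this, max_self]; rfl⟩
  have h₁ : Function.Surjective f₁ := by
    have hr : IsClosed (LinearMap.range f₁.toLinearMap : Set A) := by
      rw [LinearMap.coe_range]
      exact f₁.isometry.isClosedEmbedding.isClosed_range
    have hr' : CompleteSpace (LinearMap.range f₁.toLinearMap) := hr.completeSpace_coe
    refine LinearMap.range_eq_top.1 ((Submodule.orthogonal_eq_bot_iff).1 ?_)
    rw [Submodule.eq_bot_iff]
    intro a ha
    have h0 : ((a, 0) : A × C) ∈ L := by
      rw [hL]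
      intro p' hp'
      rw [inner_zero_left]
      exact (Submodule.mem_orthogonal' _ _).1 ha _ ⟨⟨p', hp'⟩, rfl⟩
    simpa using hnorm _ h0
  have h₂ : Function.Surjective f₂ := by
    have hr : IsClosed (LinearMap.range f₂.toLinearMap : Set C) := by
      rw [LinearMap.coe_range]
      exact f₂.isometry.isClosedEmbedding.isClosed_range
    have hr' : CompleteSpace (LinearMap.range f₂.toLinearMap) := hr.completeSpace_coe
    refine LinearMap.range_eq_top.1 ((Submodule.orthogonal_eq_bot_iff).1 ?_)
    rw [Submodule.eq_bot_iff]
    intro c hc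
    have h0 : ((0, c) : A × C) ∈ L := by
      rw [hL]
      intro p' hp'
      rw [inner_zero_left]
      exact ((Submodule.mem_orthogonal' _ _).1 hc _ ⟨⟨p', hp'⟩, rfl⟩).symm
    simpa using (hnorm _ h0).symm
  let e₁ := LinearIsometryEquiv.ofSurjective f₁ h₁
  let e₂ := LinearIsometryEquiv.ofSurjective f₂ h₂
  refine ⟨e₂.symm.trans e₁, fun p => ⟨fun hp => ?_, fun hp => ?_⟩⟩
  · have : e₂ ⟨p, hp⟩ = p.2 := rfl
    rw [LinearIsometryEquiv.trans_apply, ← this, e₂.symm_apply_apply]; rfl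
  · have h3 : e₂ (e₂.symm p.2) = p.2 := e₂.apply_symm_apply _
    have : p = ((e₂.symm p.2 : L) : A × C) := Prod.ext hp h3.symm
    rw [this]; exact (e₂.symm p.2).2

end Lagrangian

theorem LinearIsometryEquiv.exists_resolvent {H : Type*} [NormedAddCommGroup H]
    [NormedSpace ℂ H] [CompleteSpace H] (W : H ≃ₗᵢ[ℂ] H) {c : ℝ} (hc0 : 0 ≤ c) (hc1 : c < 1) :
    ∃ R : H →L[ℂ] H, (∀ f, R f - (c : ℂ) • W (R f) = f) ∧ ∀ f, R (f - (c : ℂ) • W f) = f := by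
  have hn : ‖(c : ℂ) • (W : H →L[ℂ] H)‖ < 1 := by
    rw [norm_smul, Complex.norm_real, Real.norm_of_nonneg hc0]
    have : ‖(W : H →L[ℂ] H)‖ ≤ 1 :=
      ContinuousLinearMap.opNorm_le_bound _ zero_le_one fun x => by
        rw [one_mul]; exact (W.norm_map x).le
    nlinarith [norm_nonneg (W : H →L[ℂ] H)]
  let u := Units.oneSub ((c : ℂ) • (W : H →L[ℂ] H)) hn
  refine ⟨(↑u⁻¹ : H →L[ℂ] H), fun f => ?_, fun f => ?_⟩
  · have := congrArg (fun T : H →L[ℂ] H => T f) u.mul_inv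
    exact this
  · have := congrArg (fun T : H →L[ℂ] H => T f) u.inv_mul
    exact this

theorem LinearPMap.graph_sub_mem {H : Type*} [NormedAddCommGroup H] [InnerProductSpace ℂ H]
    {P : H →ₗ.[ℂ] H} {f g f' g' : H} (h : (f, g) ∈ P.graph) (h' : (f', g') ∈ P.graph) :
    (f - f', g - g') ∈ P.graph := P.graph.sub_mem h h'

theorem LinearPMap.graph_add_mem {H : Type*} [NormedAddCommGroup H] [InnerProductSpace ℂ H]
    {P : H →ₗ.[ℂ] H} {f g f' g' : H} (h : (f, g) ∈ P.graph) (h' : (f', g') ∈ P.graph) :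
    (f + f', g + g') ∈ P.graph := P.graph.add_mem h h'

theorem LinearPMap.graph_smul_mem {H : Type*} [NormedAddCommGroup H] [InnerProductSpace ℂ H]
    {P : H →ₗ.[ℂ] H} {f g : H} (c : ℂ) (h : (f, g) ∈ P.graph) :
    (c • f, c • g) ∈ P.graph := P.graph.smul_mem c h

/-- Boundary data for the extension problem: `Q` is the spectral projection of `P` for
`(-1, 1)`, and `ι`, `j` embed the two boundary spaces into the layer where `q ≤ |t| < 1`. -/
structure IsBoundaryData {H A C : Type*} [NormedAddCommGroup H] [InnerProductSpace ℂ H]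
    [NormedAddCommGroup A] [InnerProductSpace ℂ A] [NormedAddCommGroup C] [InnerProductSpace ℂ C]
    (r : ℝ) (P : H →ₗ.[ℂ] H) (U : H ≃ₗᵢ[ℂ] H) (Q : H →L[ℂ] H) (ι j : A × C →ₗ[ℂ] H) : Prop where
  Q_idem : ∀ f, Q (Q f) = Q f
  Q_symm : ∀ f g, @inner ℂ _ _ (Q f) g = @inner ℂ _ _ f (Q g)
  Q_U : ∀ f, Q (U.symm (Q f)) = U.symm (Q f)
  P_Q : ∀ f g, (f, g) ∈ P.graph → (Q f, Q g) ∈ P.graph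
  dom_Q : ∀ f, ∃ g, (Q f, g) ∈ P.graph
  ran_Q : ∀ f, ∃ k, (k, f - Q f) ∈ P.graph
  j_ι : ∀ z, (j z, ι z) ∈ P.graph
  Q_ι : ∀ z, Q (ι z) = ι z
  Q_U_j : ∀ z, Q (U (j z)) = 0
  form : ∀ z w, @inner ℂ _ _ (j z) (ι w) = @inner ℂ _ _ z.1 w.1 - @inner ℂ _ _ z.2 w.2
  surj : ∀ k, Q k = k → Q (U (U k)) = 0 → ∃ z z', k = ι z + (r : ℂ) • U.symm (ι z')

theorem IsBoundaryData.Q_kappa {H A C : Type*} [NormedAddCommGroup H] [InnerProductSpace ℂ H]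
    [NormedAddCommGroup A] [InnerProductSpace ℂ A] [NormedAddCommGroup C] [InnerProductSpace ℂ C]
    {r : ℝ} {P : H →ₗ.[ℂ] H} {U : H ≃ₗᵢ[ℂ] H} {Q : H →L[ℂ] H} {ι j : A × C →ₗ[ℂ] H}
    (B : IsBoundaryData r P U Q ι j) (z z' : A × C) :
    Q (ι z + (r : ℂ) • U.symm (ι z')) = ι z + (r : ℂ) • U.symm (ι z') := by
  rw [map_add, map_smul, B.Q_ι, ← B.Q_ι z', B.Q_U, B.Q_ι]

namespace IsQTriple

variable {H A C : Type*} [NormedAddCommGroup H] [InnerProductSpace ℂ H] [CompleteSpace H]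
  [NormedAddCommGroup A] [InnerProductSpace ℂ A]
  [NormedAddCommGroup C] [InnerProductSpace ℂ C]
  {r : ℝ} {P X : H →ₗ.[ℂ] H} {U : H ≃ₗᵢ[ℂ] H} {Q : H →L[ℂ] H} {ι j : A × C →ₗ[ℂ] H}

theorem r_ne_zero (T : IsQTriple r P X U) : (r : ℂ) ≠ 0 := by exact_mod_cast T.pos.ne'

theorem sq_lt_one (T : IsQTriple r P X U) : r ^ 2 < 1 := by
  have := T.pos; have := T.lt_one; nlinarith

theorem P_U_symm (T : IsQTriple r P X U) {f g : H} (h : (f, g) ∈ P.graph) :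
    (U.symm f, ((r ^ 2 : ℝ) : ℂ) • U.symm g) ∈ P.graph :=
  T.selfAdjoint_P.graph_map_symm U (by have := T.pos; positivity) T.P_U h

theorem X_U_symm (T : IsQTriple r P X U) {f g : H} (h : (f, g) ∈ X.graph) :
    (U.symm f, (((r ^ 2)⁻¹ : ℝ) : ℂ) • U.symm g) ∈ X.graph := by
  refine T.selfAdjoint_X.graph_map_symm U (by have := T.pos; positivity) ?_ h
  intro f g h
  simpa using T.X_U _ _ h

theorem ker_P' (T : IsQTriple r P X U) {f f' g : H} (h : (f, g) ∈ P.graph)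
    (h' : (f', g) ∈ P.graph) : f = f' := by
  have := LinearPMap.graph_sub_mem h h'
  rw [sub_self] at this
  exact sub_eq_zero.1 (T.ker_P _ this)

/-- The adjoint relation: `X f = g` forces `P g = -i r⁻¹ U (f - r² U⁻² f)`. -/
theorem P_X (T : IsQTriple r P X U) {f g : H} (h : (f, g) ∈ X.graph) :
    (g, (-Complex.I * (r : ℂ)⁻¹) • U (f - ((r ^ 2 : ℝ) : ℂ) • U.symm (U.symm f))) ∈ P.graph := by
  have hr := T.r_ne_zero
  refine T.selfAdjoint_P.mem_graph_of_inner fun x y hxy => ?_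
  rw [T.selfAdjoint_X.inner_graph_comm h (T.X_P x y hxy), inner_smul_left, inner_smul_right,
    U.inner_map_eq_flip, inner_sub_left, inner_sub_right, inner_smul_left, inner_smul_right,
    inner_smul_right, U.symm.inner_map_eq_flip, U.symm.inner_map_eq_flip, U.symm_symm,
    U.apply_symm_apply,
    Complex.conj_ofReal, map_mul, map_neg, Complex.conj_I, ← Complex.ofReal_inv,
    Complex.conj_ofReal]
  push_cast
  field_simp

theorem eq_of_resolvent (T : IsQTriple r P X U) {f k e : H}
    (h : f - ((r ^ 2 : ℝ) : ℂ) • U.symm (U.symm f) = k)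
    (he : e - ((r ^ 2 : ℝ) : ℂ) • U.symm (U.symm e) = k) : f = e := by
  obtain ⟨R, -, hR⟩ := (U.symm * U.symm).exists_resolvent (sq_nonneg r) T.sq_lt_one
  rw [← hR f, ← hR e]
  exact congrArg R (h.trans he.symm)

/-- The value of `X` at a vector `y = (1 - r² U⁻²)⁻¹ k`. -/
theorem X_resolvent (T : IsQTriple r P X U) {y k g h : H}
    (hy : y - ((r ^ 2 : ℝ) : ℂ) • U.symm (U.symm y) = k) (hg : (y, g) ∈ X.graph)
    (hh : (h, (-Complex.I * (r : ℂ)⁻¹) • U k) ∈ P.graph) : g = h := by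
  have := T.P_X hg
  rw [hy] at this
  exact T.ker_P' this hh

theorem decomp (T : IsQTriple r P X U) (B : IsBoundaryData r P U Q ι j) {f g : H}
    (h : (f, g) ∈ X.graph) : ∃ x p y z z', (x, p) ∈ P.graph ∧
      y - ((r ^ 2 : ℝ) : ℂ) • U.symm (U.symm y) = ι z + (r : ℂ) • U.symm (ι z') ∧ f = p + y := by
  have hr := T.r_ne_zero
  have hq : ((r ^ 2 : ℝ) : ℂ) ≠ 0 := by push_cast; exact pow_ne_zero 2 hr
  set c : ℂ := ((r ^ 2 : ℝ) : ℂ) with hc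
  have hc2 : c = (r : ℂ) ^ 2 := by rw [hc]; push_cast; rfl
  -- `k'` solves `P k' = f - r² U⁻² f`
  obtain ⟨k', hk'⟩ : ∃ k', (k', f - c • U.symm (U.symm f)) ∈ P.graph := by
    have h1 := T.P_U_symm (T.P_X h)
    rw [map_smul, U.symm_apply_apply] at h1
    have h2 := LinearPMap.graph_smul_mem (Complex.I / r) h1
    refine ⟨(Complex.I / r) • U.symm g, ?_⟩
    have h3 : (Complex.I / r) • c • (-Complex.I * (r : ℂ)⁻¹) • (f - c • U.symm (U.symm f)) =
        f - c • U.symm (U.symm f) := by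
      rw [smul_smul, smul_smul]
      convert one_smul ℂ _ using 2
      rw [hc2]
      field_simp
      simp
    rwa [h3] at h2
  obtain ⟨R, hR, -⟩ := (U * U).exists_resolvent (sq_nonneg r) T.sq_lt_one
  rw [← hc] at hR
  set k := -(c • R (U (U k'))) with hk
  have hkk : U (U k') = U (U k) - c⁻¹ • k := by
    have h1 := hR (U (U k'))
    change R (U (U k')) - c • U (U (R (U (U k')))) = _ at h1
    rw [hk, smul_neg, smul_smul, inv_mul_cancel₀ hq, one_smul, map_neg, map_neg, map_smul,
      map_smul]
    nth_rw 1 [← h1]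
    abel
  obtain ⟨p, hp⟩ := B.dom_Q k
  obtain ⟨x, hx⟩ := B.ran_Q f
  have hQp : Q p = p := by
    have := B.P_Q _ _ hp
    rw [B.Q_idem] at this
    exact LinearPMap.graph_unique this hp
  have hQUU : ∀ f, Q (U (U (Q f))) = Q (U (U f)) := fun f => by
    refine ext_inner_right ℂ fun v => ?_
    have h2 : Q (U.symm (U.symm (Q v))) = U.symm (U.symm (Q v)) := by
      rw [← B.Q_U v, B.Q_U]
    rw [B.Q_symm, U.inner_map_eq_flip, U.inner_map_eq_flip, B.Q_symm, h2, B.Q_symm,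
      U.inner_map_eq_flip, U.inner_map_eq_flip]
  have key : Q (U (U (f - c • U.symm (U.symm f)))) = Q (U (U p)) - c • p := by
    have h1 := B.P_Q _ _ (T.P_U _ _ (T.P_U _ _ hk'))
    have h2 := LinearPMap.graph_sub_mem (B.P_Q _ _ (T.P_U _ _ (T.P_U _ _ hp)))
      (LinearPMap.graph_smul_mem c⁻¹ hp)
    rw [hQUU, ← map_smul, ← map_sub, ← hkk] at h2
    have h3 := congrArg (fun v => c • c • v) (LinearPMap.graph_unique h1 h2)
    simp only [← hc, map_smul, smul_sub, smul_inv_smul₀ hq] at h3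
    exact h3
  obtain ⟨z, z', hz⟩ := B.surj (Q f - p - c • U.symm (U.symm (Q f - p))) (by
    have h1 : Q (Q f - p) = Q f - p := by rw [map_sub, B.Q_idem, hQp]
    have h2 : Q (U.symm (U.symm (Q (Q f - p)))) = U.symm (U.symm (Q (Q f - p))) := by
      rw [← B.Q_U (Q f - p), B.Q_U]
    rw [h1] at h2
    rw [map_sub, map_smul, h1, h2]) (by
    simp only [map_sub, map_smul, U.apply_symm_apply, hQUU, B.Q_idem, hQp] at key ⊢
    linear_combination (norm := module) key)
  refine ⟨x + Q k, f - Q f + p, Q f - p, z, z', LinearPMap.graph_add_mem hx hp, hz, by abel⟩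

theorem Q_resolvent (T : IsQTriple r P X U) (B : IsBoundaryData r P U Q ι j) {y k : H}
    (hy : y - ((r ^ 2 : ℝ) : ℂ) • U.symm (U.symm y) = k) (hk : Q k = k) : Q y = y := by
  have hQU2 : ∀ f, Q (U.symm (U.symm (Q f))) = U.symm (U.symm (Q f)) := fun f => by
    rw [← B.Q_U f, B.Q_U]
  set c : ℂ := ((r ^ 2 : ℝ) : ℂ) with hc
  set d := y - Q y with hd
  have h1 : d = c • (U.symm (U.symm d) - Q (U.symm (U.symm d))) := by
    have e1 : y = k + c • U.symm (U.symm y) := by rw [← hy]; abel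
    have e2 : Q y = k + c • Q (U.symm (U.symm y)) := by
      nth_rw 1 [e1]
      rw [map_add, map_smul, hk]
    rw [hd, map_sub, map_sub, map_sub, hQU2]
    nth_rw 1 [e1]
    nth_rw 1 [e2]
    module
  have h2 : ‖d‖ ≤ r ^ 2 * ‖d‖ := by
    nth_rw 1 [h1]
    rw [norm_smul, hc, Complex.norm_real, Real.norm_of_nonneg (sq_nonneg r)]
    refine mul_le_mul_of_nonneg_left ?_ (sq_nonneg r)
    set w := U.symm (U.symm d)
    have h3 : ‖w‖ = ‖d‖ := by rw [U.symm.norm_map, U.symm.norm_map]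
    rw [← h3]
    have h4 : ‖w‖ * ‖w‖ = ‖Q w‖ * ‖Q w‖ + ‖w - Q w‖ * ‖w - Q w‖ := by
      rw [← norm_add_sq_eq_norm_sq_add_norm_sq_of_inner_eq_zero (𝕜 := ℂ)]
      · rw [add_sub_cancel]
      · rw [B.Q_symm, map_sub, B.Q_idem, sub_self, inner_zero_right]
    nlinarith [norm_nonneg w, norm_nonneg (Q w), norm_nonneg (w - Q w)]
  have h3 : ‖d‖ = 0 := by
    have := T.sq_lt_one
    nlinarith [norm_nonneg d]
  exact (sub_eq_zero.1 (norm_eq_zero.1 h3)).symm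

/-- The candidate for `X y` when `y = (1 - r² U⁻²)⁻¹ (ι z + r U⁻¹ ι z')`. -/
theorem graph_kappa (T : IsQTriple r P X U) (B : IsBoundaryData r P U Q ι j) (z z' : A × C) :
    (-Complex.I • ((r : ℂ) • U (j z) + j z'),
      (-Complex.I * (r : ℂ)⁻¹) • U (ι z + (r : ℂ) • U.symm (ι z'))) ∈ P.graph := by
  have hr := T.r_ne_zero
  have h := LinearPMap.graph_smul_mem (-Complex.I) (LinearPMap.graph_add_mem
    (LinearPMap.graph_smul_mem (r : ℂ) (T.P_U _ _ (B.j_ι z))) (B.j_ι z'))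
  convert h using 2
  rw [map_add, map_smul, U.apply_symm_apply]
  push_cast
  match_scalars <;> field_simp

theorem inner_kappa (T : IsQTriple r P X U) (B : IsBoundaryData r P U Q ι j) (z z' w w' : A × C)
    {y : H} (hy : y - ((r ^ 2 : ℝ) : ℂ) • U.symm (U.symm y) = ι w + (r : ℂ) • U.symm (ι w')) :
    ⟪-Complex.I • ((r : ℂ) • U (j z) + j z'), y⟫_ℂ =
      Complex.I * (⟪z'.1, w.1⟫_ℂ - ⟪z'.2, w.2⟫_ℂ) := by
  have hQy := T.Q_resolvent B hy (B.Q_kappa w w')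
  have hQj : Q (j z') = j z' := by
    have := B.P_Q _ _ (B.j_ι z')
    rw [B.Q_ι] at this
    exact T.ker_P' this (B.j_ι z')
  have h1 : ∀ v, Q v = v → ⟪j z', U.symm v⟫_ℂ = 0 := fun v hv => by
    rw [← U.inner_map_eq_flip, ← hv, ← B.Q_symm, B.Q_U_j, inner_zero_left]
  have hy' : y = ι w + (r : ℂ) • U.symm (ι w') + ((r ^ 2 : ℝ) : ℂ) • U.symm (U.symm y) := by
    rw [← hy]; abel
  have h2 : ⟪U (j z), y⟫_ℂ = 0 := by
    rw [← hQy, ← B.Q_symm, B.Q_U_j, inner_zero_left]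
  have h3 : ⟪j z', y⟫_ℂ = ⟪z'.1, w.1⟫_ℂ - ⟪z'.2, w.2⟫_ℂ := by
    rw [hy', inner_add_right, inner_add_right, inner_smul_right, inner_smul_right,
      h1 _ (B.Q_ι w'), h1 _ (by rw [← hQy, B.Q_U]), B.form]
    ring
  rw [inner_smul_left, inner_add_left, inner_smul_left, h2, h3, map_neg, Complex.conj_I]
  ring

theorem exists_extension_unitaries [CompleteSpace A] [CompleteSpace C] (T : IsQTriple r P X U)
    (B : IsBoundaryData r P U Q ι j) : ∃ V W : C ≃ₗᵢ[ℂ] A, ∀ f, (∃ g, (f, g) ∈ X.graph) ↔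
      ∃ x p e e' z z', (x, p) ∈ P.graph ∧
        e - ((r ^ 2 : ℝ) : ℂ) • U.symm (U.symm e) = ι z ∧
        e' - ((r ^ 2 : ℝ) : ℂ) • U.symm (U.symm e') = ι z' ∧
        f = p + e + (r : ℂ) • U.symm e' ∧
        z.1 + z'.1 = V (z.2 + z'.2) ∧ z.1 - z'.1 = W (z.2 - z'.2) := by
  obtain ⟨R, hR, -⟩ := (U.symm * U.symm).exists_resolvent (sq_nonneg r) T.sq_lt_one
  replace hR : ∀ f, R f - ((r ^ 2 : ℝ) : ℂ) • U.symm (U.symm (R f)) = f := hR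
  let κ : (A × C) × (A × C) →ₗ[ℂ] H := R.toLinearMap.comp
    (ι.comp (LinearMap.fst ℂ _ _) +
      (r : ℂ) • (U.symm : H →ₗ[ℂ] H).comp (ι.comp (LinearMap.snd ℂ _ _)))
  have hκ : ∀ z z', κ (z, z') = R (ι z + (r : ℂ) • U.symm (ι z')) := fun z z' => rfl
  let L : Submodule ℂ ((A × C) × (A × C)) := X.domain.comap κ
  have hLmem : ∀ z z', (z, z') ∈ L ↔ ∃ g, (κ (z, z'), g) ∈ X.graph := fun z z' =>
    LinearPMap.mem_domain_iff
  have hXL : ∀ z z', (z, z') ∈ L →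
      (κ (z, z'), -Complex.I • ((r : ℂ) • U (j z) + j z')) ∈ X.graph := fun z z' h => by
    obtain ⟨g, hg⟩ := (hLmem z z').1 h
    rwa [T.X_resolvent (hR _) hg (T.graph_kappa B z z')] at hg
  have hLL : ∀ z z', (z, z') ∈ L ↔ ∀ w w', (w, w') ∈ L →
      (⟪z'.1, w.1⟫_ℂ - ⟪z'.2, w.2⟫_ℂ) + (⟪z.1, w'.1⟫_ℂ - ⟪z.2, w'.2⟫_ℂ) = 0 := by
    intro z z'
    have hsymm : ∀ w w', ⟪-Complex.I • ((r : ℂ) • U (j z) + j z'), κ (w, w')⟫_ℂ =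
        ⟪κ (z, z'), -Complex.I • ((r : ℂ) • U (j w) + j w')⟫_ℂ ↔
        (⟪z'.1, w.1⟫_ℂ - ⟪z'.2, w.2⟫_ℂ) + (⟪z.1, w'.1⟫_ℂ - ⟪z.2, w'.2⟫_ℂ) = 0 := by
      intro w w'
      rw [hκ, hκ, T.inner_kappa B z z' w w' (hR _),
        ← inner_conj_symm (R (ι z + (r : ℂ) • U.symm (ι z'))),
        T.inner_kappa B w w' z z' (hR _), map_mul, Complex.conj_I, map_sub,
        inner_conj_symm, inner_conj_symm, neg_mul, eq_neg_iff_add_eq_zero, ← mul_add,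
        mul_eq_zero, or_iff_right Complex.I_ne_zero]
    constructor
    · intro h w w' hw
      exact (hsymm w w').1 (T.selfAdjoint_X.inner_graph_comm (hXL z z' h) (hXL w w' hw))
    · intro h
      refine (hLmem z z').2 ⟨-Complex.I • ((r : ℂ) • U (j z) + j z'),
        T.selfAdjoint_X.mem_graph_of_inner fun f g hfg => ?_⟩
      obtain ⟨x, p, y, w, w', hxp, hy, rfl⟩ := T.decomp B hfg
      have hyκ : y = κ (w, w') := T.eq_of_resolvent hy (hR _)
      have hg := LinearPMap.graph_sub_mem hfg (T.X_P x p hxp)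
      rw [add_sub_cancel_left, hyκ] at hg
      have hw : (w, w') ∈ L := (hLmem w w').2 ⟨_, hg⟩
      have hg' := LinearPMap.graph_unique hg (hXL w w' hw)
      have h1 := (hsymm w w').2 (h w w' hw)
      rw [inner_add_right, hyκ, h1, ← hg', inner_sub_right]
      have h2 := T.selfAdjoint_P.inner_graph_comm (T.graph_kappa B z z') hxp
      have h3 : ⟪(-Complex.I * (r : ℂ)⁻¹) • U (ι z + (r : ℂ) • U.symm (ι z')), x⟫_ℂ =
          ⟪κ (z, z'), Complex.I • ((r : ℂ)⁻¹ • U.symm x - (r : ℂ) • U x)⟫_ℂ := by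
        have hr := T.r_ne_zero
        rw [← hR (ι z + (r : ℂ) • U.symm (ι z')), ← hκ, inner_smul_left, inner_smul_right,
          U.inner_map_eq_flip, inner_sub_left, inner_sub_right, inner_smul_left,
          inner_smul_right, inner_smul_right, U.symm.inner_map_eq_flip,
          U.symm.inner_map_eq_flip, U.symm_symm, U.apply_symm_apply,
          Complex.conj_ofReal, map_mul, map_neg, Complex.conj_I, ← Complex.ofReal_inv,
          Complex.conj_ofReal]
        push_cast
        field_simp
      rw [← h2, h3]
      ring
  have hswap : ∀ z z', (z, z') ∈ L → (z', z) ∈ L := by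
    intro z z' h
    obtain ⟨g, hg⟩ := (hLmem z z').1 h
    have h1 : κ (z', z) = (r : ℂ) • U.symm (κ (z, z')) + ι z' := by
      refine T.eq_of_resolvent (hR (ι z' + (r : ℂ) • U.symm (ι z))) ?_
      have h2 := hR (ι z + (r : ℂ) • U.symm (ι z'))
      rw [← hκ] at h2
      have h3 := congrArg (fun v => (r : ℂ) • U.symm v) h2
      simp only [map_add, map_sub, map_smul] at h3 ⊢
      push_cast at h3 ⊢
      linear_combination (norm := module) h3
    rw [hLmem, h1]
    exact ⟨_, LinearPMap.graph_add_mem (LinearPMap.graph_smul_mem _ (T.X_U_symm hg))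
      (T.X_P _ _ (B.j_ι z'))⟩
  let Lp : Submodule ℂ (A × C) := L.comap (LinearMap.prod LinearMap.id LinearMap.id)
  let Lm : Submodule ℂ (A × C) := L.comap (LinearMap.prod LinearMap.id (-LinearMap.id))
  have hLp : ∀ x, x ∈ Lp ↔ (x, x) ∈ L := fun x => Iff.rfl
  have hLm : ∀ x, x ∈ Lm ↔ (x, -x) ∈ L := fun x => Iff.rfl
  have hLp_add : ∀ w w', (w, w') ∈ L → w + w' ∈ Lp := fun w w' h => by
    have := L.add_mem h (hswap _ _ h)
    rw [Prod.mk_add_mk, add_comm w' w] at this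
    exact this
  have hLm_sub : ∀ w w', (w, w') ∈ L → w - w' ∈ Lm := fun w w' h => by
    have := L.sub_mem h (hswap _ _ h)
    rw [Prod.mk_sub_mk, ← neg_sub w w'] at this
    exact this
  have hL_iff : ∀ z z', (z, z') ∈ L ↔ z + z' ∈ Lp ∧ z - z' ∈ Lm := by
    refine fun z z' => ⟨fun h => ⟨hLp_add _ _ h, hLm_sub _ _ h⟩, fun ⟨h1, h2⟩ => ?_⟩
    have h3 := L.smul_mem (2⁻¹ : ℂ) (L.add_mem ((hLp _).1 h1) ((hLm _).1 h2))
    convert h3 using 1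
    rw [Prod.mk_add_mk, Prod.smul_mk]
    congr 1 <;> module
  have hLp_iff : ∀ p, p ∈ Lp ↔ ∀ p' ∈ Lp, ⟪p.1, p'.1⟫_ℂ = ⟪p.2, p'.2⟫_ℂ := by
    intro p
    rw [hLp, hLL]
    constructor
    · intro h p' hp'
      have := h _ _ ((hLp p').1 hp')
      linear_combination this / 2
    · intro h w w' hw
      have := h _ (hLp_add _ _ hw)
      rw [Prod.fst_add, Prod.snd_add, inner_add_right, inner_add_right] at this
      linear_combination this
  have hLm_iff : ∀ p, p ∈ Lm ↔ ∀ p' ∈ Lm, ⟪p.1, p'.1⟫_ℂ = ⟪p.2, p'.2⟫_ℂ := by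
    intro p
    rw [hLm, hLL]
    constructor
    · intro h p' hp'
      have := h _ _ ((hLm p').1 hp')
      rw [Prod.fst_neg, Prod.snd_neg, Prod.fst_neg, Prod.snd_neg, inner_neg_left,
        inner_neg_left, inner_neg_right, inner_neg_right] at this
      linear_combination -this / 2
    · intro h w w' hw
      have := h _ (hLm_sub _ _ hw)
      rw [Prod.fst_sub, Prod.snd_sub, inner_sub_right, inner_sub_right] at this
      rw [Prod.fst_neg, Prod.snd_neg, inner_neg_left, inner_neg_left]
      linear_combination -this
  obtain ⟨V, hV⟩ := exists_unitary_of_lagrangian Lp hLp_iff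
  obtain ⟨W, hW⟩ := exists_unitary_of_lagrangian Lm hLm_iff
  have hL' : ∀ z z', (z, z') ∈ L ↔
      z.1 + z'.1 = V (z.2 + z'.2) ∧ z.1 - z'.1 = W (z.2 - z'.2) := fun z z' => by
    rw [hL_iff, hV, hW]; rfl
  refine ⟨V, W, fun f => ?_⟩
  constructor
  · rintro ⟨g, hg⟩
    obtain ⟨x, p, y, z, z', hxp, hy, rfl⟩ := T.decomp B hg
    have hyκ : y = κ (z, z') := T.eq_of_resolvent hy (hR _)
    have hz : (z, z') ∈ L := by
      rw [hLmem, ← hyκ]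
      have := LinearPMap.graph_sub_mem hg (T.X_P x p hxp)
      rw [add_sub_cancel_left] at this
      exact ⟨_, this⟩
    refine ⟨x, p, R (ι z), R (ι z'), z, z', hxp, hR _, hR _, ?_, (hL' z z').1 hz⟩
    rw [add_assoc]
    congr 1
    refine T.eq_of_resolvent hy ?_
    have h2 := congrArg (fun v => (r : ℂ) • U.symm v) (hR (ι z'))
    simp only [map_add, map_sub, map_smul] at h2 ⊢
    linear_combination (norm := module) hR (ι z) + h2
  · rintro ⟨x, p, e, e', z, z', hxp, he, he', rfl, hV, hW⟩
    obtain ⟨g, hg⟩ := (hLmem z z').1 ((hL' z z').2 ⟨hV, hW⟩)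
    have : κ (z, z') = e + (r : ℂ) • U.symm e' := by
      refine T.eq_of_resolvent (hR (ι z + (r : ℂ) • U.symm (ι z'))) ?_
      have h2 := congrArg (fun v => (r : ℂ) • U.symm v) he'
      simp only [map_add, map_sub, map_smul] at h2 ⊢
      linear_combination (norm := module) he + h2
    rw [add_assoc, ← this]
    exact ⟨_, LinearPMap.graph_add_mem (T.X_P x p hxp) hg⟩

end IsQTriple

section Gram

variable {ι H K : Type*} [NormedAddCommGroup H] [InnerProductSpace ℂ H] [CompleteSpace H]
  [NormedAddCommGroup K] [InnerProductSpace ℂ K] [CompleteSpace K]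

theorem denseRange_linearCombination {x : ι → H} (hx : ∀ f, (∀ i, ⟪x i, f⟫_ℂ = 0) → f = 0) :
    DenseRange (Finsupp.linearCombination ℂ x) := by
  have h : (LinearMap.range (Finsupp.linearCombination ℂ x))ᗮ = ⊥ := by
    rw [Submodule.eq_bot_iff]
    intro f hf
    exact hx f fun i => (Submodule.mem_orthogonal _ _).1 hf _
      ⟨Finsupp.single i 1, by simp⟩
  have h2 := Submodule.dense_iff_topologicalClosure_eq_top.2
    ((Submodule.topologicalClosure_eq_top_iff).2 h)
  rwa [LinearMap.coe_range] at h2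

/-- Two total families with the same Gram matrix are related by a unitary. -/
theorem exists_unitary_of_gram {x : ι → H} {y : ι → K}
    (hxy : ∀ i j, ⟪x i, x j⟫_ℂ = ⟪y i, y j⟫_ℂ) (hx : ∀ f, (∀ i, ⟪x i, f⟫_ℂ = 0) → f = 0)
    (hy : ∀ f, (∀ i, ⟪y i, f⟫_ℂ = 0) → f = 0) : ∃ Θ : H ≃ₗᵢ[ℂ] K, ∀ i, Θ (x i) = y i := by
  have hnorm : ∀ c : ι →₀ ℂ, ‖Finsupp.linearCombination ℂ y c‖ =
      ‖Finsupp.linearCombination ℂ x c‖ := fun c => by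
    have : ⟪Finsupp.linearCombination ℂ y c, Finsupp.linearCombination ℂ y c⟫_ℂ =
        ⟪Finsupp.linearCombination ℂ x c, Finsupp.linearCombination ℂ x c⟫_ℂ := by
      simp only [Finsupp.linearCombination_apply, Finsupp.sum_inner, Finsupp.inner_sum,
        inner_smul_left, inner_smul_right, hxy]
    rw [inner_self_eq_norm_sq_to_K, inner_self_eq_norm_sq_to_K] at this
    have h' : ‖Finsupp.linearCombination ℂ y c‖ ^ 2 = ‖Finsupp.linearCombination ℂ x c‖ ^ 2 := by
      exact_mod_cast this
    exact (sq_eq_sq₀ (norm_nonneg _) (norm_nonneg _)).1 h'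
  refine ⟨(LinearEquiv.refl ℂ (ι →₀ ℂ)).extendOfIsometry (Finsupp.linearCombination ℂ x)
    (Finsupp.linearCombination ℂ y) (denseRange_linearCombination hx)
    (denseRange_linearCombination hy) hnorm, fun i => ?_⟩
  have := (LinearEquiv.refl ℂ (ι →₀ ℂ)).extendOfIsometry_eq (Finsupp.linearCombination ℂ x)
    (Finsupp.linearCombination ℂ y) (denseRange_linearCombination hx)
    (denseRange_linearCombination hy) hnorm (Finsupp.single i 1)
  simpa using this

end Gram

/-- The fundamental layer on the half-line of sign `s = ±1`. -/
def layer (q s : ℝ) : Set ℝ := {t | s * t ∈ Set.Ico q 1}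

theorem measurableSet_layer (q s : ℝ) : MeasurableSet (layer q s) :=
  measurableSet_Ico.preimage (by fun_prop)

/-- `v` generates the part of the Hilbert space in the two fundamental layers: each `v j` lies in
the layer of sign `s j`, distinct `v i`, `v j` generate orthogonal cyclic subspaces, and the
cyclic subspaces span. -/
structure IsLayerFamily {H J : Type*} [NormedAddCommGroup H] [InnerProductSpace ℂ H]
    (q : ℝ) (E : Set ℝ → (H →L[ℂ] H)) (s : J → ℝ) (v : J → H) : Prop where
  sign : ∀ j, s j = 1 ∨ s j = -1
  layer : ∀ j, E (layer q (s j)) (v j) = v j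
  orth : ∀ i j, i ≠ j → ∀ M, MeasurableSet M → @inner ℂ _ _ (v i) (E M (v j)) = 0
  total : ∀ f, E (_root_.layer q 1 ∪ _root_.layer q (-1)) f = f →
    (∀ j M, MeasurableSet M → @inner ℂ _ _ (E M (v j)) f = 0) → f = 0

section Zorn

theorem layer_inter_layer {q : ℝ} (hq0 : 0 < q) : layer q 1 ∩ layer q (-1) = ∅ := by
  ext t
  simp only [layer, Set.mem_inter_iff, Set.mem_ofPred_eq, Set.mem_Ico, Set.mem_empty_iff_false,
    iff_false]
  rintro ⟨⟨h1, -⟩, h2, -⟩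
  linarith

theorem IsSpectralMeasure.exists_layerFamily {H : Type} [NormedAddCommGroup H]
    [InnerProductSpace ℂ H] [CompleteSpace H]
    {P : H →ₗ.[ℂ] H} {E : Set ℝ → (H →L[ℂ] H)} (hE : IsSpectralMeasure P E) {q : ℝ}
    (hq0 : 0 < q) :
    ∃ (Ip Im : Type) (v : Ip ⊕ Im → H),
      IsLayerFamily q E (Sum.elim (fun _ : Ip => (1 : ℝ)) (fun _ : Im => (-1 : ℝ))) v := by
  let F : Set (Set H) := {S | (∀ v ∈ S, v ≠ 0 ∧ (E (layer q 1) v = v ∨ E (layer q (-1)) v = v)) ∧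
    ∀ v ∈ S, ∀ w ∈ S, v ≠ w → ∀ M, MeasurableSet M → ⟪v, E M w⟫_ℂ = 0}
  obtain ⟨S, hS⟩ : ∃ S, Maximal (· ∈ F) S := by
    refine zorn_subset F fun c hc hchain => ⟨⋃₀ c, ⟨?_, ?_⟩, fun s hs =>
      Set.subset_sUnion_of_mem hs⟩
    · rintro v ⟨s, hs, hv⟩
      exact (hc hs).1 v hv
    · rintro v ⟨s, hs, hv⟩ w ⟨t, ht, hw⟩ hne
      rcases hchain.total hs ht with h | h
      · exact (hc ht).2 v (h hv) w hw hne
      · exact (hc hs).2 v hv w (h hw) hne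
  have hempty : ∀ v ∈ S, E (layer q 1) v = v → E (layer q (-1)) v = v → False := by
    intro v hv h1 h2
    apply (hS.prop.1 v hv).1
    rw [← h1, ← h2, hE.comp_apply, layer_inter_layer hq0, hE.empty_apply]
  have hmax : ∀ w, (E (layer q 1) w = w ∨ E (layer q (-1)) w = w) →
      (∀ v ∈ S, ∀ M, MeasurableSet M → ⟪E M v, w⟫_ℂ = 0) → w = 0 := by
    intro w hw hperp
    by_contra h0
    have hmem : insert w S ∈ F := by
      refine ⟨?_, ?_⟩
      · rintro v (rfl | hv)
        · exact ⟨h0, hw⟩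
        · exact hS.prop.1 v hv
      · rintro v (rfl | hv) u (rfl | hu) hne M hM
        · exact absurd rfl hne
        · rw [← inner_conj_symm, hperp u hu M hM, map_zero]
        · rw [← hE.inner_comm, hperp v hv M hM]
        · exact hS.prop.2 v hv u hu hne M hM
    have hwS : w ∈ S := hS.le_of_ge hmem (Set.subset_insert _ _) (Set.mem_insert _ _)
    have := hperp w hwS _ MeasurableSet.univ
    rw [hE.univ_apply, inner_self_eq_zero] at this
    exact h0 this
  refine ⟨{v // v ∈ S ∧ E (layer q 1) v = v}, {v // v ∈ S ∧ E (layer q (-1)) v = v},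
    Sum.elim Subtype.val Subtype.val, ?_, ?_, ?_, ?_⟩
  · rintro (j | j) <;> simp
  · rintro (j | j)
    · exact j.2.2
    · exact j.2.2
  · rintro (i | i) (j | j) hne
    · exact hS.prop.2 _ i.2.1 _ j.2.1 fun h => hne (congrArg _ (Subtype.ext h))
    · exact hS.prop.2 _ i.2.1 _ j.2.1 fun h => hempty _ i.2.1 i.2.2 (h ▸ j.2.2)
    · exact hS.prop.2 _ i.2.1 _ j.2.1 fun h => hempty _ i.2.1 (h ▸ j.2.2) i.2.2
    · exact hS.prop.2 _ i.2.1 _ j.2.1 fun h => hne (congrArg _ (Subtype.ext h))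
  · intro f hf hperp
    have hperp' : ∀ v ∈ S, ∀ M, MeasurableSet M → ⟪E M v, f⟫_ℂ = 0 := by
      intro v hv M hM
      rcases (hS.prop.1 v hv).2 with h | h
      · exact hperp (Sum.inl ⟨v, hv, h⟩) M hM
      · exact hperp (Sum.inr ⟨v, hv, h⟩) M hM
    have h1 : ∀ s, (s = 1 ∨ s = -1) → E (layer q s) f = 0 := by
      intro s hs
      refine hmax _ ?_ fun v hv M hM => ?_
      · rcases hs with rfl | rfl
        · left; rw [hE.comp_apply, Set.inter_self]
        · right; rw [hE.comp_apply, Set.inter_self]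
      · rw [← hE.inner_comm, hE.comp_apply]
        exact hperp' v hv _ ((measurableSet_layer _ _).inter hM)
    rw [← hf, hE.union_apply (measurableSet_layer _ _) (layer_inter_layer hq0), h1 1 (.inl rfl),
      h1 (-1) (.inr rfl), add_zero]

end Zorn

namespace HS

variable {J : Type*} {ν : J → Measure ℝ}

theorem ext_ae {f g : HS ν} (h : ∀ j, ∀ᵐ t ∂ν j, f j t = g j t) : f = g :=
  lp.ext (funext fun j => Lp.ext (h j))

theorem add_ae (f g : HS ν) (j : J) : ∀ᵐ t ∂ν j, (f + g : HS ν) j t = f j t + g j t := by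
  filter_upwards [Lp.coeFn_add (f j) (g j)] with t ht
  exact ht

theorem sub_ae (f g : HS ν) (j : J) : ∀ᵐ t ∂ν j, (f - g : HS ν) j t = f j t - g j t := by
  filter_upwards [Lp.coeFn_sub (f j) (g j)] with t ht
  exact ht

theorem smul_ae (c : ℂ) (f : HS ν) (j : J) : ∀ᵐ t ∂ν j, (c • f : HS ν) j t = c * f j t := by
  filter_upwards [Lp.coeFn_smul c (f j)] with t ht
  exact ht

theorem zero_ae (j : J) : ∀ᵐ t ∂ν j, (0 : HS ν) j t = 0 := by
  filter_upwards [Lp.coeFn_zero ℂ 2 (ν j)] with t ht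
  exact ht

theorem aestronglyMeasurable (f : HS ν) (j : J) : AEStronglyMeasurable (f j) (ν j) :=
  Lp.aestronglyMeasurable _

theorem exists_of_eLpNorm_le {φ : J → ℝ → ℂ} (hm : ∀ j, AEStronglyMeasurable (φ j) (ν j))
    {c : J → ℝ} (hc0 : ∀ j, 0 ≤ c j) (hc : Summable fun j => c j ^ 2)
    (h : ∀ j, eLpNorm (φ j) 2 (ν j) ≤ ENNReal.ofReal (c j)) :
    ∃ g : HS ν, ∀ j, ∀ᵐ t ∂ν j, g j t = φ j t := by
  have hL : ∀ j, MemLp (φ j) 2 (ν j) := fun j => ⟨hm j, (h j).trans_lt ENNReal.ofReal_lt_top⟩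
  have hn : ∀ j, ‖(hL j).toLp (φ j)‖ ≤ c j := fun j => by
    rw [Lp.norm_toLp]
    exact ENNReal.toReal_le_of_le_ofReal (hc0 j) (h j)
  have hmem : Memℓp (fun j => (hL j).toLp (φ j)) 2 := by
    refine memℓp_gen ?_
    refine Summable.of_nonneg_of_le (fun j => by positivity) (fun j => ?_) hc
    simp only [ENNReal.toReal_ofNat, Real.rpow_ofNat]
    exact pow_le_pow_left₀ (norm_nonneg _) (hn j) 2
  exact ⟨⟨_, hmem⟩, fun j => (hL j).coeFn_toLp⟩

theorem summable_norm_sq (f : HS ν) : Summable fun j => ‖f j‖ ^ 2 := by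
  have := (lp.memℓp f).summable (by simp)
  simpa using this

theorem exists_of_bound (f : HS ν) {C : ℝ} (hC : 0 ≤ C) {φ : J → ℝ → ℂ}
    (hm : ∀ j, AEStronglyMeasurable (φ j) (ν j))
    (h : ∀ j, ∀ᵐ t ∂ν j, ‖φ j t‖ ≤ C * ‖f j t‖) :
    ∃ g : HS ν, ∀ j, ∀ᵐ t ∂ν j, g j t = φ j t := by
  refine exists_of_eLpNorm_le hm (c := fun j => C * ‖f j‖) (fun j => by positivity) ?_ fun j => ?_
  · simp_rw [mul_pow]
    exact (summable_norm_sq f).mul_left _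
  · refine (eLpNorm_le_mul_eLpNorm_of_ae_le_mul (h j) 2).trans ?_
    rw [ENNReal.ofReal_mul hC, Lp.norm_def, ENNReal.ofReal_toReal (Lp.eLpNorm_ne_top _)]

theorem inner_eq_tsum (f g : HS ν) :
    ⟪f, g⟫_ℂ = ∑' j, ∫ t, (starRingEnd ℂ) (f j t) * g j t ∂ν j := by
  rw [lp.inner_eq_tsum]
  refine tsum_congr fun j => ?_
  rw [L2.inner_def]
  refine integral_congr_ae (.of_forall fun t => ?_)
  simp [mul_comm]

theorem inner_congr {f g f' g' : HS ν}
    (h : ∀ j, ∀ᵐ t ∂ν j, (starRingEnd ℂ) (f j t) * g j t = (starRingEnd ℂ) (f' j t) * g' j t) :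
    ⟪f, g⟫_ℂ = ⟪f', g'⟫_ℂ := by
  rw [inner_eq_tsum, inner_eq_tsum]
  exact tsum_congr fun j => integral_congr_ae (h j)

theorem inner_single_indicator (f : HS ν) [DecidableEq J] (j : J) {S : Set ℝ}
    (hS : MeasurableSet S) (hS' : ν j S ≠ ⊤) :
    ⟪(lp.single 2 j (indicatorConstLp 2 hS hS' (1 : ℂ)) : HS ν), f⟫_ℂ = ∫ t in S, f j t ∂ν j := by
  rw [lp.inner_single_left, L2.inner_indicatorConstLp_one]

theorem integrableOn (f : HS ν) (j : J) {S : Set ℝ} (hS' : ν j S ≠ ⊤) :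
    IntegrableOn (f j) S (ν j) := by
  have : IsFiniteMeasure ((ν j).restrict S) := ⟨by
    rw [Measure.restrict_apply_univ]; exact lt_top_iff_ne_top.2 hS'⟩
  exact ((Lp.memLp (f j)).restrict S).integrable (by norm_num)

theorem lintegral_sq_le (f : HS ν) (j : J) :
    ∫⁻ t, ‖f j t‖ₑ ^ 2 ∂ν j ≤ ENNReal.ofReal (‖f‖ ^ 2) := by
  have h1 : ‖f j‖ ≤ ‖f‖ := lp.norm_apply_le_norm (by simp) f j
  have h2 : eLpNorm (f j) 2 (ν j) ≤ ENNReal.ofReal ‖f‖ := by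
    rw [← ENNReal.ofReal_toReal (Lp.eLpNorm_ne_top (f j)), ← Lp.norm_def]
    exact ENNReal.ofReal_le_ofReal h1
  have h3 := eLpNorm_nnreal_pow_eq_lintegral (f := f j) (μ := ν j) (p := 2) (by norm_num)
  rw [ENNReal.ofReal_pow (norm_nonneg _)]
  refine le_trans (le_of_eq ?_) (pow_le_pow_left' h2 2)
  simpa using h3.symm

end HS

theorem eq_zero_of_zpow_mul_mem_Ico {q : ℝ} (hq0 : 0 < q) (hq1 : q < 1) {x : ℝ} {k : ℤ}
    (hx : x ∈ Set.Ico q 1) (hk : q ^ k * x ∈ Set.Ico q 1) : k = 0 := by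
  have hx0 : 0 < x := hq0.trans_le hx.1
  rcases lt_trichotomy k 0 with h | h | h
  · exfalso
    have h1 : q ^ (-1 : ℤ) ≤ q ^ k := zpow_le_zpow_right_of_le_one₀ hq0 hq1.le (by omega)
    have h2 : q ^ (-1 : ℤ) * q = 1 := by rw [zpow_neg_one, inv_mul_cancel₀ hq0.ne']
    have h3 : q ^ (-1 : ℤ) * q ≤ q ^ k * x :=
      mul_le_mul h1 hx.1 hq0.le (zpow_pos hq0 _).le
    linarith [hk.2]
  · exact h
  · exfalso
    have h1 : q ^ k ≤ q ^ (1 : ℤ) := zpow_le_zpow_right_of_le_one₀ hq0 hq1.le (by omega)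
    rw [zpow_one] at h1
    have h3 : q ^ k * x ≤ q * x := mul_le_mul_of_nonneg_right h1 hx0.le
    have h4 : q * x < q := by nlinarith [hx.2]
    linarith [hk.1]

theorem exists_zpow_mul_mem_Ico {q : ℝ} (hq0 : 0 < q) (hq1 : q < 1) {x : ℝ} (hx : 0 < x) :
    ∃ n : ℤ, q ^ n * x ∈ Set.Ico q 1 := by
  obtain ⟨n, hn1, hn2⟩ := exists_mem_Ico_zpow (x := x) (y := q⁻¹) hx ((one_lt_inv₀ hq0).2 hq1)
  refine ⟨n + 1, ?_, ?_⟩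
  · rw [inv_zpow, inv_le_iff_one_le_mul₀ (zpow_pos hq0 _)] at hn1
    rw [zpow_add_one₀ hq0.ne']
    nlinarith
  · rw [inv_zpow, lt_inv_comm₀ hx (zpow_pos hq0 _)] at hn2
    have := mul_lt_mul_of_pos_right hn2 hx
    rwa [inv_mul_cancel₀ hx.ne'] at this

/-- The measure on a half-line obtained from a measure `ν` on the fundamental layer by requiring
that dilation by `q` multiply the measure by `q`. -/
def dilationMeasure (q : ℝ) (ν : Measure ℝ) : Measure ℝ :=
  Measure.sum fun n : ℤ => ENNReal.ofReal (q ^ n) • ν.map fun t => q ^ n * t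

section Dilation

variable {q s : ℝ} {ν : Measure ℝ}

theorem dilationMeasure_apply {S : Set ℝ} (hS : MeasurableSet S) :
    dilationMeasure q ν S = ∑' n : ℤ, ENNReal.ofReal (q ^ n) * ν ((fun t => q ^ n * t) ⁻¹' S) := by
  rw [dilationMeasure, Measure.sum_apply _ hS]
  refine tsum_congr fun n => ?_
  rw [Measure.smul_apply, Measure.map_apply (by fun_prop) hS, smul_eq_mul]

theorem zpow_layer_eq_zero (hq0 : 0 < q) (hq1 : q < 1) {t : ℝ} {k : ℤ} (ht : t ∈ layer q s)
    (hk : q ^ k * t ∈ layer q s) : k = 0 := by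
  refine eq_zero_of_zpow_mul_mem_Ico hq0 hq1 (x := s * t) ht ?_
  have : q ^ k * (s * t) = s * (q ^ k * t) := by ring
  rw [this]; exact hk

theorem dilationMeasure_scaled (hq0 : 0 < q) (hq1 : q < 1) (hν : ν (layer q s)ᶜ = 0) (n : ℤ)
    {M : Set ℝ} (hM : MeasurableSet M) (hMl : M ⊆ layer q s) :
    dilationMeasure q ν ((fun t => q ^ (-n) * t) ⁻¹' M) = ENNReal.ofReal (q ^ n) * ν M := by
  rw [dilationMeasure_apply (hM.preimage (by fun_prop)), tsum_eq_single n]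
  · congr 2
    ext t
    simp only [Set.mem_preimage]
    rw [← mul_assoc, ← zpow_add₀ hq0.ne', neg_add_cancel, zpow_zero, one_mul]
  · intro m hm
    have : (fun t => q ^ m * t) ⁻¹' ((fun t => q ^ (-n) * t) ⁻¹' M) ⊆ (layer q s)ᶜ := by
      intro t ht htl
      simp only [Set.mem_preimage] at ht
      rw [← mul_assoc, ← zpow_add₀ hq0.ne'] at ht
      have := zpow_layer_eq_zero hq0 hq1 htl (hMl ht)
      omega
    rw [measure_mono_null this hν, mul_zero]

theorem dilationMeasure_preimage (hq0 : 0 < q) (k : ℤ) {S : Set ℝ} (hS : MeasurableSet S) :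
    dilationMeasure q ν ((fun t => q ^ k * t) ⁻¹' S) =
      ENNReal.ofReal (q ^ (-k)) * dilationMeasure q ν S := by
  rw [dilationMeasure_apply hS, dilationMeasure_apply (hS.preimage (by fun_prop)),
    ← ENNReal.tsum_mul_left, ← (Equiv.addRight (-k)).tsum_eq]
  refine tsum_congr fun n => ?_
  rw [← mul_assoc, ← ENNReal.ofReal_mul (zpow_pos hq0 _).le, ← zpow_add₀ hq0.ne']
  simp only [Equiv.coe_addRight]
  congr 2
  · rw [add_comm]
  · ext t
    simp only [Set.mem_preimage]
    rw [← mul_assoc, ← zpow_add₀ hq0.ne', add_comm n, add_neg_cancel_left]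

theorem map_dilationMeasure (hq0 : 0 < q) (k : ℤ) :
    (dilationMeasure q ν).map (fun t => q ^ k * t) =
      ENNReal.ofReal (q ^ (-k)) • dilationMeasure q ν := by
  ext S hS
  rw [Measure.map_apply (by fun_prop) hS, dilationMeasure_preimage hq0 k hS]; rfl

theorem quasiMeasurePreserving_dilation (hq0 : 0 < q) (k : ℤ) :
    Measure.QuasiMeasurePreserving (fun t => q ^ k * t) (dilationMeasure q ν)
      (dilationMeasure q ν) := by
  refine ⟨by fun_prop, ?_⟩
  rw [map_dilationMeasure hq0]
  exact Measure.smul_absolutelyContinuous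

theorem ae_dilation (hq0 : 0 < q) {p : ℝ → Prop} (h : ∀ᵐ t ∂dilationMeasure q ν, p t) :
    ∀ᵐ t ∂dilationMeasure q ν, ∀ k : ℤ, p (q ^ k * t) :=
  ae_all_iff.2 fun k => (quasiMeasurePreserving_dilation hq0 k).ae h

theorem dilationMeasure_restrict_layer (hq0 : 0 < q) (hq1 : q < 1) (hν : ν (layer q s)ᶜ = 0) :
    (dilationMeasure q ν).restrict (layer q s) = ν := by
  ext S hS
  have h := dilationMeasure_scaled hq0 hq1 hν 0 (hS.inter (measurableSet_layer q s))
    Set.inter_subset_right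
  rw [Measure.restrict_apply hS]
  simp only [neg_zero, zpow_zero, one_mul, Set.preimage_id', ENNReal.ofReal_one] at h
  rw [h]
  exact measure_inter_conull hν

theorem ae_exists_mem_layer (hq0 : 0 < q) (hν : ν (layer q s)ᶜ = 0) :
    ∀ᵐ t ∂dilationMeasure q ν, ∃ n : ℤ, q ^ n * t ∈ layer q s := by
  have hm : MeasurableSet {t : ℝ | ∃ n : ℤ, q ^ n * t ∈ layer q s} := by
    have : {t : ℝ | ∃ n : ℤ, q ^ n * t ∈ layer q s} =
        ⋃ n : ℤ, (fun t => q ^ n * t) ⁻¹' layer q s := by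
      ext t; simp
    rw [this]
    exact MeasurableSet.iUnion fun n => (measurableSet_layer q s).preimage (by fun_prop)
  rw [ae_iff]
  change dilationMeasure q ν {t : ℝ | ∃ n : ℤ, q ^ n * t ∈ layer q s}ᶜ = 0
  rw [dilationMeasure_apply hm.compl, ENNReal.tsum_eq_zero]
  intro n
  have : (fun t => q ^ n * t) ⁻¹' {t : ℝ | ∃ n : ℤ, q ^ n * t ∈ layer q s}ᶜ ⊆ (layer q s)ᶜ := by
    intro t ht htl
    refine ht ⟨-n, ?_⟩
    change q ^ (-n) * (q ^ n * t) ∈ _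
    rwa [← mul_assoc, ← zpow_add₀ hq0.ne', neg_add_cancel, zpow_zero, one_mul]
  rw [measure_mono_null this hν, mul_zero]

theorem mul_pos_of_zpow_mem_layer (hq0 : 0 < q) {t : ℝ} {n : ℤ} (h : q ^ n * t ∈ layer q s) :
    0 < s * t := by
  have h1 : 0 < s * (q ^ n * t) := hq0.trans_le h.1
  have h2 : s * (q ^ n * t) = q ^ n * (s * t) := by ring
  rw [h2] at h1
  exact (mul_pos_iff_of_pos_left (zpow_pos hq0 n)).1 h1

theorem ae_mul_pos (hq0 : 0 < q) (hν : ν (layer q s)ᶜ = 0) :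
    ∀ᵐ t ∂dilationMeasure q ν, 0 < s * t := by
  filter_upwards [ae_exists_mem_layer hq0 hν] with t ⟨n, hn⟩
  exact mul_pos_of_zpow_mem_layer hq0 hn

/-- Two functions with the same integrals over all sets `qⁿ M` with `M` in the fundamental layer
agree almost everywhere. -/
theorem ae_eq_of_setIntegral_scaled (hq0 : 0 < q) (hν : ν (layer q s)ᶜ = 0)
    {f g : ℝ → ℂ}
    (hf : ∀ n : ℤ, IntegrableOn f ((fun t => q ^ (-n) * t) ⁻¹' layer q s) (dilationMeasure q ν))
    (hg : ∀ n : ℤ, IntegrableOn g ((fun t => q ^ (-n) * t) ⁻¹' layer q s) (dilationMeasure q ν))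
    (h : ∀ (n : ℤ) (M : Set ℝ), MeasurableSet M →
      ∫ t in (fun t => q ^ (-n) * t) ⁻¹' (M ∩ layer q s), f t ∂dilationMeasure q ν =
      ∫ t in (fun t => q ^ (-n) * t) ⁻¹' (M ∩ layer q s), g t ∂dilationMeasure q ν) :
    ∀ᵐ t ∂dilationMeasure q ν, f t = g t := by
  have hl : ∀ n : ℤ, MeasurableSet ((fun t => q ^ (-n) * t) ⁻¹' layer q s) := fun n =>
    (measurableSet_layer q s).preimage (by fun_prop)
  have key : ∀ n : ℤ, ∀ᵐ t ∂dilationMeasure q ν,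
      t ∈ (fun t => q ^ (-n) * t) ⁻¹' layer q s → f t = g t := by
    intro n
    rw [← ae_restrict_iff' (hl n)]
    refine Integrable.ae_eq_of_forall_setIntegral_eq f g (hf n) (hg n) fun S hS _ => ?_
    rw [Measure.restrict_restrict hS]
    have : S ∩ (fun t => q ^ (-n) * t) ⁻¹' layer q s =
        (fun t => q ^ (-n) * t) ⁻¹' (((fun t => q ^ n * t) ⁻¹' S) ∩ layer q s) := by
      ext t
      simp only [Set.mem_inter_iff, Set.mem_preimage]
      rw [← mul_assoc, ← zpow_add₀ hq0.ne', add_neg_cancel, zpow_zero, one_mul]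
    rw [this]
    exact h n _ (hS.preimage (by fun_prop))
  filter_upwards [ae_all_iff.2 key, ae_exists_mem_layer hq0 hν] with t ht ⟨n, hn⟩
  exact ht (-n) (by rwa [Set.mem_preimage, neg_neg])

end Dilation

/-- A self-adjoint `P` with spectral measure `E`, a unitary `U` with `U P U⁻¹ = q P`, and vectors
`v j` generating the spectral subspaces of the two fundamental layers. -/
structure IsDilationSystem {H J : Type*} [NormedAddCommGroup H] [InnerProductSpace ℂ H]
    [CompleteSpace H] (r q : ℝ) (P : H →ₗ.[ℂ] H) (U : H ≃ₗᵢ[ℂ] H) (E : Set ℝ → (H →L[ℂ] H))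
    (s : J → ℝ) (v : J → H) : Prop where
  pos : 0 < r
  lt_one : q < 1
  sq : r ^ 2 = q
  selfAdjoint : IsSelfAdjoint P
  spectral : IsSpectralMeasure P E
  P_U : ∀ f g, (f, g) ∈ P.graph → (U f, (q : ℂ)⁻¹ • U g) ∈ P.graph
  P_U_symm : ∀ f g, (f, g) ∈ P.graph → (U.symm f, (q : ℂ) • U.symm g) ∈ P.graph
  ker_P : ∀ f, (f, (0 : H)) ∈ P.graph → f = 0
  family : IsLayerFamily q E s v

namespace IsDilationSystem

theorem zpow_zpow_neg {H : Type*} [NormedAddCommGroup H] [InnerProductSpace ℂ H]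
    (U : H ≃ₗᵢ[ℂ] H) (n : ℤ) (f : H) : (U ^ n) ((U ^ (-n)) f) = f := by
  change (U ^ n * U ^ (-n)) f = f
  rw [← zpow_add, add_neg_cancel, zpow_zero]
  rfl

theorem apply_zpow {H : Type*} [NormedAddCommGroup H] [InnerProductSpace ℂ H]
    (U : H ≃ₗᵢ[ℂ] H) (n : ℤ) (f : H) : U ((U ^ n) f) = (U ^ (1 + n)) f := by
  rw [zpow_one_add]
  rfl

section Vectors

variable {H J : Type*} [NormedAddCommGroup H] [InnerProductSpace ℂ H] {r : ℝ} {U : H ≃ₗᵢ[ℂ] H}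
    {E : Set ℝ → (H →L[ℂ] H)} {v : J → H}

/-- The vector that corresponds to the indicator function of `qⁿ M` in the component `j`. -/
def vec (r : ℝ) (U : H ≃ₗᵢ[ℂ] H) (E : Set ℝ → (H →L[ℂ] H)) (v : J → H) (j : J) (n : ℤ)
    (M : Set ℝ) : H := ((r : ℂ) ^ n) • (U ^ (-n)) (E M (v j))

theorem U_vec (r_pos : 0 < r) (j : J) (n : ℤ) (M : Set ℝ) :
    U (vec r U E v j n M) = (r : ℂ) • vec r U E v j (n - 1) M := by
  have hr : (r : ℂ) ≠ 0 := by exact_mod_cast r_pos.ne'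
  rw [vec, vec, map_smul, smul_smul, neg_sub, apply_zpow, sub_eq_add_neg 1 n, ← zpow_one_add₀ hr]
  simp

end Vectors

section Unitary

variable {H J : Type*} [NormedAddCommGroup H] [InnerProductSpace ℂ H]
    [CompleteSpace H] {r q : ℝ} {P : H →ₗ.[ℂ] H} {U : H ≃ₗᵢ[ℂ] H} {E : Set ℝ → (H →L[ℂ] H)}
    {s : J → ℝ} {v : J → H}

theorem q_pos (S : IsDilationSystem r q P U E s v) : 0 < q := by
  have := S.pos
  rw [← S.sq]; positivity

/-- The spectral measure of the vector `v j`. -/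
def nu (S : IsDilationSystem r q P U E s v) (j : J) : Measure ℝ := S.spectral.meas (v j)

instance (S : IsDilationSystem r q P U E s v) (j : J) : IsFiniteMeasure (S.nu j) :=
  inferInstanceAs (IsFiniteMeasure (S.spectral.meas (v j)))

theorem nu_compl_layer (S : IsDilationSystem r q P U E s v) (j : J) :
    S.nu j (layer q (s j))ᶜ = 0 :=
  S.spectral.meas_null_of_apply_eq (measurableSet_layer _ _) (S.family.layer j)

theorem zpow_apply (S : IsDilationSystem r q P U E s v) (n : ℤ) {M : Set ℝ}
    (hM : MeasurableSet M) (f : H) :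
    (U ^ n) (E M f) = E ((fun t => q ^ n * t) ⁻¹' M) ((U ^ n) f) :=
  S.spectral.map_unitary_zpow S.q_pos S.selfAdjoint S.P_U S.P_U_symm n hM f

theorem apply_vec (S : IsDilationSystem r q P U E s v) (j : J) (n : ℤ) (M : Set ℝ) {T : Set ℝ}
    (hT : MeasurableSet T) :
    E T (vec r U E v j n M) = vec r U E v j n (M ∩ (fun t => q ^ n * t) ⁻¹' T) := by
  have hT' : MeasurableSet ((fun t : ℝ => q ^ n * t) ⁻¹' T) := hT.preimage (by fun_prop)
  rw [vec, vec, map_smul, Set.inter_comm, ← S.spectral.comp_apply, S.zpow_apply _ hT']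
  congr 3
  ext t
  simp only [Set.mem_preimage]
  rw [← mul_assoc, ← zpow_add₀ S.q_pos.ne', add_neg_cancel, zpow_zero, one_mul]

theorem vec_inter_layer (S : IsDilationSystem r q P U E s v) (j : J) (n : ℤ) (M : Set ℝ) :
    vec r U E v j n (M ∩ layer q (s j)) = vec r U E v j n M := by
  rw [vec, vec, ← S.spectral.comp_apply, S.family.layer]

theorem support_vec (S : IsDilationSystem r q P U E s v) (j : J) (n : ℤ) (M : Set ℝ) :
    E ((fun t => q ^ (-n) * t) ⁻¹' layer q (s j)) (vec r U E v j n M) = vec r U E v j n M := by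
  rw [S.apply_vec j n M ((measurableSet_layer _ _).preimage (by fun_prop))]
  rw [← S.vec_inter_layer j n M]
  congr 1
  ext t
  simp only [Set.mem_inter_iff, Set.mem_preimage]
  rw [← mul_assoc, ← zpow_add₀ S.q_pos.ne', neg_add_cancel, zpow_zero, one_mul]

theorem scaled_layer_disjoint (S : IsDilationSystem r q P U E s v) {j k : J} {n m : ℤ}
    (h : n ≠ m) : ((fun t => q ^ (-n) * t) ⁻¹' layer q (s j)) ∩
      ((fun t => q ^ (-m) * t) ⁻¹' layer q (s k)) = ∅ := by
  have hq := S.q_pos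
  ext t
  simp only [Set.mem_inter_iff, Set.mem_preimage, Set.mem_empty_iff_false, iff_false]
  rintro ⟨h1, h2⟩
  have h3 := mul_pos_of_zpow_mem_layer hq h1
  have h4 := mul_pos_of_zpow_mem_layer hq h2
  have hs : s j = s k := by
    rcases S.family.sign j with h5 | h5 <;> rcases S.family.sign k with h6 | h6 <;>
      rw [h5] at h3 ⊢ <;> rw [h6] at h4 ⊢ <;> linarith
  rw [hs] at h1
  have h5 : q ^ (n - m) * (q ^ (-n) * t) ∈ layer q (s k) := by
    rw [← mul_assoc, ← zpow_add₀ hq.ne']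
    convert h2 using 3; ring
  have := zpow_layer_eq_zero hq S.lt_one h1 h5
  omega

theorem inner_vec_of_ne (S : IsDilationSystem r q P U E s v) {j k : J} {n m : ℤ} (h : n ≠ m)
    (M N : Set ℝ) :
    ⟪vec r U E v j n M, vec r U E v k m N⟫_ℂ = 0 := by
  rw [← S.support_vec j n M, ← S.support_vec k m N]
  exact S.spectral.inner_of_disjoint (S.scaled_layer_disjoint h) _ _

theorem inner_vec_of_ne' (S : IsDilationSystem r q P U E s v) {j k : J} (h : j ≠ k) (n : ℤ)
    {M N : Set ℝ} (hM : MeasurableSet M) (hN : MeasurableSet N) :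
    ⟪vec r U E v j n M, vec r U E v k n N⟫_ℂ = 0 := by
  rw [vec, vec, inner_smul_left, inner_smul_right, LinearIsometryEquiv.inner_map_map,
    S.spectral.inner_comm, S.spectral.comp_apply, S.family.orth j k h _ (hM.inter hN), mul_zero,
    mul_zero]

theorem inner_vec_self (S : IsDilationSystem r q P U E s v) (j : J) (n : ℤ)
    {M N : Set ℝ} (hM : MeasurableSet M) (hN : MeasurableSet N) :
    ⟪vec r U E v j n M, vec r U E v j n N⟫_ℂ = ((q ^ n * (S.nu j).real (M ∩ N) : ℝ) : ℂ) := by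
  rw [vec, vec, inner_smul_left, inner_smul_right, LinearIsometryEquiv.inner_map_map,
    S.spectral.inner_comm, S.spectral.comp_apply, ← S.spectral.inner_comm,
    S.spectral.inner_self_apply, measureReal_def, nu, S.spectral.meas_apply _ (hM.inter hN),
    ENNReal.toReal_ofReal (sq_nonneg _), ← mul_assoc, map_zpow₀, Complex.conj_ofReal,
    ← mul_zpow, ← S.sq]
  push_cast
  rw [pow_two, pow_two]

theorem eq_zero_of_inner_vec (S : IsDilationSystem r q P U E s v) {f : H}
    (h : ∀ j n M, MeasurableSet M → ⟪vec r U E v j n M, f⟫_ℂ = 0) : f = 0 := by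
  have hr : (r : ℂ) ≠ 0 := by exact_mod_cast S.pos.ne'
  have hq := S.q_pos
  set B := layer q 1 ∪ layer q (-1) with hB
  have hBm : MeasurableSet B := (measurableSet_layer _ _).union (measurableSet_layer _ _)
  have hBl : ∀ j, layer q (s j) ⊆ B := fun j => by
    rcases S.family.sign j with h | h <;> rw [h]
    exacts [Set.subset_union_left, Set.subset_union_right]
  have h1 : ∀ n : ℤ, E B ((U ^ n) f) = 0 := fun n => by
    refine S.family.total _ (by rw [S.spectral.comp_apply, Set.inter_self]) fun j M hM => ?_
    rw [← S.spectral.inner_comm, S.spectral.comp_apply, Set.inter_comm,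
      ← S.spectral.comp_apply, S.spectral.apply_eq_of_subset (hBl j) (S.family.layer j)]
    have h2 := h j n M hM
    rw [vec, inner_smul_left, mul_eq_zero] at h2
    rcases h2 with h2 | h2
    · rw [map_eq_zero] at h2
      exact absurd h2 (zpow_ne_zero _ hr)
    · rw [← LinearIsometryEquiv.inner_map_map (U ^ n)] at h2
      rw [← h2]
      congr 1
      rw [zpow_zpow_neg]
  have h2 : ∀ n : ℤ, E ((fun t => q ^ n * t) ⁻¹' B) f = 0 := fun n => by
    have h3 := S.zpow_apply n hBm ((U ^ (-n)) f)
    rw [h1, map_zero, zpow_zpow_neg] at h3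
    exact h3.symm
  have hnull : S.spectral.meas f Set.univ = 0 := by
    have hcov : (Set.univ : Set ℝ) ⊆ {0} ∪ ⋃ n : ℤ, (fun t => q ^ n * t) ⁻¹' B := by
      intro t _
      rcases lt_trichotomy t 0 with ht | ht | ht
      · obtain ⟨n, hn⟩ := exists_zpow_mul_mem_Ico hq S.lt_one (neg_pos.2 ht)
        refine Or.inr (Set.mem_iUnion.2 ⟨n, Or.inr ?_⟩)
        change -1 * (q ^ n * t) ∈ Set.Ico q 1
        convert hn using 1; ring
      · exact Or.inl ht
      · obtain ⟨n, hn⟩ := exists_zpow_mul_mem_Ico hq S.lt_one ht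
        refine Or.inr (Set.mem_iUnion.2 ⟨n, Or.inl ?_⟩)
        change 1 * (q ^ n * t) ∈ Set.Ico q 1
        rwa [one_mul]
    refine measure_mono_null hcov (measure_union_null ?_ (measure_iUnion_null fun n => ?_))
    · rw [← S.spectral.apply_eq_zero_iff f (measurableSet_singleton 0)]
      exact S.spectral.apply_singleton_zero S.selfAdjoint S.ker_P f
    · rw [← S.spectral.apply_eq_zero_iff f (hBm.preimage (by fun_prop))]
      exact h2 n
  rw [← S.spectral.apply_eq_zero_iff f .univ, S.spectral.univ_apply] at hnull
  exact hnull

theorem measure_scaled_ne_top (S : IsDilationSystem r q P U E s v) {μ : J → Measure ℝ}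
    (hμ : ∀ j, μ j = dilationMeasure q (S.nu j)) (j : J) (n : ℤ) {M : Set ℝ}
    (hM : MeasurableSet M) :
    μ j ((fun t => q ^ (-n) * t) ⁻¹' (M ∩ layer q (s j))) ≠ ⊤ := by
  rw [hμ, dilationMeasure_scaled S.q_pos S.lt_one (S.nu_compl_layer j) n
    (hM.inter (measurableSet_layer _ _)) Set.inter_subset_right]
  exact ENNReal.mul_ne_top ENNReal.ofReal_ne_top (measure_ne_top _ _)

theorem exists_unitary (S : IsDilationSystem r q P U E s v) {μ : J → Measure ℝ}
    (hμ : ∀ j, μ j = dilationMeasure q (S.nu j)) :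
    ∃ Θ : H ≃ₗᵢ[ℂ] HS μ, ∀ j n M, MeasurableSet M → ∀ f,
      ∫ t in (fun t => q ^ (-n) * t) ⁻¹' (M ∩ layer q (s j)), Θ f j t ∂μ j =
        ⟪vec r U E v j n M, f⟫_ℂ := by
  classical
  have hq := S.q_pos
  let ι := J × ℤ × {M : Set ℝ // MeasurableSet M}
  let A : ι → Set ℝ := fun i => (fun t => q ^ (-i.2.1) * t) ⁻¹' (i.2.2.1 ∩ layer q (s i.1))
  have hA : ∀ i : ι, MeasurableSet (A i) := fun i =>
    (i.2.2.2.inter (measurableSet_layer _ _)).preimage (by fun_prop)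
  have hA' : ∀ i : ι, μ i.1 (A i) ≠ ⊤ := fun i => S.measure_scaled_ne_top hμ _ _ i.2.2.2
  let x : ι → HS μ := fun i => lp.single 2 i.1 (indicatorConstLp 2 (hA i) (hA' i) (1 : ℂ))
  let y : ι → H := fun i => vec r U E v i.1 i.2.1 i.2.2.1
  have hxe : ∀ f : HS μ, (∀ i, ⟪x i, f⟫_ℂ = 0) → f = 0 := by
    intro f hf
    refine HS.ext_ae fun j => ?_
    have key : ∀ᵐ t ∂μ j, f j t = 0 := by
      have hint : ∀ n : ℤ, IntegrableOn (f j) ((fun t => q ^ (-n) * t) ⁻¹' layer q (s j))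
          (μ j) := fun n => HS.integrableOn f j (by
            have := S.measure_scaled_ne_top hμ j n .univ
            rwa [Set.univ_inter] at this)
      have h0 : ∀ (n : ℤ) (M : Set ℝ), MeasurableSet M →
          ∫ t in (fun t => q ^ (-n) * t) ⁻¹' (M ∩ layer q (s j)), f j t ∂μ j = 0 := by
        intro n M hM
        rw [← HS.inner_single_indicator f j (hA (j, n, ⟨M, hM⟩)) (hA' (j, n, ⟨M, hM⟩))]
        exact hf (j, n, ⟨M, hM⟩)
      generalize f j = fj at hint h0 ⊢
      generalize (fj : ℝ → ℂ) = φ at hint h0 ⊢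
      rw [hμ j] at hint h0 ⊢
      exact ae_eq_of_setIntegral_scaled hq (S.nu_compl_layer j) hint
        (fun n => integrableOn_zero) fun n M hM => by rw [h0 n M hM]; simp
    filter_upwards [key, HS.zero_ae (ν := μ) j] with t h1 h2
    rw [h1, h2]
  have hye : ∀ f : H, (∀ i, ⟪y i, f⟫_ℂ = 0) → f = 0 := fun f hf =>
    S.eq_zero_of_inner_vec fun j n M hM => hf (j, n, ⟨M, hM⟩)
  have hgram : ∀ i k, ⟪x i, x k⟫_ℂ = ⟪y i, y k⟫_ℂ := by
    rintro ⟨j, n, M, hM⟩ ⟨k, m, N, hN⟩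
    change ⟪x (j, n, ⟨M, hM⟩), x (k, m, ⟨N, hN⟩)⟫_ℂ = ⟪vec r U E v j n M, vec r U E v k m N⟫_ℂ
    by_cases hjk : j = k
    · subst hjk
      have h1 : ⟪x (j, n, ⟨M, hM⟩), x (j, m, ⟨N, hN⟩)⟫_ℂ =
          (((μ j).real (A (j, n, ⟨M, hM⟩) ∩ A (j, m, ⟨N, hN⟩)) : ℝ) : ℂ) := by
        have := lp.inner_single_left (𝕜 := ℂ) (G := fun j => Lp ℂ 2 (μ j)) j
          (indicatorConstLp 2 (hA (j, n, ⟨M, hM⟩)) (hA' (j, n, ⟨M, hM⟩)) (1 : ℂ))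
          (x (j, m, ⟨N, hN⟩))
        rw [show x (j, n, ⟨M, hM⟩) = lp.single 2 j
          (indicatorConstLp 2 (hA (j, n, ⟨M, hM⟩)) (hA' (j, n, ⟨M, hM⟩)) (1 : ℂ)) from rfl, this,
          show x (j, m, ⟨N, hN⟩) = lp.single 2 j
          (indicatorConstLp 2 (hA (j, m, ⟨N, hN⟩)) (hA' (j, m, ⟨N, hN⟩)) (1 : ℂ)) from rfl,
          lp.single_apply_self, L2.inner_indicatorConstLp_one, 
          integral_congr_ae (ae_restrict_of_ae indicatorConstLp_coeFn),
          setIntegral_indicator (hA (j, m, ⟨N, hN⟩))]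
        simp
      rw [h1]
      by_cases hnm : n = m
      · subst hnm
        have h2 : A (j, n, ⟨M, hM⟩) ∩ A (j, n, ⟨N, hN⟩) =
            (fun t => q ^ (-n) * t) ⁻¹' ((M ∩ N) ∩ layer q (s j)) := by
          ext t; simp only [A, Set.mem_inter_iff, Set.mem_preimage]; tauto
        rw [← S.vec_inter_layer j n M, S.inner_vec_self j n (hM.inter (measurableSet_layer _ _)) hN,
          h2, measureReal_def, hμ j, dilationMeasure_scaled hq S.lt_one (S.nu_compl_layer j) n
          ((hM.inter hN).inter (measurableSet_layer _ _)) Set.inter_subset_right,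
          ENNReal.toReal_mul, ENNReal.toReal_ofReal (zpow_pos hq _).le, measureReal_def,
          Set.inter_right_comm]
      · rw [S.inner_vec_of_ne hnm M N]
        have h2 : A (j, n, ⟨M, hM⟩) ∩ A (j, m, ⟨N, hN⟩) = ∅ := by
          refine Set.subset_eq_empty ?_ (S.scaled_layer_disjoint (j := j) (k := j) hnm)
          exact Set.inter_subset_inter (Set.preimage_mono Set.inter_subset_right)
            (Set.preimage_mono Set.inter_subset_right)
        rw [h2]; simp
    · have h1 : ⟪x (j, n, ⟨M, hM⟩), x (k, m, ⟨N, hN⟩)⟫_ℂ = 0 := by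
        change ⟪(lp.single 2 j _ : HS μ), (lp.single 2 k _ : HS μ)⟫_ℂ = 0
        rw [lp.inner_single_left, lp.single_apply_ne _ _ _ hjk, inner_zero_right]
      rw [h1]
      by_cases hnm : n = m
      · subst hnm
        exact (S.inner_vec_of_ne' hjk n hM hN).symm
      · exact (S.inner_vec_of_ne hnm M N).symm
  obtain ⟨Θ, hΘ⟩ := exists_unitary_of_gram (fun i k => (hgram i k).symm) hye hxe
  refine ⟨Θ, fun j n M hM f => ?_⟩
  rw [← Θ.inner_map_map, show vec r U E v j n M = y (j, n, ⟨M, hM⟩) from rfl, hΘ]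
  exact (HS.inner_single_indicator (Θ f) j (hA (j, n, ⟨M, hM⟩)) (hA' (j, n, ⟨M, hM⟩))).symm

end Unitary

end IsDilationSystem

/-- `Θ` turns `E` into multiplication by indicator functions, `P` into multiplication by the
variable, and `U` into a weighted dilation. -/
structure IsMulRepresentation {H J : Type*} [NormedAddCommGroup H] [InnerProductSpace ℂ H]
    [CompleteSpace H] (r q : ℝ) (P : H →ₗ.[ℂ] H) (U : H ≃ₗᵢ[ℂ] H) (E : Set ℝ → (H →L[ℂ] H))
    (μ : J → Measure ℝ) (Θ : H ≃ₗᵢ[ℂ] HS μ) : Prop where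
  E_ae : ∀ T, MeasurableSet T → ∀ f j, ∀ᵐ t ∂μ j, Θ (E T f) j t = T.indicator (Θ f j) t
  U_ae : ∀ f j, ∀ᵐ t ∂μ j, Θ (U f) j t = (r : ℂ) * Θ f j (q * t)
  U_symm_ae : ∀ f j, ∀ᵐ t ∂μ j, Θ (U.symm f) j t = (r : ℂ)⁻¹ * Θ f j (q⁻¹ * t)
  mem_graph_iff : ∀ f g, (f, g) ∈ P.graph ↔ ∀ j, ∀ᵐ t ∂μ j, Θ g j t = (t : ℂ) * Θ f j t

namespace IsDilationSystem

section Representation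

variable {H J : Type*} [NormedAddCommGroup H] [InnerProductSpace ℂ H]
    [CompleteSpace H] {r q : ℝ} {P : H →ₗ.[ℂ] H} {U : H ≃ₗᵢ[ℂ] H} {E : Set ℝ → (H →L[ℂ] H)}
    {s : J → ℝ} {v : J → H} {μ : J → Measure ℝ} {Θ : H ≃ₗᵢ[ℂ] HS μ}

theorem ae_eq_of_setIntegral (S : IsDilationSystem r q P U E s v)
    (hμ : ∀ j, μ j = dilationMeasure q (S.nu j)) {j : J} {f g : ℝ → ℂ}
    (hf : ∀ n : ℤ, IntegrableOn f ((fun t => q ^ (-n) * t) ⁻¹' layer q (s j)) (μ j))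
    (hg : ∀ n : ℤ, IntegrableOn g ((fun t => q ^ (-n) * t) ⁻¹' layer q (s j)) (μ j))
    (h : ∀ (n : ℤ) (M : Set ℝ), MeasurableSet M →
      ∫ t in (fun t => q ^ (-n) * t) ⁻¹' (M ∩ layer q (s j)), f t ∂μ j =
      ∫ t in (fun t => q ^ (-n) * t) ⁻¹' (M ∩ layer q (s j)), g t ∂μ j) :
    ∀ᵐ t ∂μ j, f t = g t := by
  rw [hμ j] at *
  exact ae_eq_of_setIntegral_scaled S.q_pos (S.nu_compl_layer j) hf hg h

theorem integrableOn_scaled (S : IsDilationSystem r q P U E s v)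
    (hμ : ∀ j, μ j = dilationMeasure q (S.nu j)) (f : HS μ) (j : J) (n : ℤ) :
    IntegrableOn (f j) ((fun t => q ^ (-n) * t) ⁻¹' layer q (s j)) (μ j) :=
  HS.integrableOn f j (by
    have := S.measure_scaled_ne_top hμ j n .univ
    rwa [Set.univ_inter] at this)

theorem ae_dilate (S : IsDilationSystem r q P U E s v)
    (hμ : ∀ j, μ j = dilationMeasure q (S.nu j)) {j : J} {p : ℝ → Prop} (h : ∀ᵐ t ∂μ j, p t) :
    ∀ᵐ t ∂μ j, ∀ k : ℤ, p (q ^ k * t) := by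
  rw [hμ j] at *
  exact ae_dilation S.q_pos h

theorem map_mu (S : IsDilationSystem r q P U E s v)
    (hμ : ∀ j, μ j = dilationMeasure q (S.nu j)) (j : J) :
    (μ j).map (fun t => q * t) = ENNReal.ofReal q⁻¹ • μ j := by
  have := map_dilationMeasure (ν := S.nu j) S.q_pos 1
  rw [hμ j]
  simpa using this

theorem E_ae (S : IsDilationSystem r q P U E s v)
    (hμ : ∀ j, μ j = dilationMeasure q (S.nu j))
    (hΘ : ∀ j n M, MeasurableSet M → ∀ f,
      ∫ t in (fun t => q ^ (-n) * t) ⁻¹' (M ∩ layer q (s j)), Θ f j t ∂μ j =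
        ⟪vec r U E v j n M, f⟫_ℂ) {T : Set ℝ} (hT : MeasurableSet T) (f : H) (j : J) :
    ∀ᵐ t ∂μ j, Θ (E T f) j t = T.indicator (Θ f j) t := by
  refine S.ae_eq_of_setIntegral hμ (fun n => S.integrableOn_scaled hμ _ j n)
    (fun n => (S.integrableOn_scaled hμ _ j n).indicator hT) fun n M hM => ?_
  have hT' : MeasurableSet ((fun t : ℝ => q ^ n * t) ⁻¹' T) := hT.preimage (by fun_prop)
  rw [hΘ j n M hM, ← S.spectral.inner_comm, S.apply_vec j n M hT, ← hΘ j n _ (hM.inter hT'),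
    setIntegral_indicator hT]
  have h : (fun t => q ^ (-n) * t) ⁻¹' (M ∩ (fun t => q ^ n * t) ⁻¹' T ∩ layer q (s j)) =
      (fun t => q ^ (-n) * t) ⁻¹' (M ∩ layer q (s j)) ∩ T := by
    ext t
    have : q ^ n * (q ^ (-n) * t) = t := by
      rw [← mul_assoc, ← zpow_add₀ S.q_pos.ne', add_neg_cancel, zpow_zero, one_mul]
    simp only [Set.mem_inter_iff, Set.mem_preimage, this]
    tauto
  rw [h]

theorem U_ae (S : IsDilationSystem r q P U E s v)
    (hμ : ∀ j, μ j = dilationMeasure q (S.nu j))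
    (hΘ : ∀ j n M, MeasurableSet M → ∀ f,
      ∫ t in (fun t => q ^ (-n) * t) ⁻¹' (M ∩ layer q (s j)), Θ f j t ∂μ j =
        ⟪vec r U E v j n M, f⟫_ℂ) (f : H) (j : J) :
    ∀ᵐ t ∂μ j, Θ (U f) j t = (r : ℂ) * Θ f j (q * t) := by
  have hq := S.q_pos
  have hr : (r : ℂ) ≠ 0 := by exact_mod_cast S.pos.ne'
  have hemb : MeasurableEmbedding fun t : ℝ => q * t := measurableEmbedding_mulLeft₀ hq.ne'
  have hpre : ∀ (n : ℤ) (A : Set ℝ), (fun t => q ^ (-n) * t) ⁻¹' A =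
      (fun t => q * t) ⁻¹' ((fun t => q ^ (-(n + 1)) * t) ⁻¹' A) := fun n A => by
    ext t
    simp only [Set.mem_preimage]
    rw [← mul_assoc, ← zpow_add_one₀ hq.ne']
    congr! 3; ring
  refine S.ae_eq_of_setIntegral hμ (fun n => S.integrableOn_scaled hμ _ j n)
    (fun n => ?_) fun n M hM => ?_
  · rw [hpre]
    refine Integrable.const_mul ?_ _
    refine (hemb.integrableOn_map_iff (f := Θ f j)).1 ?_
    rw [S.map_mu hμ, IntegrableOn, Measure.restrict_smul]
    exact (S.integrableOn_scaled hμ (Θ f) j (n + 1)).smul_measure ENNReal.ofReal_ne_top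
  · rw [hΘ j n M hM, integral_const_mul, hpre, ← hemb.setIntegral_map, S.map_mu hμ,
      Measure.restrict_smul, integral_smul_measure, hΘ j (n + 1) M hM]
    have h1 := U_vec (U := U) (E := E) (v := v) S.pos j (n + 1) M
    have h2 : vec r U E v j n M = (r : ℂ)⁻¹ • U (vec r U E v j (n + 1) M) := by
      rw [h1, smul_smul, inv_mul_cancel₀ hr, one_smul, add_sub_cancel_right]
    rw [h2, inner_smul_left, U.inner_map_map, ENNReal.toReal_ofReal (inv_pos.2 hq).le, map_inv₀,
      Complex.conj_ofReal, ← S.sq, Complex.real_smul]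
    push_cast
    field_simp

theorem U_symm_ae (S : IsDilationSystem r q P U E s v)
    (hμ : ∀ j, μ j = dilationMeasure q (S.nu j))
    (hΘ : ∀ j n M, MeasurableSet M → ∀ f,
      ∫ t in (fun t => q ^ (-n) * t) ⁻¹' (M ∩ layer q (s j)), Θ f j t ∂μ j =
        ⟪vec r U E v j n M, f⟫_ℂ) (f : H) (j : J) :
    ∀ᵐ t ∂μ j, Θ (U.symm f) j t = (r : ℂ)⁻¹ * Θ f j (q⁻¹ * t) := by
  have hr : (r : ℂ) ≠ 0 := by exact_mod_cast S.pos.ne'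
  filter_upwards [S.ae_dilate hμ (S.U_ae hμ hΘ (U.symm f) j)] with t ht
  have := ht (-1)
  rw [U.apply_symm_apply, zpow_neg_one, ← mul_assoc, mul_inv_cancel₀ S.q_pos.ne', one_mul] at this
  rw [this, inv_mul_cancel_left₀ hr]

theorem lintegral_le_meas (S : IsDilationSystem r q P U E s v)
    (hμ : ∀ j, μ j = dilationMeasure q (S.nu j))
    (hΘ : ∀ j n M, MeasurableSet M → ∀ f,
      ∫ t in (fun t => q ^ (-n) * t) ⁻¹' (M ∩ layer q (s j)), Θ f j t ∂μ j =
        ⟪vec r U E v j n M, f⟫_ℂ) (f : H) (j : J) {T : Set ℝ} (hT : MeasurableSet T) :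
    ∫⁻ t in T, ‖Θ f j t‖ₑ ^ 2 ∂μ j ≤ ENNReal.ofReal (‖E T f‖ ^ 2) := by
  rw [← Θ.norm_map]
  refine le_trans (le_of_eq ?_) (HS.lintegral_sq_le (Θ (E T f)) j)
  rw [← lintegral_indicator hT]
  refine lintegral_congr_ae ?_
  filter_upwards [S.E_ae hμ hΘ hT f j] with t ht
  rw [ht]
  by_cases h : t ∈ T <;> simp [h]

theorem P_ae (S : IsDilationSystem r q P U E s v)
    (hμ : ∀ j, μ j = dilationMeasure q (S.nu j))
    (hΘ : ∀ j n M, MeasurableSet M → ∀ f,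
      ∫ t in (fun t => q ^ (-n) * t) ⁻¹' (M ∩ layer q (s j)), Θ f j t ∂μ j =
        ⟪vec r U E v j n M, f⟫_ℂ) {f g : H} (h : (f, g) ∈ P.graph) (j : J) :
    ∀ᵐ t ∂μ j, Θ g j t = (t : ℂ) * Θ f j t := by
  set φ : ℝ → ℂ := fun t => Θ g j t - (t : ℂ) * Θ f j t with hφ
  have hφm : AEStronglyMeasurable φ (μ j) :=
    (HS.aestronglyMeasurable _ _).sub ((Complex.measurable_ofReal.aestronglyMeasurable).mul
      (HS.aestronglyMeasurable _ _))
  have hloc : ∀ a b : ℝ, a < b → ∫⁻ t in Set.Ico a b, ‖φ t‖ₑ ^ 2 ∂μ j ≤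
      ENNReal.ofReal (4 * (b - a) ^ 2) * S.spectral.meas f (Set.Ico a b) := by
    intro a b hab
    set w := g - (a : ℂ) • f with hw
    have hae : ∀ᵐ t ∂(μ j).restrict (Set.Ico a b), ‖φ t‖ₑ ^ 2 ≤
        2 * ‖Θ w j t‖ₑ ^ 2 + ENNReal.ofReal (2 * (b - a) ^ 2) * ‖Θ f j t‖ₑ ^ 2 := by
      have h1 : ∀ᵐ t ∂μ j, Θ w j t = Θ g j t - (a : ℂ) * Θ f j t := by
        rw [hw, map_sub, map_smul]
        filter_upwards [HS.sub_ae (Θ g) ((a : ℂ) • Θ f) j, HS.smul_ae (a : ℂ) (Θ f) j] with t h1 h2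
        rw [h1, h2]
      filter_upwards [ae_restrict_of_ae h1, ae_restrict_mem measurableSet_Ico] with t h1 ht
      have h2 : φ t = Θ w j t - ((t - a : ℝ) : ℂ) * Θ f j t := by
        rw [h1, hφ]; push_cast; ring
      have h3 : |t - a| ≤ b - a := by
        rw [abs_of_nonneg (sub_nonneg.2 ht.1)]; linarith [ht.2]
      have h4 : ‖φ t‖ ≤ ‖Θ w j t‖ + (b - a) * ‖Θ f j t‖ := by
        rw [h2]
        refine (norm_sub_le _ _).trans ?_
        rw [norm_mul, Complex.norm_real, Real.norm_eq_abs]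
        gcongr
      have h5 : ‖φ t‖ ^ 2 ≤ 2 * ‖Θ w j t‖ ^ 2 + 2 * (b - a) ^ 2 * ‖Θ f j t‖ ^ 2 := by
        have := norm_nonneg (φ t)
        nlinarith [sq_nonneg (‖Θ w j t‖ - (b - a) * ‖Θ f j t‖),
          sq_nonneg (‖Θ w j t‖ + (b - a) * ‖Θ f j t‖ - ‖φ t‖)]
      have h6 := ENNReal.ofReal_le_ofReal h5
      rw [ENNReal.ofReal_add (by positivity) (by positivity), ENNReal.ofReal_mul (by norm_num),
        ENNReal.ofReal_mul (by positivity), ENNReal.ofReal_pow (norm_nonneg _),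
        ENNReal.ofReal_pow (norm_nonneg _), ENNReal.ofReal_pow (norm_nonneg _),
        ofReal_norm, ofReal_norm, ofReal_norm] at h6
      simpa using h6
    refine (lintegral_mono_ae hae).trans ?_
    have hEI : E (Set.Icc a b) (E (Set.Ico a b) f) = E (Set.Ico a b) f := by
      rw [S.spectral.comp_apply, Set.inter_eq_right.2 Set.Ico_subset_Icc_self]
    have hwn : ‖E (Set.Ico a b) w‖ ^ 2 ≤ (b - a) ^ 2 * ‖E (Set.Ico a b) f‖ ^ 2 := by
      have := S.spectral.norm_sub_smul_le S.selfAdjoint hab.le hEI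
        (S.spectral.proj_graph S.selfAdjoint measurableSet_Ico h)
      rw [← mul_pow, hw, map_sub, map_smul]
      gcongr
    have hm1 : AEMeasurable (fun t => ‖Θ w j t‖ₑ ^ 2) ((μ j).restrict (Set.Ico a b)) :=
      ((HS.aestronglyMeasurable (Θ w) j).restrict.enorm).pow_const 2
    have hm2 : AEMeasurable (fun t => ‖Θ f j t‖ₑ ^ 2) ((μ j).restrict (Set.Ico a b)) :=
      ((HS.aestronglyMeasurable (Θ f) j).restrict.enorm).pow_const 2
    rw [lintegral_add_left' (hm1.const_mul _), lintegral_const_mul'' _ hm1,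
      lintegral_const_mul'' _ hm2]
    refine (add_le_add (mul_le_mul_right (S.lintegral_le_meas hμ hΘ w j measurableSet_Ico) _)
      (mul_le_mul_right (S.lintegral_le_meas hμ hΘ f j measurableSet_Ico) _)).trans ?_
    rw [S.spectral.meas_apply _ measurableSet_Ico, ← ENNReal.ofReal_mul (by positivity),
      ← ENNReal.ofReal_mul (by positivity), ← ENNReal.ofReal_ofNat 2,
      ← ENNReal.ofReal_mul (by norm_num),
      ← ENNReal.ofReal_add (by positivity) (by positivity)]
    refine ENNReal.ofReal_le_ofReal ?_
    nlinarith
  have hglob : ∀ δ : ℝ, 0 < δ → ∫⁻ t, ‖φ t‖ₑ ^ 2 ∂μ j ≤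
      ENNReal.ofReal (4 * δ ^ 2 * ‖f‖ ^ 2) := by
    intro δ hδ
    have hd : Pairwise (Function.onFun Disjoint fun n : ℤ => Set.Ico (n • δ) ((n + 1) • δ)) :=
      Set.pairwise_disjoint_Ico_zsmul δ
    have hU := iUnion_Ico_zsmul hδ
    rw [← setLIntegral_univ, ← hU, lintegral_iUnion (fun _ => measurableSet_Ico) hd]
    have h1 : ∀ n : ℤ, ∫⁻ t in Set.Ico (n • δ) ((n + 1) • δ), ‖φ t‖ₑ ^ 2 ∂μ j ≤
        ENNReal.ofReal (4 * δ ^ 2) * S.spectral.meas f (Set.Ico (n • δ) ((n + 1) • δ)) := by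
      intro n
      have h2 : (n + 1) • δ - n • δ = δ := by rw [add_smul, one_smul]; ring
      have := hloc (n • δ) ((n + 1) • δ) (by linarith)
      rwa [h2] at this
    refine (ENNReal.tsum_le_tsum h1).trans ?_
    rw [ENNReal.tsum_mul_left, ← measure_iUnion hd fun _ => measurableSet_Ico, hU,
      S.spectral.meas_apply f .univ, S.spectral.univ_apply, ← ENNReal.ofReal_mul (by positivity)]
  have hzero : ∫⁻ t, ‖φ t‖ₑ ^ 2 ∂μ j = 0 := by
    have hlim : Filter.Tendsto (fun δ : ℝ => ENNReal.ofReal (4 * δ ^ 2 * ‖f‖ ^ 2))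
        (nhdsWithin 0 (Set.Ioi 0)) (nhds 0) := by
      have : Filter.Tendsto (fun δ : ℝ => ENNReal.ofReal (4 * δ ^ 2 * ‖f‖ ^ 2))
          (nhds 0) (nhds (ENNReal.ofReal (4 * 0 ^ 2 * ‖f‖ ^ 2))) :=
        (ENNReal.continuous_ofReal.comp (by fun_prop)).tendsto 0
      simp only [ne_eq, OfNat.ofNat_ne_zero, not_false_eq_true, zero_pow, mul_zero, zero_mul,
        ENNReal.ofReal_zero] at this
      exact this.mono_left nhdsWithin_le_nhds
    refine le_antisymm (ge_of_tendsto hlim ?_) zero_le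
    filter_upwards [self_mem_nhdsWithin] with δ hδ using hglob δ hδ
  rw [lintegral_eq_zero_iff' (hφm.enorm.pow_const 2)] at hzero
  filter_upwards [hzero] with t ht
  have : φ t = 0 := by simpa using ht
  exact sub_eq_zero.1 this

theorem isMulRepresentation (S : IsDilationSystem r q P U E s v)
    (hμ : ∀ j, μ j = dilationMeasure q (S.nu j))
    (hΘ : ∀ j n M, MeasurableSet M → ∀ f,
      ∫ t in (fun t => q ^ (-n) * t) ⁻¹' (M ∩ layer q (s j)), Θ f j t ∂μ j =
        ⟪vec r U E v j n M, f⟫_ℂ) : IsMulRepresentation r q P U E μ Θ where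
  E_ae _ hT f j := S.E_ae hμ hΘ hT f j
  U_ae f j := S.U_ae hμ hΘ f j
  U_symm_ae f j := S.U_symm_ae hμ hΘ f j
  mem_graph_iff f g := by
    refine ⟨fun h j => S.P_ae hμ hΘ h j, fun h =>
      S.selfAdjoint.mem_graph_of_inner fun x y hxy => ?_⟩
    rw [← Θ.inner_map_map, ← Θ.inner_map_map f]
    refine HS.inner_congr fun j => ?_
    filter_upwards [h j, S.P_ae hμ hΘ hxy j] with t h1 h2
    rw [h1, h2, map_mul, Complex.conj_ofReal]
    ring

end Representation

end IsDilationSystem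

/-- The restriction of `m` to the layer of sign `s`, reflected to `[q, 1)` if `s = -1`. -/
def layerMap (q s : ℝ) (m : Measure ℝ) : Measure ℝ :=
  (m.restrict (layer q s)).map fun t => s * t

section LayerMap

variable {q s : ℝ} {m : Measure ℝ}

theorem sgn_mul_sgn_mul (hs : s = 1 ∨ s = -1) (t : ℝ) : s * (s * t) = t := by
  rcases hs with rfl | rfl <;> ring

theorem measurableEmbedding_sign_mul (hs : s = 1 ∨ s = -1) :
    MeasurableEmbedding fun t : ℝ => s * t :=
  measurableEmbedding_mulLeft₀ (by rcases hs with rfl | rfl <;> norm_num)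

theorem ae_layerMap_iff (hs : s = 1 ∨ s = -1) {p : ℝ → Prop} :
    (∀ᵐ x ∂layerMap q s m, p x) ↔ ∀ᵐ t ∂m, t ∈ layer q s → p (s * t) := by
  rw [layerMap, (measurableEmbedding_sign_mul hs).ae_map_iff,
    ae_restrict_iff' (measurableSet_layer _ _)]

theorem ae_mem_Ico_layerMap (hs : s = 1 ∨ s = -1) : ∀ᵐ x ∂layerMap q s m, x ∈ Set.Ico q 1 :=
  (ae_layerMap_iff hs).2 (.of_forall fun _ ht => ht)

theorem measurable_density : Measurable fun t : ℝ => ENNReal.ofReal t⁻¹ := by fun_prop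

theorem wd_absolutelyContinuous : wd (layerMap q s m) ≪ layerMap q s m :=
  withDensity_absolutelyContinuous _ _

theorem absolutelyContinuous_wd (hq : 0 < q) (hs : s = 1 ∨ s = -1) :
    layerMap q s m ≪ wd (layerMap q s m) := by
  refine withDensity_absolutelyContinuous' measurable_density.aemeasurable ?_
  filter_upwards [ae_mem_Ico_layerMap hs] with x hx
  rw [ne_eq, ENNReal.ofReal_eq_zero, not_le]
  exact inv_pos.2 (hq.trans_le hx.1)

theorem ae_wd_iff (hq : 0 < q) (hs : s = 1 ∨ s = -1) {p : ℝ → Prop} :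
    (∀ᵐ x ∂wd (layerMap q s m), p x) ↔ ∀ᵐ t ∂m, t ∈ layer q s → p (s * t) := by
  rw [← ae_layerMap_iff hs]
  exact ⟨fun h => (absolutelyContinuous_wd hq hs).ae_le h,
    fun h => wd_absolutelyContinuous.ae_le h⟩

theorem le_wd (hq : 0 < q) (hs : s = 1 ∨ s = -1) : layerMap q s m ≤ wd (layerMap q s m) := by
  conv_lhs => rw [← withDensity_one (μ := layerMap q s m)]
  refine withDensity_mono ?_
  filter_upwards [ae_mem_Ico_layerMap hs] with x hx
  rw [Pi.one_apply, ENNReal.one_le_ofReal]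
  exact (one_le_inv₀ (hq.trans_le hx.1)).2 hx.2.le

theorem wd_le (hq : 0 < q) (hs : s = 1 ∨ s = -1) :
    wd (layerMap q s m) ≤ ENNReal.ofReal q⁻¹ • layerMap q s m := by
  rw [← withDensity_const]
  refine withDensity_mono ?_
  filter_upwards [ae_mem_Ico_layerMap hs] with x hx
  exact ENNReal.ofReal_le_ofReal (inv_anti₀ hq hx.1)

theorem eLpNorm_indicator_le (hq : 0 < q) (hs : s = 1 ∨ s = -1) (F : ℝ → ℂ) :
    eLpNorm ((layer q s).indicator fun t => F (s * t)) 2 m ≤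
      eLpNorm F 2 (wd (layerMap q s m)) := by
  rw [eLpNorm_indicator_eq_eLpNorm_restrict (measurableSet_layer _ _)]
  refine le_trans (le_of_eq ?_) (eLpNorm_mono_measure F (le_wd hq hs))
  rw [layerMap, (measurableEmbedding_sign_mul hs).eLpNorm_map_measure]
  rfl

theorem eLpNorm_wd_le (hq : 0 < q) (hs : s = 1 ∨ s = -1) (G : ℝ → ℂ) :
    eLpNorm (fun x => G (s * x)) 2 (wd (layerMap q s m)) ≤
      ENNReal.ofReal q⁻¹ ^ (1 / 2 : ENNReal).toReal * eLpNorm G 2 m := by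
  refine (eLpNorm_mono_measure _ (wd_le hq hs)).trans ?_
  rw [eLpNorm_smul_measure_of_ne_top (by norm_num), smul_eq_mul, layerMap,
    (measurableEmbedding_sign_mul hs).eLpNorm_map_measure]
  gcongr
  refine le_trans (le_of_eq ?_) (eLpNorm_mono_measure G (Measure.restrict_le_self (s := layer q s)))
  congr 1
  ext t
  simp only [Function.comp_apply, sgn_mul_sgn_mul hs]

theorem aestronglyMeasurable_indicator_layer (hq : 0 < q) (hs : s = 1 ∨ s = -1) {F : ℝ → ℂ}
    (hF : AEStronglyMeasurable F (wd (layerMap q s m))) :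
    AEStronglyMeasurable ((layer q s).indicator fun t => F (s * t)) m := by
  rw [aestronglyMeasurable_indicator_iff (measurableSet_layer _ _)]
  exact (measurableEmbedding_sign_mul hs).aestronglyMeasurable_map_iff.1
    (hF.mono_ac (absolutelyContinuous_wd hq hs))

theorem aestronglyMeasurable_wd (hs : s = 1 ∨ s = -1) {G : ℝ → ℂ}
    (hG : AEStronglyMeasurable G m) :
    AEStronglyMeasurable (fun x => G (s * x)) (wd (layerMap q s m)) := by
  refine AEStronglyMeasurable.mono_ac wd_absolutelyContinuous ?_
  refine (measurableEmbedding_sign_mul hs).aestronglyMeasurable_map_iff.2 ?_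
  refine hG.restrict.congr (.of_forall fun t => ?_)
  simp only [Function.comp_apply, sgn_mul_sgn_mul hs]

theorem integral_wd (hq : 0 < q) (hs : s = 1 ∨ s = -1) (F : ℝ → ℂ) :
    ∫ x, F x ∂wd (layerMap q s m) = ∫ t in layer q s, ((s * t)⁻¹ : ℝ) * F (s * t) ∂m := by
  rw [wd, integral_withDensity_eq_integral_toReal_smul measurable_density
    (.of_forall fun _ => ENNReal.ofReal_lt_top), layerMap,
    (measurableEmbedding_sign_mul hs).integral_map]
  refine setIntegral_congr_fun (measurableSet_layer _ _) fun t ht => ?_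
  rw [ENNReal.toReal_ofReal (inv_pos.2 (hq.trans_le ht.1)).le, Complex.real_smul]

end LayerMap

namespace HS

section Lift

variable {Ip Im : Type*} {q : ℝ} {μ : Ip ⊕ Im → Measure ℝ}

/-- The sign of a component. -/
abbrev sgn : Ip ⊕ Im → ℝ := Sum.elim (fun _ => 1) fun _ => -1

theorem sgn_cases (j : Ip ⊕ Im) : sgn j = 1 ∨ sgn j = -1 := by
  rcases j with j | j
  exacts [Or.inl rfl, Or.inr rfl]

/-- The boundary space of sign `1`. -/
abbrev BdryP (q : ℝ) (μ : Ip ⊕ Im → Measure ℝ) : Type _ :=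
  HS fun i : Ip => wd (layerMap q 1 (μ (Sum.inl i)))

/-- The boundary space of sign `-1`. -/
abbrev BdryM (q : ℝ) (μ : Ip ⊕ Im → Measure ℝ) : Type _ :=
  HS fun i : Im => wd (layerMap q (-1) (μ (Sum.inr i)))

/-- The components of a pair of boundary vectors. -/
def bdryFun (z : BdryP q μ × BdryM q μ) : Ip ⊕ Im → ℝ → ℂ :=
  Sum.elim (fun i => z.1 i) fun i => z.2 i

/-- A pair of boundary vectors as a function on the two fundamental layers. -/
def liftFun (z : BdryP q μ × BdryM q μ) (j : Ip ⊕ Im) : ℝ → ℂ :=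
  (layer q (sgn j)).indicator fun t => bdryFun z j (sgn j * t)

theorem bdryFun_add_ae (z w : BdryP q μ × BdryM q μ) (j : Ip ⊕ Im) :
    ∀ᵐ x ∂wd (layerMap q (sgn j) (μ j)),
      bdryFun (z + w) j x = bdryFun z j x + bdryFun w j x := by
  rcases j with i | i
  · exact add_ae z.1 w.1 i
  · exact add_ae z.2 w.2 i

theorem bdryFun_smul_ae (c : ℂ) (z : BdryP q μ × BdryM q μ) (j : Ip ⊕ Im) :
    ∀ᵐ x ∂wd (layerMap q (sgn j) (μ j)), bdryFun (c • z) j x = c * bdryFun z j x := by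
  rcases j with i | i
  · exact smul_ae c z.1 i
  · exact smul_ae c z.2 i

theorem aestronglyMeasurable_bdryFun (z : BdryP q μ × BdryM q μ) (j : Ip ⊕ Im) :
    AEStronglyMeasurable (bdryFun z j) (wd (layerMap q (sgn j) (μ j))) := by
  rcases j with i | i
  · exact aestronglyMeasurable z.1 i
  · exact aestronglyMeasurable z.2 i

theorem liftFun_add_ae (hq : 0 < q) (z w : BdryP q μ × BdryM q μ) (j : Ip ⊕ Im) :
    ∀ᵐ t ∂μ j, liftFun (z + w) j t = liftFun z j t + liftFun w j t := by
  filter_upwards [(ae_wd_iff hq (sgn_cases j)).1 (bdryFun_add_ae z w j)] with t ht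
  by_cases h : t ∈ layer q (sgn j)
  · simpa [liftFun, h] using ht h
  · simp [liftFun, h]

theorem liftFun_smul_ae (hq : 0 < q) (c : ℂ) (z : BdryP q μ × BdryM q μ) (j : Ip ⊕ Im) :
    ∀ᵐ t ∂μ j, liftFun (c • z) j t = c * liftFun z j t := by
  filter_upwards [(ae_wd_iff hq (sgn_cases j)).1 (bdryFun_smul_ae c z j)] with t ht
  by_cases h : t ∈ layer q (sgn j)
  · simpa [liftFun, h] using ht h
  · simp [liftFun, h]

theorem exists_linearMap {Z J : Type*} [AddCommGroup Z] [Module ℂ Z] {ν : J → Measure ℝ}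
    {φ : Z → J → ℝ → ℂ} (h : ∀ z, ∃ g : HS ν, ∀ j, ∀ᵐ t ∂ν j, g j t = φ z j t)
    (hadd : ∀ z w j, ∀ᵐ t ∂ν j, φ (z + w) j t = φ z j t + φ w j t)
    (hsmul : ∀ (c : ℂ) z j, ∀ᵐ t ∂ν j, φ (c • z) j t = c * φ z j t) :
    ∃ L : Z →ₗ[ℂ] HS ν, ∀ z j, ∀ᵐ t ∂ν j, L z j t = φ z j t := by
  choose L hL using h
  refine ⟨⟨⟨L, fun z w => ext_ae fun j => ?_⟩, fun c z => ext_ae fun j => ?_⟩, hL⟩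
  · filter_upwards [hL (z + w) j, hL z j, hL w j, hadd z w j, add_ae (L z) (L w) j]
      with t h1 h2 h3 h4 h5
    rw [h1, h5, h4, h2, h3]
  · filter_upwards [hL (c • z) j, hL z j, hsmul c z j, smul_ae c (L z) j] with t h1 h2 h3 h4
    rw [h1, RingHom.id_apply, h4, h3, h2]

theorem exists_lift (hq : 0 < q) (z : BdryP q μ × BdryM q μ) :
    ∃ g : HS μ, ∀ j, ∀ᵐ t ∂μ j, g j t = liftFun z j t := by
  refine exists_of_eLpNorm_le (c := Sum.elim (fun i => ‖z.1 i‖) fun i => ‖z.2 i‖)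
    (fun j => aestronglyMeasurable_indicator_layer hq (sgn_cases j)
      (aestronglyMeasurable_bdryFun z j)) ?_ ?_ fun j => ?_
  · rintro (i | i) <;> exact norm_nonneg _
  · exact Summable.sum _ (summable_norm_sq z.1) (summable_norm_sq z.2)
  · refine (eLpNorm_indicator_le hq (sgn_cases j) _).trans ?_
    rcases j with i | i
    · refine le_of_eq ?_
      rw [Sum.elim_inl, Lp.norm_def, ENNReal.ofReal_toReal (Lp.eLpNorm_ne_top _)]
      rfl
    · refine le_of_eq ?_
      rw [Sum.elim_inr, Lp.norm_def, ENNReal.ofReal_toReal (Lp.eLpNorm_ne_top _)]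
      rfl

theorem exists_inv_lift (hq : 0 < q) (z : BdryP q μ × BdryM q μ) :
    ∃ g : HS μ, ∀ j, ∀ᵐ t ∂μ j, g j t = (t : ℂ)⁻¹ * liftFun z j t := by
  obtain ⟨g, hg⟩ := exists_lift hq z
  refine exists_of_bound g (inv_pos.2 hq).le (fun j => ?_) fun j => ?_
  · exact ((by fun_prop : Measurable fun t : ℝ => (t : ℂ)⁻¹).aestronglyMeasurable).mul
      (aestronglyMeasurable_indicator_layer hq (sgn_cases j) (aestronglyMeasurable_bdryFun z j))
  · filter_upwards [hg j] with t ht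
    rw [ht, norm_mul]
    by_cases h : t ∈ layer q (sgn j)
    · gcongr
      rw [norm_inv, Complex.norm_real, Real.norm_eq_abs]
      refine inv_anti₀ hq ?_
      have h1 : |sgn j * t| = |t| := by rcases sgn_cases j with h2 | h2 <;> simp [h2]
      rw [← h1]
      exact h.1.trans (le_abs_self _)
    · simp [liftFun, h]

theorem exists_bdry (hq : 0 < q) (f : HS μ) :
    ∃ z : BdryP q μ × BdryM q μ, ∀ j, ∀ᵐ t ∂μ j,
      liftFun z j t = (layer q (sgn j)).indicator (f j) t := by
  set K : ℝ := (ENNReal.ofReal q⁻¹ ^ (1 / 2 : ENNReal).toReal).toReal with hK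
  have hKe : ENNReal.ofReal q⁻¹ ^ (1 / 2 : ENNReal).toReal = ENNReal.ofReal K := by
    rw [hK, ENNReal.ofReal_toReal]
    exact ENNReal.rpow_ne_top_of_nonneg (by positivity) ENNReal.ofReal_ne_top
  have hK0 : 0 ≤ K := ENNReal.toReal_nonneg
  have hbd : ∀ j, eLpNorm (fun x => f j (sgn j * x)) 2 (wd (layerMap q (sgn j) (μ j))) ≤
      ENNReal.ofReal (K * ‖f j‖) := fun j => by
    refine (eLpNorm_wd_le hq (sgn_cases j) _).trans (le_of_eq ?_)
    rw [hKe, Lp.norm_def, ENNReal.ofReal_mul hK0, ENNReal.ofReal_toReal (Lp.eLpNorm_ne_top _)]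
  have hsum : Summable fun j => (K * ‖f j‖) ^ 2 := by
    simp_rw [mul_pow]
    exact (summable_norm_sq f).mul_left _
  obtain ⟨a, ha⟩ := exists_of_eLpNorm_le
    (ν := fun i : Ip => wd (layerMap q 1 (μ (Sum.inl i)))) (φ := fun i x => f (Sum.inl i) (1 * x))
    (fun i => aestronglyMeasurable_wd (Or.inl rfl) (aestronglyMeasurable f _))
    (c := fun i => K * ‖f (Sum.inl i)‖) (fun i => by positivity)
    (hsum.comp_injective Sum.inl_injective) fun i => hbd (Sum.inl i)
  obtain ⟨c, hc⟩ := exists_of_eLpNorm_le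
    (ν := fun i : Im => wd (layerMap q (-1) (μ (Sum.inr i))))
    (φ := fun i x => f (Sum.inr i) (-1 * x))
    (fun i => aestronglyMeasurable_wd (Or.inr rfl) (aestronglyMeasurable f _))
    (c := fun i => K * ‖f (Sum.inr i)‖) (fun i => by positivity)
    (hsum.comp_injective Sum.inr_injective) fun i => hbd (Sum.inr i)
  refine ⟨(a, c), fun j => ?_⟩
  have h : ∀ᵐ x ∂wd (layerMap q (sgn j) (μ j)), bdryFun (a, c) j x = f j (sgn j * x) := by
    rcases j with i | i
    exacts [ha i, hc i]
  filter_upwards [(ae_wd_iff hq (sgn_cases j)).1 h] with t ht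
  by_cases hl : t ∈ layer q (sgn j)
  · simpa [liftFun, hl, sgn_mul_sgn_mul (sgn_cases j)] using ht hl
  · simp [liftFun, hl]

theorem inner_lift (hq : 0 < q) {z w : BdryP q μ × BdryM q μ} {f g : HS μ}
    (hf : ∀ j, ∀ᵐ t ∂μ j, f j t = (t : ℂ)⁻¹ * liftFun z j t)
    (hg : ∀ j, ∀ᵐ t ∂μ j, g j t = liftFun w j t) :
    ⟪f, g⟫_ℂ = ⟪z.1, w.1⟫_ℂ - ⟪z.2, w.2⟫_ℂ := by
  have key : ∀ j, ∫ t, (starRingEnd ℂ) (f j t) * g j t ∂μ j =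
      (sgn j : ℂ) * ∫ x, (starRingEnd ℂ) (bdryFun z j x) * bdryFun w j x
        ∂wd (layerMap q (sgn j) (μ j)) := by
    intro j
    rw [integral_wd hq (sgn_cases j), ← integral_const_mul,
      ← integral_indicator (measurableSet_layer _ _)]
    refine integral_congr_ae ?_
    filter_upwards [hf j, hg j] with t h1 h2
    rw [h1, h2]
    by_cases hl : t ∈ layer q (sgn j)
    · simp only [liftFun, hl, Set.indicator_of_mem, map_mul, map_inv₀, Complex.conj_ofReal]
      rcases sgn_cases j with h3 | h3 <;> rw [h3] <;> push_cast
      · ring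
      · rw [mul_inv]; ring
    · simp [liftFun, hl]
  have hs : Summable fun j => @inner ℂ _ _ (f j) (g j) := lp.summable_inner f g
  have e : ∀ j, @inner ℂ _ _ (f j) (g j) = ∫ t, (starRingEnd ℂ) (f j t) * g j t ∂μ j := by
    intro j
    rw [L2.inner_def]
    refine integral_congr_ae (.of_forall fun t => ?_)
    simp [mul_comm]
  rw [lp.inner_eq_tsum, Summable.tsum_sum (hs.comp_injective Sum.inl_injective)
    (hs.comp_injective Sum.inr_injective), inner_eq_tsum z.1, inner_eq_tsum z.2, sub_eq_add_neg,
    ← tsum_neg]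
  congr 1
  · refine tsum_congr fun i => ?_
    rw [e, key]
    simp [bdryFun]
  · refine tsum_congr fun i => ?_
    rw [e, key]
    simp [bdryFun]

end Lift

end HS

namespace IsMulRepresentation

section Boundary

variable {Ip Im H : Type*} [NormedAddCommGroup H] [InnerProductSpace ℂ H]
    {r q : ℝ} {P : H →ₗ.[ℂ] H} {U : H ≃ₗᵢ[ℂ] H} {E : Set ℝ → (H →L[ℂ] H)}
    {v : Ip ⊕ Im → H} {μ : Ip ⊕ Im → Measure ℝ} {Θ : H ≃ₗᵢ[ℂ] HS μ}

theorem ext_ae {f g : H} (h : ∀ j, ∀ᵐ t ∂μ j, Θ f j t = Θ g j t) : f = g :=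
  Θ.injective (HS.ext_ae h)

theorem exists_boundaryMaps (hq0 : 0 < q) (Θ : H ≃ₗᵢ[ℂ] HS μ) :
    ∃ ι κ : HS.BdryP q μ × HS.BdryM q μ →ₗ[ℂ] H,
      (∀ z j, ∀ᵐ t ∂μ j, Θ (ι z) j t = HS.liftFun z j t) ∧
      ∀ z j, ∀ᵐ t ∂μ j, Θ (κ z) j t = (t : ℂ)⁻¹ * HS.liftFun z j t := by
  obtain ⟨L, hL⟩ := HS.exists_linearMap (HS.exists_lift (μ := μ) hq0) (HS.liftFun_add_ae hq0)
    (HS.liftFun_smul_ae hq0)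
  obtain ⟨K, hK⟩ := HS.exists_linearMap (HS.exists_inv_lift (μ := μ) hq0)
    (fun z w j => (HS.liftFun_add_ae hq0 z w j).mono fun t ht => by rw [ht, mul_add])
    fun c z j => (HS.liftFun_smul_ae hq0 c z j).mono fun t ht => by rw [ht, mul_left_comm]
  refine ⟨(Θ.symm : HS μ →ₗ[ℂ] H) ∘ₗ L, (Θ.symm : HS μ →ₗ[ℂ] H) ∘ₗ K, fun z j => ?_,
    fun z j => ?_⟩
  · filter_upwards [hL z j] with t ht
    rw [← ht]
    exact congrArg (fun f : HS μ => f j t) (Θ.apply_symm_apply (L z))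
  · filter_upwards [hK z j] with t ht
    rw [← ht]
    exact congrArg (fun f : HS μ => f j t) (Θ.apply_symm_apply (K z))

variable [CompleteSpace H]

theorem ae_sgn_mul_pos (S : IsDilationSystem r q P U E HS.sgn v)
    (hμ : ∀ j, μ j = dilationMeasure q (S.nu j)) (j : Ip ⊕ Im) :
    ∀ᵐ t ∂μ j, 0 < HS.sgn j * t := by
  rw [hμ j]
  exact ae_mul_pos S.q_pos (S.nu_compl_layer j)

theorem ae_ne_zero (S : IsDilationSystem r q P U E HS.sgn v)
    (hμ : ∀ j, μ j = dilationMeasure q (S.nu j)) (j : Ip ⊕ Im) : ∀ᵐ t ∂μ j, ((t : ℝ) : ℂ) ≠ 0 := by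
  filter_upwards [ae_sgn_mul_pos S hμ j] with t ht h
  rw [Complex.ofReal_eq_zero] at h
  simp [h] at ht

theorem mem_Ioo_iff (j : Ip ⊕ Im) (t : ℝ) :
    t ∈ Set.Ioo (-1 : ℝ) 1 ↔ -1 < HS.sgn j * t ∧ HS.sgn j * t < 1 := by
  rcases HS.sgn_cases j with h | h <;> rw [h, Set.mem_Ioo] <;> constructor <;> rintro ⟨h1, h2⟩ <;>
    constructor <;> linarith

theorem inv_mul_notMem_Ioo (hq0 : 0 < q) (hq1 : q < 1) {t : ℝ} (ht : t ∉ Set.Ioo (-1 : ℝ) 1) :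
    q⁻¹ * t ∉ Set.Ioo (-1 : ℝ) 1 := by
  rintro ⟨h1, h2⟩
  rw [inv_mul_eq_div, lt_div_iff₀ hq0] at h1
  rw [inv_mul_eq_div, div_lt_iff₀ hq0] at h2
  exact ht ⟨by linarith, by linarith⟩

theorem layer_subset_Ioo (hq0 : 0 < q) (j : Ip ⊕ Im) {t : ℝ} (ht : t ∈ layer q (HS.sgn j)) :
    t ∈ Set.Ioo (-1 : ℝ) 1 :=
  (mem_Ioo_iff j t).2 ⟨by linarith [ht.1], ht.2⟩

theorem mul_notMem_layer (hq0 : 0 < q) (j : Ip ⊕ Im) {t : ℝ} (ht : t ∈ Set.Ioo (-1 : ℝ) 1) :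
    q * t ∉ layer q (HS.sgn j) := by
  rintro ⟨h, -⟩
  have h2 := ((mem_Ioo_iff j t).1 ht).2
  nlinarith

variable {ι κ : HS.BdryP q μ × HS.BdryM q μ →ₗ[ℂ] H}

theorem apply_U_eq_zero (S : IsDilationSystem r q P U E HS.sgn v)
    (hμ : ∀ j, μ j = dilationMeasure q (S.nu j)) (R : IsMulRepresentation r q P U E μ Θ)
    {f : H} (hf : ∀ j, ∀ᵐ t ∂μ j, t ∉ layer q (HS.sgn j) → Θ f j t = 0) :
    E (Set.Ioo (-1) 1) (U f) = 0 := by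
  refine ext_ae (Θ := Θ) fun j => ?_
  filter_upwards [R.E_ae _ measurableSet_Ioo (U f) j, R.U_ae f j, S.ae_dilate hμ (hf j),
    HS.zero_ae (ν := μ) j] with t h1 h2 h3 h4
  rw [h1, map_zero, h4]
  by_cases ht : t ∈ Set.Ioo (-1 : ℝ) 1
  · have h5 := h3 1
    rw [zpow_one] at h5
    rw [Set.indicator_of_mem ht, h2, h5 (mul_notMem_layer S.q_pos j ht), mul_zero]
  · rw [Set.indicator_of_notMem ht]

theorem surj (S : IsDilationSystem r q P U E HS.sgn v)
    (hμ : ∀ j, μ j = dilationMeasure q (S.nu j)) (R : IsMulRepresentation r q P U E μ Θ)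
    (hι : ∀ z j, ∀ᵐ t ∂μ j, Θ (ι z) j t = HS.liftFun z j t) {k : H}
    (hk : E (Set.Ioo (-1) 1) k = k) (hk' : E (Set.Ioo (-1) 1) (U (U k)) = 0) :
    ∃ z z', k = ι z + (r : ℂ) • U.symm (ι z') := by
  have hr : (r : ℂ) ≠ 0 := by exact_mod_cast S.pos.ne'
  have hq0 := S.q_pos
  obtain ⟨z, hz⟩ := HS.exists_bdry hq0 (Θ k)
  obtain ⟨w, hw⟩ := HS.exists_bdry hq0 (Θ (U k))
  refine ⟨z, (r : ℂ)⁻¹ • w, ext_ae (Θ := Θ) fun j => ?_⟩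
  rw [map_smul, map_smul, smul_inv_smul₀ hr, map_add]
  filter_upwards [HS.add_ae (Θ (ι z)) (Θ (U.symm (ι w))) j, hι z j, hz j, R.U_symm_ae (ι w) j,
    S.ae_dilate hμ (hι w j), S.ae_dilate hμ (hw j), S.ae_dilate hμ (R.U_ae k j),
    S.ae_dilate hμ (R.U_ae (U k) j), S.ae_dilate hμ (R.E_ae _ measurableSet_Ioo (U (U k)) j),
    S.ae_dilate hμ (HS.zero_ae (ν := μ) j), R.E_ae _ measurableSet_Ioo k j,
    ae_sgn_mul_pos S hμ j] with t h1 h2 h3 h4 h5 h6 h7 h8 h9 h10 h11 hpos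
  have e1 : q * (q⁻¹ * t) = t := mul_inv_cancel_left₀ hq0.ne' t
  have e2 : q * (q ^ (-2 : ℤ) * t) = q⁻¹ * t := by
    rw [zpow_neg]
    field_simp
  have h5' := h5 (-1)
  have h6' := h6 (-1)
  have h7' := h7 (-1)
  rw [zpow_neg_one] at h5' h6' h7'
  rw [e1] at h7'
  rw [h1, h2, h3, h4, h5', h6']
  by_cases ht : t ∈ layer q (HS.sgn j)
  · have ht' : q⁻¹ * t ∉ layer q (HS.sgn j) := by
      rintro ⟨-, h⟩
      have := ht.1
      rw [mul_left_comm, inv_mul_lt_iff₀ hq0] at h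
      linarith
    rw [Set.indicator_of_mem ht, Set.indicator_of_notMem ht', mul_zero, add_zero]
  · rw [Set.indicator_of_notMem ht, zero_add]
    by_cases ht' : q⁻¹ * t ∈ layer q (HS.sgn j)
    · rw [Set.indicator_of_mem ht', h7', inv_mul_cancel_left₀ hr]
    · rw [Set.indicator_of_notMem ht', mul_zero]
      by_cases hT : t ∈ Set.Ioo (-1 : ℝ) 1
      · have h8' := h8 (-2)
        rw [e2, h7'] at h8'
        have h9' := h9 (-2)
        rw [hk', map_zero, h10 (-2), Set.indicator_of_mem, h8'] at h9'
        · simpa [hr] using h9'.symm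
        · have hlt := ((mem_Ioo_iff j t).1 hT).2
          have h12 : HS.sgn j * t < q := by
            by_contra! h
            exact ht ⟨h, hlt⟩
          have h13 : q⁻¹ * (HS.sgn j * t) < q := by
            by_contra! h
            refine ht' ⟨by rwa [mul_left_comm], ?_⟩
            rwa [mul_left_comm, inv_mul_lt_iff₀ hq0, mul_one]
          have h14 : HS.sgn j * (q ^ (-2 : ℤ) * t) = q⁻¹ * (q⁻¹ * (HS.sgn j * t)) := by
            rw [zpow_neg, zpow_ofNat]
            field_simp
          rw [mem_Ioo_iff j, h14]
          refine ⟨by linarith [mul_pos (inv_pos.2 hq0) (mul_pos (inv_pos.2 hq0) hpos)], ?_⟩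
          rwa [inv_mul_lt_iff₀ hq0, mul_one]
      · rw [hk, Set.indicator_of_notMem hT] at h11
        exact h11

theorem isBoundaryData (S : IsDilationSystem r q P U E HS.sgn v)
    (hμ : ∀ j, μ j = dilationMeasure q (S.nu j)) (R : IsMulRepresentation r q P U E μ Θ)
    (hι : ∀ z j, ∀ᵐ t ∂μ j, Θ (ι z) j t = HS.liftFun z j t)
    (hκ : ∀ z j, ∀ᵐ t ∂μ j, Θ (κ z) j t = (t : ℂ)⁻¹ * HS.liftFun z j t) :
    IsBoundaryData r P U (E (Set.Ioo (-1) 1)) ι κ where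
  Q_idem f := by rw [S.spectral.comp_apply, Set.inter_self]
  Q_symm f g := S.spectral.inner_comm _ f g
  Q_U f := by
    refine ext_ae (Θ := Θ) fun j => ?_
    set T := Set.Ioo (-1 : ℝ) 1
    filter_upwards [R.E_ae T measurableSet_Ioo (U.symm (E T f)) j, R.U_symm_ae (E T f) j,
      S.ae_dilate hμ (R.E_ae T measurableSet_Ioo f j)] with t h1 h2 h3
    rw [h1]
    by_cases ht : t ∈ T
    · rw [Set.indicator_of_mem ht]
    · have h4 := h3 (-1)
      rw [zpow_neg_one, Set.indicator_of_notMem (inv_mul_notMem_Ioo S.q_pos S.lt_one ht)] at h4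
      rw [Set.indicator_of_notMem ht, h2, h4, mul_zero]
  P_Q f g h := S.spectral.proj_graph S.selfAdjoint measurableSet_Ioo h
  dom_Q f := S.spectral.mem_domain_of_bounded
    (S.spectral.apply_eq_of_subset Set.Ioo_subset_Icc_self
      (by rw [S.spectral.comp_apply, Set.inter_self]))
  ran_Q f := by
    set T := Set.Ioo (-1 : ℝ) 1
    obtain ⟨g, hg⟩ := HS.exists_of_bound (Θ f) zero_le_one
      (φ := fun j t => (t : ℂ)⁻¹ * Tᶜ.indicator (Θ f j) t)
      (fun j => (by fun_prop : Measurable fun t : ℝ => (t : ℂ)⁻¹).aestronglyMeasurable.mul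
        ((HS.aestronglyMeasurable _ j).indicator measurableSet_Ioo.compl)) fun j => by
        refine .of_forall fun t => ?_
        by_cases ht : t ∈ T
        · simp [ht]
        · rw [Set.indicator_of_mem (Set.mem_compl ht), norm_mul]
          gcongr
          rw [norm_inv, Complex.norm_real, Real.norm_eq_abs]
          refine inv_le_one_of_one_le₀ ?_
          by_contra! h
          exact ht (abs_lt.1 h)
    refine ⟨Θ.symm g, (R.mem_graph_iff _ _).2 fun j => ?_⟩
    rw [map_sub, Θ.apply_symm_apply]
    filter_upwards [HS.sub_ae (Θ f) (Θ (E T f)) j, R.E_ae T measurableSet_Ioo f j, hg j,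
      ae_ne_zero S hμ j] with t h1 h2 h3 h4
    rw [h1, h2, h3, mul_inv_cancel_left₀ h4]
    by_cases ht : t ∈ T <;> simp [ht]
  j_ι z := by
    refine (R.mem_graph_iff _ _).2 fun j => ?_
    filter_upwards [hι z j, hκ z j, ae_ne_zero S hμ j] with t h1 h2 h3
    rw [h1, h2, mul_inv_cancel_left₀ h3]
  Q_ι z := by
    refine ext_ae (Θ := Θ) fun j => ?_
    filter_upwards [R.E_ae _ measurableSet_Ioo (ι z) j, hι z j] with t h1 h2
    rw [h1]
    by_cases ht : t ∈ Set.Ioo (-1 : ℝ) 1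
    · rw [Set.indicator_of_mem ht]
    · rw [Set.indicator_of_notMem ht, h2, HS.liftFun, Set.indicator_of_notMem]
      exact fun h => ht (layer_subset_Ioo S.q_pos j h)
  Q_U_j z := apply_U_eq_zero S hμ R fun j => by
    filter_upwards [hκ z j] with t h ht
    rw [h, HS.liftFun, Set.indicator_of_notMem ht, mul_zero]
  form z w := by
    rw [← Θ.inner_map_map]
    exact HS.inner_lift S.q_pos (hκ z) (hι w)
  surj k hk hk' := surj S hμ R hι hk hk'

end Boundary

end IsMulRepresentation

section Extension

variable {q : ℝ} {h g : ℝ → ℂ}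

theorem exists_isEvenExt (hq0 : 0 < q) (hq1 : q < 1) (h : ℝ → ℂ) : ∃ g, IsEvenExt q h g := by
  classical
  refine ⟨fun t => if ht : ∃ n : ℕ, ∃ s ∈ Set.Ico q 1, t = q ^ (2 * n) * s then
    h ht.choose_spec.choose else 0, fun n t ht => ?_, fun t ht => dif_neg ht⟩
  have hex : ∃ m : ℕ, ∃ s ∈ Set.Ico q 1, q ^ (2 * n) * t = q ^ (2 * m) * s := ⟨n, t, ht, rfl⟩
  refine (dif_pos hex).trans ?_
  obtain ⟨hs, he⟩ := hex.choose_spec.choose_spec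
  set m := hex.choose
  set s := hex.choose_spec.choose
  have e : q ^ ((2 * n : ℤ) - 2 * m) * t = s := by
    rw [zpow_sub₀ hq0.ne', div_mul_eq_mul_div, div_eq_iff (zpow_ne_zero _ hq0.ne')]
    have := he
    rw [mul_comm _ s] at this
    exact_mod_cast this
  have h0 := eq_zero_of_zpow_mul_mem_Ico hq0 hq1 ht (e ▸ hs)
  rw [h0, zpow_zero, one_mul] at e
  rw [e]

theorem IsEvenExt.eq_apply (hg : IsEvenExt q h g) (hq0 : 0 < q) (hq1 : q < 1) {u : ℝ}
    (hu : u ∈ Set.Ico q 1)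
    {a : ℤ → ℂ} (ha0 : ∀ m < 0, a m = 0) (ha : ∀ m, a m = (if m = 0 then h u else 0) + a (m - 2))
    (k : ℤ) : a k = g (q ^ k * u) := by
  have hodd : ∀ n : ℕ, a (2 * n + 1) = 0 := by
    intro n
    induction n with
    | zero => rw [ha, if_neg (by omega), zero_add, ha0 _ (by norm_num)]
    | succ n ih =>
      rw [ha, if_neg (by omega), zero_add, ← ih]
      congr 1
      push_cast
      ring
  have heven : ∀ n : ℕ, a (2 * n) = h u := by
    intro n
    induction n with
    | zero => rw [ha, if_pos (by simp), ha0 _ (by norm_num), add_zero]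
    | succ n ih =>
      rw [ha, if_neg (by omega), zero_add, ← ih]
      congr 1
      push_cast
      ring
  by_cases hk : ∃ n : ℕ, k = 2 * n
  · obtain ⟨n, rfl⟩ := hk
    rw [heven, ← hg.1 n u hu]
    congr 1
  · rw [hg.2]
    · rcases lt_or_ge k 0 with h0 | h0
      · exact ha0 k h0
      · obtain ⟨n, hn⟩ := Int.eq_ofNat_of_zero_le h0
        have h1 : k = 2 * ((n / 2 : ℕ) : ℤ) + 1 := by
          by_contra h2
          exact hk ⟨n / 2, by omega⟩
        rw [h1, hodd]
    · rintro ⟨n, s, hs, he⟩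
      refine hk ⟨n, ?_⟩
      have e : q ^ (k - 2 * n) * u = s := by
        rw [zpow_sub₀ hq0.ne', div_mul_eq_mul_div, div_eq_iff (zpow_ne_zero _ hq0.ne'), he,
          mul_comm]
        norm_cast
      have := eq_zero_of_zpow_mul_mem_Ico hq0 hq1 hu (e ▸ hs)
      omega

theorem isOddExt_iff (hq0 : 0 < q) : IsOddExt q h g ↔ IsEvenExt q h fun x => g (q * x) := by
  have e : ∀ (n : ℕ) (t : ℝ), q ^ (2 * n + 1) * t = q * (q ^ (2 * n) * t) := fun n t => by ring
  constructor
  · refine fun H => ⟨fun n t ht => ?_, fun t ht => H.2 _ fun ⟨n, s, hs, hst⟩ => ht ⟨n, s, hs, ?_⟩⟩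
    · rw [← H.1 n t ht, e]
    · rw [e] at hst
      exact mul_left_cancel₀ hq0.ne' hst
  · refine fun H => ⟨fun n t ht => ?_, fun t ht => ?_⟩
    · rw [← H.1 n t ht, e]
    · have := H.2 (q⁻¹ * t) fun ⟨n, s, hs, hst⟩ => ht ⟨n, s, hs, by
        rw [e, ← hst, mul_inv_cancel_left₀ hq0.ne']⟩
      simpa only [mul_inv_cancel_left₀ hq0.ne'] using this

theorem exists_isOddExt (hq0 : 0 < q) (hq1 : q < 1) (h : ℝ → ℂ) : ∃ g, IsOddExt q h g := by
  obtain ⟨g, hg⟩ := exists_isEvenExt hq0 hq1 h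
  refine ⟨fun t => g (q⁻¹ * t), (isOddExt_iff hq0).2 ?_⟩
  simpa only [inv_mul_cancel_left₀ hq0.ne'] using hg

theorem isEvenExtNeg_iff : IsEvenExtNeg q h g ↔ IsEvenExt q h fun x => g (-x) := by
  refine and_congr_right fun _ => ⟨fun H t ht => H _ fun ⟨n, s, hs, e⟩ => ht ⟨n, s, hs, ?_⟩,
    fun H t ht => ?_⟩
  · exact neg_injective e
  · have := H (-t) fun ⟨n, s, hs, e⟩ => ht ⟨n, s, hs, by rw [← e, neg_neg]⟩
    simpa only [neg_neg] using this

theorem isOddExtNeg_iff : IsOddExtNeg q h g ↔ IsOddExt q h fun x => g (-x) := by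
  refine and_congr_right fun _ => ⟨fun H t ht => H _ fun ⟨n, s, hs, e⟩ => ht ⟨n, s, hs, ?_⟩,
    fun H t ht => ?_⟩
  · exact neg_injective e
  · have := H (-t) fun ⟨n, s, hs, e⟩ => ht ⟨n, s, hs, by rw [← e, neg_neg]⟩
    simpa only [neg_neg] using this

end Extension

namespace LinearPMap

variable {H H' : Type*} [NormedAddCommGroup H] [InnerProductSpace ℂ H]
    [NormedAddCommGroup H'] [InnerProductSpace ℂ H']

/-- The operator `Θ T Θ*`. -/
def conj (Θ : H ≃ₗᵢ[ℂ] H') (T : H →ₗ.[ℂ] H) : H' →ₗ.[ℂ] H' where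
  domain := T.domain.comap (Θ.symm : H' →ₗ[ℂ] H)
  toFun := (Θ : H →ₗ[ℂ] H') ∘ₗ T.toFun ∘ₗ (Θ.symm : H' →ₗ[ℂ] H).restrict fun _ h => h

theorem mem_domain_conj {Θ : H ≃ₗᵢ[ℂ] H'} {T : H →ₗ.[ℂ] H} {f : H'} :
    f ∈ (T.conj Θ).domain ↔ Θ.symm f ∈ T.domain := Iff.rfl

theorem mem_graph_conj (Θ : H ≃ₗᵢ[ℂ] H') (T : H →ₗ.[ℂ] H) (f : (T.conj Θ).domain) :
    (Θ.symm f, Θ.symm (T.conj Θ f)) ∈ T.graph :=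
  (T.mem_graph_iff).2 ⟨⟨_, f.2⟩, rfl, (Θ.symm_apply_apply _).symm⟩

theorem transportsPMap_conj (Θ : H ≃ₗᵢ[ℂ] H') (T : H →ₗ.[ℂ] H) :
    TransportsPMap Θ T (T.conj Θ) := by
  refine ⟨fun f => ?_, fun g => g.2⟩
  have hf : Θ f ∈ (T.conj Θ).domain := by
    rw [mem_domain_conj, Θ.symm_apply_apply]
    exact f.2
  refine ⟨hf, ?_⟩
  have h1 := mem_graph_conj Θ T ⟨Θ f, hf⟩
  rw [Θ.symm_apply_apply] at h1
  rw [← LinearPMap.graph_unique h1 (T.mem_graph f), Θ.apply_symm_apply]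

end LinearPMap

namespace IsMulRepresentation

theorem mem_graph_model {H J : Type*} [NormedAddCommGroup H] [InnerProductSpace ℂ H]
    {P X : H →ₗ.[ℂ] H} {μ : J → Measure ℝ} (Θ : H ≃ₗᵢ[ℂ] HS μ)
    (f : ((X.domRestrict (LinearMap.range P.toFun)).conj Θ).domain) :
    (Θ.symm f, Θ.symm ((X.domRestrict (LinearMap.range P.toFun)).conj Θ f)) ∈ X.graph :=
  LinearPMap.le_graph_of_le LinearPMap.domRestrict_le (LinearPMap.mem_graph_conj Θ _ f)

section Model

variable {Ip Im H : Type*} [NormedAddCommGroup H] [InnerProductSpace ℂ H] [CompleteSpace H]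
    {r q : ℝ} {P X : H →ₗ.[ℂ] H} {U : H ≃ₗᵢ[ℂ] H} {E : Set ℝ → (H →L[ℂ] H)}
    {v : Ip ⊕ Im → H} {μ : Ip ⊕ Im → Measure ℝ} {Θ : H ≃ₗᵢ[ℂ] HS μ}
    {ι κ : HS.BdryP q μ × HS.BdryM q μ →ₗ[ℂ] H}

theorem ae_eq_of_isEvenExt (S : IsDilationSystem r q P U E HS.sgn v)
    (hμ : ∀ j, μ j = dilationMeasure q (S.nu j)) (R : IsMulRepresentation r q P U E μ Θ)
    (hι : ∀ z j, ∀ᵐ t ∂μ j, Θ (ι z) j t = HS.liftFun z j t)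
    {e : H} (hQ : E (Set.Ioo (-1) 1) e = e) {z : HS.BdryP q μ × HS.BdryM q μ}
    (he : e - ((r ^ 2 : ℝ) : ℂ) • U.symm (U.symm e) = ι z) {j : Ip ⊕ Im} {g : ℝ → ℂ}
    (hg : IsEvenExt q (HS.bdryFun z j) g) : ∀ᵐ t ∂μ j, Θ e j t = g (HS.sgn j * t) := by
  have hq0 := S.q_pos
  have hr : (r : ℂ) ≠ 0 := by exact_mod_cast S.pos.ne'
  have hrec : ∀ᵐ t ∂μ j, Θ e j t = HS.liftFun z j t + Θ e j (q⁻¹ * (q⁻¹ * t)) := by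
    have he' : e = ι z + ((r ^ 2 : ℝ) : ℂ) • U.symm (U.symm e) := by rw [← he, sub_add_cancel]
    have h0 : ∀ᵐ t ∂μ j, Θ e j t =
        (Θ (ι z) + ((r ^ 2 : ℝ) : ℂ) • Θ (U.symm (U.symm e)) : HS μ) j t := by
      rw [← map_smul, ← map_add, ← he']
      exact .of_forall fun _ => rfl
    filter_upwards [h0, HS.add_ae (Θ (ι z)) (((r ^ 2 : ℝ) : ℂ) • Θ (U.symm (U.symm e))) j, hι z j,
      HS.smul_ae ((r ^ 2 : ℝ) : ℂ) (Θ (U.symm (U.symm e))) j, R.U_symm_ae (U.symm e) j,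
      S.ae_dilate hμ (R.U_symm_ae e j)] with t h1 h2 h3 h4 h5 h6
    have h7 := h6 (-1)
    rw [zpow_neg_one] at h7
    rw [h1, h2, h3, h4, h5, h7]
    push_cast
    field_simp
  have hsupp : ∀ᵐ t ∂μ j, t ∉ Set.Ioo (-1 : ℝ) 1 → Θ e j t = 0 := by
    filter_upwards [R.E_ae _ measurableSet_Ioo e j] with t h1 ht
    rwa [hQ, Set.indicator_of_notMem ht] at h1
  have hlay : ∀ᵐ t ∂μ j, ∃ n : ℤ, q ^ n * t ∈ layer q (HS.sgn j) := by
    rw [hμ j]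
    exact ae_exists_mem_layer hq0 (S.nu_compl_layer j)
  filter_upwards [hlay, S.ae_dilate hμ hrec, S.ae_dilate hμ hsupp] with t ⟨n, hn⟩ h1 h2
  have hmul : ∀ m : ℤ, q ^ m * (q ^ n * t) = q ^ (m + n) * t := fun m => by
    rw [zpow_add₀ hq0.ne', mul_assoc]
  have key := hg.eq_apply hq0 S.lt_one (u := HS.sgn j * (q ^ n * t)) hn
    (a := fun m => Θ e j (q ^ m * (q ^ n * t))) (fun m hm => ?_) (fun m => ?_) (-n)
  · rw [mul_left_comm _ (HS.sgn j)] at key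
    simpa only [hmul, neg_add_cancel, zpow_zero, one_mul] using key
  · simp only [hmul]
    refine h2 _ fun hT => ?_
    have h3 := ((mem_Ioo_iff j _).1 hT).2
    rw [← hmul, mul_left_comm] at h3
    have h4 : q ^ (-1 : ℤ) ≤ q ^ m := zpow_le_zpow_right_of_le_one₀ hq0 S.lt_one.le (by omega)
    rw [zpow_neg_one] at h4
    have h5 := hn.1
    have h6 : q⁻¹ * q ≤ q ^ m * (HS.sgn j * (q ^ n * t)) :=
      mul_le_mul h4 h5 hq0.le (zpow_pos hq0 m).le
    rw [inv_mul_cancel₀ hq0.ne'] at h6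
    linarith
  · simp only [hmul]
    rw [h1 (m + n)]
    have e1 : q⁻¹ * (q⁻¹ * (q ^ (m + n) * t)) = q ^ (m - 2 + n) * t := by
      have : (m - 2 + n : ℤ) = -1 + (-1 + (m + n)) := by ring
      rw [this, zpow_add₀ hq0.ne' (-1), zpow_add₀ hq0.ne' (-1), zpow_neg_one, mul_assoc, mul_assoc]
    rw [e1]
    congr 1
    by_cases hm : m = 0
    · subst hm
      rw [if_pos rfl, zero_add, HS.liftFun, Set.indicator_of_mem hn]
    · rw [if_neg hm, HS.liftFun, Set.indicator_of_notMem]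
      intro h
      rw [← hmul] at h
      exact hm (zpow_layer_eq_zero hq0 S.lt_one hn h)

theorem ae_eq_decomp (S : IsDilationSystem r q P U E HS.sgn v)
    (hμ : ∀ j, μ j = dilationMeasure q (S.nu j)) (R : IsMulRepresentation r q P U E μ Θ)
    (hι : ∀ z j, ∀ᵐ t ∂μ j, Θ (ι z) j t = HS.liftFun z j t)
    (p : H) {e e' : H} (hQ : E (Set.Ioo (-1) 1) e = e) (hQ' : E (Set.Ioo (-1) 1) e' = e')
    {z z' : HS.BdryP q μ × HS.BdryM q μ}
    (he : e - ((r ^ 2 : ℝ) : ℂ) • U.symm (U.symm e) = ι z)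
    (he' : e' - ((r ^ 2 : ℝ) : ℂ) • U.symm (U.symm e') = ι z') {j : Ip ⊕ Im} {g g' : ℝ → ℂ}
    (hg : IsEvenExt q (HS.bdryFun z j) fun x => g (HS.sgn j * x))
    (hg' : IsOddExt q (HS.bdryFun z' j) fun x => g' (HS.sgn j * x)) :
    ∀ᵐ t ∂μ j, Θ (p + e + (r : ℂ) • U.symm e') j t = Θ p j t + g t + g' t := by
  have hq0 := S.q_pos
  have hr : (r : ℂ) ≠ 0 := by exact_mod_cast S.pos.ne'
  rw [map_add, map_add, map_smul]
  filter_upwards [HS.add_ae (Θ p + Θ e) ((r : ℂ) • Θ (U.symm e')) j, HS.add_ae (Θ p) (Θ e) j,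
    HS.smul_ae (r : ℂ) (Θ (U.symm e')) j, R.U_symm_ae e' j,
    ae_eq_of_isEvenExt S hμ R hι hQ he hg,
    S.ae_dilate hμ (ae_eq_of_isEvenExt S hμ R hι hQ' he' ((isOddExt_iff hq0).1 hg'))]
    with t h1 h2 h3 h4 h5 h6
  have h7 := h6 (-1)
  rw [zpow_neg_one] at h7
  rw [h1, h2, h3, h4, h5, h7, mul_inv_cancel_left₀ hr, sgn_mul_sgn_mul (HS.sgn_cases j)]
  congr 2
  rw [mul_left_comm (HS.sgn j) q⁻¹, mul_inv_cancel_left₀ hq0.ne',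
    sgn_mul_sgn_mul (HS.sgn_cases j)]

theorem isPop_conj (R : IsMulRepresentation r q P U E μ Θ) : IsPop μ (P.conj Θ) := by
  refine ⟨fun f => ?_, fun f j => ?_⟩
  · rw [LinearPMap.mem_domain_conj, LinearPMap.mem_domain_iff]
    refine ⟨fun ⟨g, hg⟩ => ⟨Θ g, ?_⟩, fun ⟨g, hg⟩ => ⟨Θ.symm g, ?_⟩⟩
    · simpa only [Θ.apply_symm_apply] using (R.mem_graph_iff _ _).1 hg
    · rw [R.mem_graph_iff]
      simpa only [Θ.apply_symm_apply] using hg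
  · simpa only [Θ.apply_symm_apply] using
      (R.mem_graph_iff _ _).1 (LinearPMap.mem_graph_conj Θ P f) j

theorem isUop_conj (R : IsMulRepresentation r q P U E μ Θ) (hr : q ^ ((1 : ℝ) / 2) = r) :
    IsUop q μ ((Θ.symm.trans U).trans Θ) := by
  intro f j
  have h := R.U_ae (Θ.symm f) j
  rw [Θ.apply_symm_apply] at h
  rw [hr]
  exact h

theorem mem_domain_model (T : IsQTriple r P X U) (Θ : H ≃ₗᵢ[ℂ] HS μ) {f : HS μ} :
    f ∈ ((X.domRestrict (LinearMap.range P.toFun)).conj Θ).domain ↔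
      ∃ k, (k, Θ.symm f) ∈ P.graph := by
  rw [LinearPMap.mem_domain_conj]
  constructor
  · rintro ⟨⟨k, hk⟩, -⟩
    exact ⟨k, P.mem_graph_iff.2 ⟨k, rfl, hk⟩⟩
  · rintro ⟨k, hk⟩
    obtain ⟨y, -, hy⟩ := P.mem_graph_iff.1 hk
    exact ⟨⟨y, hy⟩, LinearPMap.mem_domain_of_mem_graph (T.X_P _ _ hk)⟩

theorem isXop_conj (T : IsQTriple r P X U) (S : IsDilationSystem r q P U E HS.sgn v)
    (hμ : ∀ j, μ j = dilationMeasure q (S.nu j)) (R : IsMulRepresentation r q P U E μ Θ) :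
    IsXop q μ ((X.domRestrict (LinearMap.range P.toFun)).conj Θ) := by
  have hq0 := S.q_pos
  have hr : (r : ℂ) ≠ 0 := by exact_mod_cast S.pos.ne'
  refine ⟨fun f => ?_, fun f j => ?_⟩
  · rw [mem_domain_model T]
    refine ⟨fun ⟨k, hk⟩ => ⟨Θ k, fun j => ?_⟩, fun ⟨g, hg⟩ => ⟨Θ.symm g, ?_⟩⟩
    · filter_upwards [(R.mem_graph_iff _ _).1 hk j, ae_ne_zero S hμ j] with t h1 h2
      rw [Θ.apply_symm_apply] at h1
      rw [h1, inv_mul_cancel_left₀ h2]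
    · refine (R.mem_graph_iff _ _).2 fun j => ?_
      filter_upwards [hg j, ae_ne_zero S hμ j] with t h1 h2
      rw [Θ.apply_symm_apply, Θ.apply_symm_apply, h1, mul_inv_cancel_left₀ h2]
  · obtain ⟨k, hk⟩ := (mem_domain_model T Θ).1 f.2
    have h1 := LinearPMap.graph_unique (mem_graph_model Θ f) (T.X_P _ _ hk)
    rw [Θ.symm_apply_eq, map_smul, map_sub, map_smul, map_smul] at h1
    rw [h1]
    have h2 := (R.mem_graph_iff _ _).1 hk j
    rw [Θ.apply_symm_apply] at h2
    filter_upwards [HS.smul_ae Complex.I ((r : ℂ)⁻¹ • Θ (U.symm k) - (r : ℂ) • Θ (U k)) j,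
      HS.sub_ae ((r : ℂ)⁻¹ • Θ (U.symm k)) ((r : ℂ) • Θ (U k)) j,
      HS.smul_ae (r : ℂ)⁻¹ (Θ (U.symm k)) j, HS.smul_ae (r : ℂ) (Θ (U k)) j, R.U_ae k j,
      R.U_symm_ae k j, S.ae_dilate hμ h2, ae_ne_zero S hμ j] with t h3 h4 h5 h6 h7 h8 h9 h10
    have h11 := h9 (-1)
    have h12 := h9 1
    rw [zpow_neg_one] at h11
    rw [zpow_one] at h12
    rw [h3, h4, h5, h6, h7, h8, h11, h12, ← S.sq]
    push_cast
    field_simp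

theorem conj_le_adjoint (T : IsQTriple r P X U) (Θ : H ≃ₗᵢ[ℂ] HS μ) :
    X.conj Θ ≤ ((X.domRestrict (LinearMap.range P.toFun)).conj Θ).adjoint := by
  refine LinearPMap.IsFormalAdjoint.le_adjoint ?_ fun f g => ?_
  · rw [Submodule.dense_iff_topologicalClosure_eq_top,
      Submodule.topologicalClosure_eq_top_iff, Submodule.eq_bot_iff]
    intro g hg
    rw [Submodule.mem_orthogonal] at hg
    have h : (Θ.symm g, (0 : H)) ∈ P.graph := T.selfAdjoint_P.mem_graph_of_inner fun x y hxy => by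
      rw [inner_zero_left]
      have := hg (Θ y) ((mem_domain_model T Θ).2 ⟨x, by rwa [Θ.symm_apply_apply]⟩)
      rw [← Θ.inner_map_map, Θ.apply_symm_apply, inner_eq_zero_symm.1 this]
    simpa using T.ker_P _ h
  · rw [← Θ.symm.inner_map_map, ← Θ.symm.inner_map_map (f : HS μ)]
    exact T.selfAdjoint_X.inner_graph_comm (mem_graph_model Θ f) (LinearPMap.mem_graph_conj Θ X g)

end Model

end IsMulRepresentation

section Induced

variable {q s : ℝ} {ν : Measure ℝ}

theorem layerMap_dilationMeasure (hq0 : 0 < q) (hq1 : q < 1) (hν : ν (layer q s)ᶜ = 0) :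
    layerMap q s (dilationMeasure q ν) = ν.map fun t => s * t := by
  rw [layerMap, dilationMeasure_restrict_layer hq0 hq1 hν]

theorem dilationMeasure_image (hq0 : 0 < q) (hq1 : q < 1) (hs : s = 1 ∨ s = -1)
    (hν : ν (layer q s)ᶜ = 0) {M : Set ℝ} (hM : MeasurableSet M) (hMs : M ⊆ Set.Ico q 1) (n : ℤ) :
    dilationMeasure q ν ((fun t => s * (q ^ n * t)) '' M) =
      ENNReal.ofReal (q ^ n) * layerMap q s (dilationMeasure q ν) M := by
  have hn : q ^ n ≠ 0 := zpow_ne_zero _ hq0.ne'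
  rw [layerMap_dilationMeasure hq0 hq1 hν, Measure.map_apply (by fun_prop) hM,
    ← dilationMeasure_scaled hq0 hq1 hν n (hM.preimage (by fun_prop)) fun t ht => hMs ht]
  congr 1
  ext t
  constructor
  · rintro ⟨x, hx, rfl⟩
    simp only [Set.mem_preimage]
    rwa [mul_left_comm, sgn_mul_sgn_mul hs, zpow_neg, inv_mul_cancel_left₀ hn]
  · intro ht
    refine ⟨_, ht, ?_⟩
    simp only
    rw [mul_left_comm _ s, sgn_mul_sgn_mul hs, zpow_neg, mul_inv_cancel_left₀ hn]

theorem isInducedPlus_dilationMeasure (hq0 : 0 < q) (hq1 : q < 1) (hν : ν (layer q 1)ᶜ = 0) :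
    IsInducedPlus q (layerMap q 1 (dilationMeasure q ν)) (dilationMeasure q ν) := by
  refine ⟨?_, fun M hM hMs n => ?_⟩
  · refine mem_ae_iff.1 ?_
    filter_upwards [ae_mul_pos hq0 hν] with t ht
    simpa using ht
  · rw [← dilationMeasure_image hq0 hq1 (Or.inl rfl) hν hM hMs]
    simp only [one_mul]

theorem isInducedMinus_dilationMeasure (hq0 : 0 < q) (hq1 : q < 1)
    (hν : ν (layer q (-1))ᶜ = 0) :
    IsInducedMinus q (layerMap q (-1) (dilationMeasure q ν)) (dilationMeasure q ν) := by
  refine ⟨?_, fun M hM hMs n => ?_⟩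
  · refine mem_ae_iff.1 ?_
    filter_upwards [ae_mul_pos hq0 hν] with t ht
    simpa using ht
  · rw [← dilationMeasure_image hq0 hq1 (Or.inr rfl) hν hM hMs]
    simp only [neg_one_mul]

end Induced

namespace IsMulRepresentation

section Model

variable {Ip Im H : Type*} [NormedAddCommGroup H] [InnerProductSpace ℂ H] [CompleteSpace H]
    {r q : ℝ} {P X : H →ₗ.[ℂ] H} {U : H ≃ₗᵢ[ℂ] H} {E : Set ℝ → (H →L[ℂ] H)}
    {v : Ip ⊕ Im → H} {μp : Ip → Measure ℝ} {μm : Im → Measure ℝ}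
    {Θ : H ≃ₗᵢ[ℂ] HS (Sum.elim μp μm)}
    {ι κ : HS.BdryP q (Sum.elim μp μm) × HS.BdryM q (Sum.elim μp μm) →ₗ[ℂ] H}

theorem mem_domain_conj_iff (T : IsQTriple r P X U) (S : IsDilationSystem r q P U E HS.sgn v)
    (hμ : ∀ j, Sum.elim μp μm j = dilationMeasure q (S.nu j))
    (R : IsMulRepresentation r q P U E (Sum.elim μp μm) Θ)
    (hι : ∀ z j, ∀ᵐ t ∂Sum.elim μp μm j, Θ (ι z) j t = HS.liftFun z j t)
    (B : IsBoundaryData r P U (E (Set.Ioo (-1) 1)) ι κ)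
    {V W : HS.BdryM q (Sum.elim μp μm) ≃ₗᵢ[ℂ] HS.BdryP q (Sum.elim μp μm)}
    (hVW : ∀ f, (∃ g, (f, g) ∈ X.graph) ↔ ∃ x p e e' z z', (x, p) ∈ P.graph ∧
      e - ((r ^ 2 : ℝ) : ℂ) • U.symm (U.symm e) = ι z ∧
      e' - ((r ^ 2 : ℝ) : ℂ) • U.symm (U.symm e') = ι z' ∧
      f = p + e + (r : ℂ) • U.symm e' ∧
      z.1 + z'.1 = V (z.2 + z'.2) ∧ z.1 - z'.1 = W (z.2 - z'.2))
    (f : HS (Sum.elim μp μm)) :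
    f ∈ (X.conj Θ).domain ↔ MemXVW q μp μm (fun j => layerMap q 1 (μp j))
      (fun j => layerMap q (-1) (μm j)) ((X.domRestrict (LinearMap.range P.toFun)).conj Θ)
      V W f := by
  have hq0 := S.q_pos
  have hdom : f ∈ (X.conj Θ).domain ↔ ∃ g, (Θ.symm f, g) ∈ X.graph := by
    rw [LinearPMap.mem_domain_conj, LinearPMap.mem_domain_iff]
  constructor
  · intro hf
    obtain ⟨x, p, e, e', z, z', hp, he, he', hfe, hV, hW⟩ := (hVW _).1 (hdom.1 hf)
    refine ⟨z.1, z'.1, z.2, z'.2, ⟨(conj_le_adjoint T Θ).1 hf, Θ p, ?_, fun i => ?_, fun i => ?_⟩,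
      hV, hW⟩
    · rw [mem_domain_model T, Θ.symm_apply_apply]
      exact ⟨x, hp⟩
    all_goals
      have hQ := T.Q_resolvent B he (B.Q_ι z)
      have hQ' := T.Q_resolvent B he' (B.Q_ι z')
    · obtain ⟨g, hg⟩ := exists_isEvenExt hq0 S.lt_one (z.1 i)
      obtain ⟨g', hg'⟩ := exists_isOddExt hq0 S.lt_one (z'.1 i)
      refine ⟨g, g', hg, hg', ?_⟩
      have := ae_eq_decomp S hμ R hι p hQ hQ' he he' (j := Sum.inl i) (g := g)
        (g' := g') (by simpa only [HS.bdryFun, HS.sgn, Sum.elim_inl, one_mul] using hg)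
        (by simpa only [HS.bdryFun, HS.sgn, Sum.elim_inl, one_mul] using hg')
      rwa [← hfe, Θ.apply_symm_apply] at this
    · obtain ⟨g, hg⟩ := exists_isEvenExt hq0 S.lt_one (z.2 i)
      obtain ⟨g', hg'⟩ := exists_isOddExt hq0 S.lt_one (z'.2 i)
      refine ⟨fun t => g (-t), fun t => g' (-t), isEvenExtNeg_iff.2 (by simpa using hg),
        isOddExtNeg_iff.2 (by simpa using hg'), ?_⟩
      have := ae_eq_decomp S hμ R hι p hQ hQ' he he' (j := Sum.inr i) (g := fun t => g (-t))
        (g' := fun t => g' (-t))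
        (by simpa only [HS.bdryFun, HS.sgn, Sum.elim_inr, neg_one_mul, neg_neg] using hg)
        (by simpa only [HS.bdryFun, HS.sgn, Sum.elim_inr, neg_one_mul, neg_neg] using hg')
      rwa [← hfe, Θ.apply_symm_apply] at this
  · rintro ⟨be, bo, ce, co, ⟨-, fX, hfX, h1, h2⟩, hV, hW⟩
    obtain ⟨K, hK, -⟩ := (U.symm * U.symm).exists_resolvent (sq_nonneg r) T.sq_lt_one
    replace hK : ∀ f, K f - ((r ^ 2 : ℝ) : ℂ) • U.symm (U.symm (K f)) = f := hK
    obtain ⟨x, hx⟩ := (mem_domain_model T Θ).1 hfX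
    refine hdom.2 ((hVW _).2 ⟨x, Θ.symm fX, K (ι (be, ce)), K (ι (bo, co)), (be, ce), (bo, co),
      hx, hK _, hK _, ext_ae (Θ := Θ) ?_, hV, hW⟩)
    have hQ := T.Q_resolvent B (hK (ι (be, ce))) (B.Q_ι _)
    have hQ' := T.Q_resolvent B (hK (ι (bo, co))) (B.Q_ι _)
    rintro (i | i)
    · obtain ⟨g, g', hg, hg', h⟩ := h1 i
      filter_upwards [h, ae_eq_decomp S hμ R hι (Θ.symm fX) hQ hQ' (hK _) (hK _)
        (j := Sum.inl i) (g := g) (g' := g')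
        (by simpa only [HS.bdryFun, HS.sgn, Sum.elim_inl, one_mul] using hg)
        (by simpa only [HS.bdryFun, HS.sgn, Sum.elim_inl, one_mul] using hg')] with t h3 h4
      rw [h4, Θ.apply_symm_apply, Θ.apply_symm_apply, h3]
    · obtain ⟨g, g', hg, hg', h⟩ := h2 i
      filter_upwards [h, ae_eq_decomp S hμ R hι (Θ.symm fX) hQ hQ' (hK _) (hK _)
        (j := Sum.inr i) (g := g) (g' := g')
        (by simpa only [HS.bdryFun, HS.sgn, Sum.elim_inr, neg_one_mul] using isEvenExtNeg_iff.1 hg)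
        (by simpa only [HS.bdryFun, HS.sgn, Sum.elim_inr, neg_one_mul] using isOddExtNeg_iff.1 hg')]
        with t h3 h4
      rw [h4, Θ.apply_symm_apply, Θ.apply_symm_apply, h3]

end Model

end IsMulRepresentation

/-- The commutation relations of the triple on a common core, in graph form. -/
theorem IsQTriple.of_commutation {H : Type*} [NormedAddCommGroup H] [InnerProductSpace ℂ H]
    [CompleteSpace H] {r c : ℝ} (hr0 : 0 < r) (hr1 : r < 1) (hc : c = r ^ 3 - r⁻¹)
    {P X : H →ₗ.[ℂ] H} (hP : IsSelfAdjoint P) (hX : IsSelfAdjoint X) {U : H ≃ₗᵢ[ℂ] H}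
    {D : Submodule ℂ H} (hD : ∀ f ∈ D, ∃ (hfP : f ∈ P.domain) (hfX : f ∈ X.domain),
      P ⟨f, hfP⟩ ∈ X.domain ∧ X ⟨f, hfX⟩ ∈ P.domain)
    (hU : ∀ f ∈ D, U f ∈ P.domain ∧ U f ∈ X.domain)
    (hPU : ∀ (f : H) (_ : f ∈ D) (hfP : f ∈ P.domain) (hUfP : U f ∈ P.domain),
      U (P ⟨f, hfP⟩) = ((r ^ 2 : ℝ) : ℂ) • P ⟨U f, hUfP⟩)
    (hXU : ∀ (f : H) (_ : f ∈ D) (hfX : f ∈ X.domain) (hUfX : U f ∈ X.domain),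
      U (X ⟨f, hfX⟩) = ((r ^ 2 : ℝ) : ℂ)⁻¹ • X ⟨U f, hUfX⟩)
    (hPX : ∀ (f : H) (_ : f ∈ D) (hfP : f ∈ P.domain) (hfX : f ∈ X.domain)
      (h1 : P ⟨f, hfP⟩ ∈ X.domain) (h2 : X ⟨f, hfX⟩ ∈ P.domain),
      P ⟨X ⟨f, hfX⟩, h2⟩ - ((r ^ 2 : ℝ) : ℂ) • X ⟨P ⟨f, hfP⟩, h1⟩ = (Complex.I * (c : ℂ)) • U f)
    (hXP : ∀ (f : H) (_ : f ∈ D) (hfP : f ∈ P.domain) (hfX : f ∈ X.domain)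
      (h1 : P ⟨f, hfP⟩ ∈ X.domain) (h2 : X ⟨f, hfX⟩ ∈ P.domain),
      X ⟨P ⟨f, hfP⟩, h1⟩ - ((r ^ 2 : ℝ) : ℂ) • P ⟨X ⟨f, hfX⟩, h2⟩ =
        (-(Complex.I * (c : ℂ))) • U.symm f)
    (hcP : (P.domRestrict D).closure = P) (hcX : (X.domRestrict D).closure = X) :
    IsQTriple r P X U := by
  have hr : (r : ℂ) ≠ 0 := by exact_mod_cast hr0.ne'
  have hr2 : ((r ^ 2 : ℝ) : ℂ) ≠ 0 := by exact_mod_cast (pow_pos hr0 2).ne'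
  have hr4 : (1 - (r : ℂ) ^ 4) ≠ 0 := by
    have : (1 - r ^ 4 : ℝ) ≠ 0 := (sub_pos.2 (pow_lt_one₀ hr0.le hr1 (by norm_num))).ne'
    exact_mod_cast this
  have hcr : (c : ℂ) = -((1 - (r : ℂ) ^ 4) * (r : ℂ)⁻¹) := by
    rw [hc]; push_cast; field_simp; ring
  have hq2 : ((r ^ 2 : ℝ) : ℂ) = (r : ℂ) ^ 2 := by push_cast; rfl
  refine .of_core hr0 hr1 hP hX hcP hcX (fun f g hf h => ?_) (fun f g hf h => ?_)
    (fun f g hf h => ?_) fun f hf => ?_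
  · obtain ⟨⟨x, hx⟩, rfl, rfl⟩ := P.mem_graph_iff.1 h
    refine P.mem_graph_iff.2 ⟨⟨U x, (hU x hf).1⟩, rfl, ?_⟩
    rw [hPU x hf hx (hU x hf).1, inv_smul_smul₀ hr2]
  · obtain ⟨⟨x, hx⟩, rfl, rfl⟩ := X.mem_graph_iff.1 h
    refine X.mem_graph_iff.2 ⟨⟨U x, (hU x hf).2⟩, rfl, ?_⟩
    rw [hXU x hf hx (hU x hf).2, smul_inv_smul₀ hr2]
  · obtain ⟨⟨x, hx⟩, rfl, rfl⟩ := P.mem_graph_iff.1 h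
    obtain ⟨hfP, hfX, h1, h2⟩ := hD x hf
    refine X.mem_graph_iff.2 ⟨⟨_, h1⟩, rfl, ?_⟩
    have e1 := hPX x hf hfP hfX h1 h2
    have e2 := hXP x hf hfP hfX h1 h2
    refine smul_right_injective H hr4 ?_
    dsimp only
    rw [hcr, hq2] at e1 e2
    linear_combination (norm := skip) e2 + (r : ℂ) ^ 2 • e1
    match_scalars <;> simp <;> field_simp <;> ring
  · obtain ⟨hfP, hfX, h1, h2⟩ := hD f hf
    refine ⟨X ⟨f, hfX⟩, P.mem_graph_iff.2 ⟨⟨_, h2⟩, rfl, ?_⟩⟩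
    have e1 := hPX f hf hfP hfX h1 h2
    have e2 := hXP f hf hfP hfX h1 h2
    refine smul_right_injective H hr4 ?_
    dsimp only
    rw [hcr, hq2] at e1 e2
    linear_combination (norm := skip) e1 + (r : ℂ) ^ 2 • e2
    match_scalars <;> simp <;> field_simp <;> ring

/-- **Proposition 6.** Any triple `{P', X', U'}` of two self-adjoint
operators and a unitary satisfying (i)–(iii) is unitarily equivalent to a model triple
`{P, X_{V,W}, U}` of Section II. -/
theorem stmt_15 (q : ℝ) (hq0 : 0 < q) (hq1 : q < 1)
    {H : Type} [NormedAddCommGroup H] [InnerProductSpace ℂ H] [CompleteSpace H]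
    (P' X' : H →ₗ.[ℂ] H) (hP'sa : IsSelfAdjoint P') (hX'sa : IsSelfAdjoint X')
    (U' : H ≃ₗᵢ[ℂ] H)
    (E : Set ℝ → (H →L[ℂ] H)) (hE : IsSpectralMeasure P' E)
    (D₁ : Submodule ℂ H)
    (hD₁dom : ∀ f ∈ D₁, ∃ (hfP : f ∈ P'.domain) (hfX : f ∈ X'.domain),
      P' ⟨f, hfP⟩ ∈ X'.domain ∧ X' ⟨f, hfX⟩ ∈ P'.domain)
    (hi₁ : ∀ f : H, E (Set.Ico q 1) f ∈ D₁)
    (hi₂ : ∀ f : H, E (Set.Ioc (-1) (-q)) f ∈ D₁)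
    (hiiU : ∀ f ∈ D₁, U' f ∈ P'.domain ∧ U' f ∈ X'.domain)
    (hii₁ : ∀ (f : H) (hf : f ∈ D₁) (hfP : f ∈ P'.domain) (hUfP : U' f ∈ P'.domain),
      U' (P' ⟨f, hfP⟩) = (q : ℂ) • P' ⟨U' f, hUfP⟩)
    (hii₂ : ∀ (f : H) (hf : f ∈ D₁) (hfX : f ∈ X'.domain) (hUfX : U' f ∈ X'.domain),
      U' (X' ⟨f, hfX⟩) = (q : ℂ)⁻¹ • X' ⟨U' f, hUfX⟩)
    (hii₃ : ∀ (f : H) (hf : f ∈ D₁) (hfP : f ∈ P'.domain) (hfX : f ∈ X'.domain)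
      (h1 : P' ⟨f, hfP⟩ ∈ X'.domain) (h2 : X' ⟨f, hfX⟩ ∈ P'.domain),
      P' ⟨X' ⟨f, hfX⟩, h2⟩ - (q : ℂ) • X' ⟨P' ⟨f, hfP⟩, h1⟩ =
        (Complex.I * ((q ^ ((3 : ℝ)/2) - q ^ (-(1 : ℝ)/2) : ℝ) : ℂ)) • U' f)
    (hii₄ : ∀ (f : H) (hf : f ∈ D₁) (hfP : f ∈ P'.domain) (hfX : f ∈ X'.domain)
      (h1 : P' ⟨f, hfP⟩ ∈ X'.domain) (h2 : X' ⟨f, hfX⟩ ∈ P'.domain),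
      X' ⟨P' ⟨f, hfP⟩, h1⟩ - (q : ℂ) • P' ⟨X' ⟨f, hfX⟩, h2⟩ =
        (-(Complex.I * ((q ^ ((3 : ℝ)/2) - q ^ (-(1 : ℝ)/2) : ℝ) : ℂ))) • U'.symm f)
    (hcoreP : (P'.domRestrict D₁).closure = P')
    (hcoreX : (X'.domRestrict D₁).closure = X') :
    ∃ (Ip Im : Type) (μ1p : Ip → Measure ℝ) (μ1m : Im → Measure ℝ),
      (∀ j, IsFiniteMeasure (μ1p j)) ∧ (∀ j, IsFiniteMeasure (μ1m j)) ∧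
      (∀ j, μ1p j (Set.Ico q 1)ᶜ = 0) ∧ (∀ j, μ1m j (Set.Ico q 1)ᶜ = 0) ∧
      ∃ (μp : Ip → Measure ℝ) (μm : Im → Measure ℝ),
        (∀ j, IsInducedPlus q (μ1p j) (μp j)) ∧
        (∀ j, IsInducedMinus q (μ1m j) (μm j)) ∧
        ∃ (U : HS (Sum.elim μp μm) ≃ₗᵢ[ℂ] HS (Sum.elim μp μm))
          (P X : HS (Sum.elim μp μm) →ₗ.[ℂ] HS (Sum.elim μp μm)),
          IsUop q (Sum.elim μp μm) U ∧ IsPop (Sum.elim μp μm) P ∧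
          IsXop q (Sum.elim μp μm) X ∧
          ∃ (V W : HS (fun j => wd (μ1m j)) ≃ₗᵢ[ℂ] HS (fun j => wd (μ1p j)))
            (Y : HS (Sum.elim μp μm) →ₗ.[ℂ] HS (Sum.elim μp μm)),
            Y ≤ X.adjoint ∧
            (∀ f, f ∈ Y.domain ↔ MemXVW q μp μm μ1p μ1m X V W f) ∧
            ∃ Θ : H ≃ₗᵢ[ℂ] HS (Sum.elim μp μm),
              TransportsPMap Θ P' P ∧ TransportsPMap Θ X' Y ∧
              ∀ f : H, Θ (U' f) = U (Θ f) := by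
  obtain ⟨r, hr0, rfl⟩ : ∃ r : ℝ, 0 < r ∧ q = r ^ 2 :=
    ⟨√q, Real.sqrt_pos.2 hq0, (Real.sq_sqrt hq0.le).symm⟩
  have hpow : ∀ x : ℝ, (r ^ 2) ^ x = r ^ (2 * x) := fun x => by
    rw [Real.rpow_mul hr0.le, Real.rpow_two]
  have hr1 : r < 1 := by nlinarith
  have hc : (r ^ 2) ^ ((3 : ℝ) / 2) - (r ^ 2) ^ (-(1 : ℝ) / 2) = r ^ 3 - r⁻¹ := by
    rw [hpow, hpow, mul_div_cancel₀ _ two_ne_zero, mul_div_cancel₀ _ two_ne_zero,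
      Real.rpow_neg_one]
    norm_cast
  have T : IsQTriple r P' X' U' := .of_commutation hr0 hr1 hc hP'sa hX'sa hD₁dom hiiU hii₁ hii₂
    hii₃ hii₄ hcoreP hcoreX
  obtain ⟨Ip, Im, v, hv⟩ := hE.exists_layerFamily hq0
  have S : IsDilationSystem r (r ^ 2) P' U' E HS.sgn v :=
    ⟨hr0, hq1, rfl, hP'sa, hE, fun _ _ => T.P_U _ _, fun _ _ => T.P_U_symm, T.ker_P, hv⟩
  let μp : Ip → Measure ℝ := fun i => dilationMeasure (r ^ 2) (S.nu (.inl i))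
  let μm : Im → Measure ℝ := fun i => dilationMeasure (r ^ 2) (S.nu (.inr i))
  have hμ : ∀ j, Sum.elim μp μm j = dilationMeasure (r ^ 2) (S.nu j) := by
    rintro (i | i) <;> rfl
  obtain ⟨Θ, hΘ⟩ := S.exists_unitary hμ
  have R := S.isMulRepresentation hμ hΘ
  obtain ⟨ι, κ, hι, hκ⟩ := IsMulRepresentation.exists_boundaryMaps hq0 Θ
  have B := IsMulRepresentation.isBoundaryData S hμ R hι hκ
  obtain ⟨V, W, hVW⟩ := T.exists_extension_unitaries B
  refine ⟨Ip, Im, fun i => layerMap (r ^ 2) 1 (μp i), fun i => layerMap (r ^ 2) (-1) (μm i),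
    fun i => ?_, fun i => ?_, fun i => mem_ae_iff.1 (ae_mem_Ico_layerMap (.inl rfl)),
    fun i => mem_ae_iff.1 (ae_mem_Ico_layerMap (.inr rfl)), μp, μm,
    fun i => isInducedPlus_dilationMeasure hq0 hq1 (S.nu_compl_layer (.inl i)),
    fun i => isInducedMinus_dilationMeasure hq0 hq1 (S.nu_compl_layer (.inr i)),
    (Θ.symm.trans U').trans Θ, P'.conj Θ, (X'.domRestrict (LinearMap.range P'.toFun)).conj Θ,
    R.isUop_conj ?_, R.isPop_conj, IsMulRepresentation.isXop_conj T S hμ R, V, W, X'.conj Θ,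
    IsMulRepresentation.conj_le_adjoint T Θ,
    IsMulRepresentation.mem_domain_conj_iff T S hμ R hι B hVW, Θ,
    LinearPMap.transportsPMap_conj Θ P', LinearPMap.transportsPMap_conj Θ X', fun f => ?_⟩
  · simp only [μp]
    rw [layerMap_dilationMeasure (s := 1) hq0 hq1 (S.nu_compl_layer (.inl i))]
    infer_instance
  · simp only [μm]
    rw [layerMap_dilationMeasure (s := -1) hq0 hq1 (S.nu_compl_layer (.inr i))]
    infer_instance
  · rw [hpow, mul_div_cancel₀ _ two_ne_zero, Real.rpow_one]
  · simp

end
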